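/- Assume the Riemann Hypothesis. Then, as N → ∞, Σ_{n=N+1}^{N+H} r(n) = (π/4) H N + O( H^{1/2} N (log N)² + H N^{3/4} (log N)³ + H² (log N)^{3/2} ), uniformly for H in the range (log N)⁴ = o(H) and H = o( N (log N)^{−3/2} ). -/

import Mathlib

open Finset Filter Asymptotics

/-- `r(n) = ∑_{p₁ + p₂² + p₃² = n} log p₁ log p₂ log p₃`, the sum running over triples
of primes, counting weighted representations of `n` as a prime plus two prime squares. -/
noncomputable def rPrime2Sq (n : ℕ) : ℝ :=
  ∑ p1 ∈ Finset.range (n + 1), ∑ p2 ∈ Finset.range (n + 1), ∑ p3 ∈ Finset.range (n + 1),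
    if p1.Prime ∧ p2.Prime ∧ p3.Prime ∧ p1 + p2 ^ 2 + p3 ^ 2 = n then
      Real.log p1 * Real.log p2 * Real.log p3
    else 0

/-- Counting a predicate of period `d` on an initial segment. -/
theorem abs_count_sub_le_of_periodic {d : ℕ} (hd : 0 < d) (f : ℕ → Prop) [DecidablePred f]
    (hf : ∀ n, f (n + d) ↔ f n) (T : ℕ) :
    |(Nat.count f T : ℝ) - Nat.count f d * T / d| ≤ Nat.count f d := by
  have hper : ∀ q k, f (d * q + k) ↔ f k := by
    intro q
    induction q with
    | zero => intro k; simp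
    | succ q ih => intro k; rw [← ih k, ← hf (d * q + k)]; ring_nf
  have hmul : ∀ q, Nat.count f (d * q) = q * Nat.count f d := by
    intro q
    induction q with
    | zero => simp
    | succ q ih =>
      rw [Nat.mul_succ, Nat.count_add, ih]
      simp only [hper]; ring
  have hT : Nat.count f T = (T / d) * Nat.count f d + Nat.count f (T % d) := by
    conv_lhs => rw [← Nat.div_add_mod T d, Nat.count_add, hmul]
    simp only [hper]
  have hle : Nat.count f (T % d) ≤ Nat.count f d := Nat.count_monotone _ (Nat.mod_lt _ hd).le
  have hTd : (T : ℝ) = d * (T / d : ℕ) + (T % d : ℕ) := by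
    exact_mod_cast (Nat.div_add_mod T d).symm
  have hm : ((T % d : ℕ) : ℝ) ≤ d := by exact_mod_cast (Nat.mod_lt _ hd).le
  have hd' : (0 : ℝ) < d := by exact_mod_cast hd
  have h1 : (Nat.count f d : ℝ) * T / d
      = (T / d : ℕ) * Nat.count f d + Nat.count f d * ((T % d : ℕ) / d) := by
    rw [hTd]
    have : (d * (T / d : ℕ) + (T % d : ℕ)) / d = T / d := by rw [Nat.div_add_mod]
    field_simp
  rw [h1, hT]
  push_cast
  have hr : ((T % d : ℕ) : ℝ) / d ≤ 1 := by rw [div_le_one hd']; exact hm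
  have hr0 : 0 ≤ ((T % d : ℕ) : ℝ) / d := by positivity
  have hle' : (Nat.count f (T % d) : ℝ) ≤ Nat.count f d := by exact_mod_cast hle
  have hc : (0 : ℝ) ≤ Nat.count f d := by positivity
  have hc' : (0 : ℝ) ≤ Nat.count f (T % d) := by positivity
  rw [abs_le]
  constructor <;> nlinarith

/-- The Chinese remainder theorem for counting. -/
theorem count_forall_eq_prod (B : Finset ℕ) (hB : ∀ p ∈ B, p.Prime) (bad : ℕ → ℕ → Prop)
    [∀ p, DecidablePred (bad p)] (hbad : ∀ p ∈ B, ∀ n, bad p (n + p) ↔ bad p n) :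
    Nat.count (fun n => ∀ p ∈ B, bad p n) (∏ p ∈ B, p) = ∏ p ∈ B, Nat.count (bad p) p := by
  induction B using Finset.induction_on with
  | empty => simp
  | insert q B hq ih =>
    have ih := ih (fun p hp => hB p (mem_insert_of_mem hp))
      (fun p hp => hbad p (mem_insert_of_mem hp))
    rw [prod_insert hq, prod_insert hq, ← ih]
    set d := ∏ p ∈ B, p with hd
    have hcop : Nat.Coprime q d := Nat.Coprime.prod_right fun p hp =>
      (Nat.coprime_primes (hB q (mem_insert_self _ _)) (hB p (mem_insert_of_mem hp))).2
        (fun h => hq (h ▸ hp))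
    have hq0 : 0 < q := (hB q (mem_insert_self _ _)).pos
    have hd0 : 0 < d := prod_pos fun p hp => (hB p (mem_insert_of_mem hp)).pos
    have hmodp : ∀ p ∈ insert q B, ∀ n, bad p (n % p) ↔ bad p n := by
      intro p hp n
      have : ∀ k, bad p (n % p + p * k) ↔ bad p (n % p) := by
        intro k
        induction k with
        | zero => simp
        | succ k ih => rw [Nat.mul_succ, ← add_assoc, hbad p hp, ih]
      rw [← this (n / p), Nat.mod_add_div]
    have hcongr : ∀ p ∈ insert q B, ∀ m n, m ≡ n [MOD p] → (bad p m ↔ bad p n) := by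
      intro p hp m n h
      rw [← hmodp p hp m, ← hmodp p hp n, h]
    have hdvd : ∀ p ∈ B, p ∣ d := fun p hp => dvd_prod_of_mem _ hp
    simp only [Nat.count_eq_card_filter_range]
    rw [← card_product]
    refine card_bij (fun n _ => (n % q, n % d)) ?_ ?_ ?_
    · intro n hn
      simp only [mem_filter, mem_range, mem_product] at hn ⊢
      refine ⟨⟨Nat.mod_lt _ hq0, (hmodp q (mem_insert_self _ _) n).2 (hn.2 q (mem_insert_self _ _))⟩,
        Nat.mod_lt _ hd0, fun p hp => ?_⟩
      exact (hcongr p (mem_insert_of_mem hp) _ _ ((Nat.mod_modEq n d).of_dvd (hdvd p hp))).2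
        (hn.2 p (mem_insert_of_mem hp))
    · intro m hm n hn h
      simp only [mem_filter, mem_range, Prod.mk.injEq] at hm hn h
      exact Nat.ModEq.eq_of_lt_of_lt ((Nat.modEq_and_modEq_iff_modEq_mul hcop).1 h) hm.1 hn.1
    · rintro ⟨a, b⟩ hab
      simp only [mem_filter, mem_range, mem_product] at hab
      obtain ⟨k, hk1, hk2⟩ := Nat.chineseRemainder hcop a b
      have h1 : k % (q * d) ≡ a [MOD q] := ((Nat.mod_modEq k _).of_dvd (dvd_mul_right _ _)).trans hk1
      have h2 : k % (q * d) ≡ b [MOD d] := ((Nat.mod_modEq k _).of_dvd (dvd_mul_left _ _)).trans hk2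
      refine ⟨k % (q * d), ?_, ?_⟩
      · simp only [mem_filter, mem_range]
        refine ⟨Nat.mod_lt _ (by positivity), fun p hp => ?_⟩
        rcases mem_insert.1 hp with rfl | hp'
        · exact (hcongr p hp _ _ h1).2 hab.1.2
        · exact (hcongr p hp _ _ (h2.of_dvd (hdvd p hp'))).2 (hab.2.2 p hp')
      · simp only [Prod.mk.injEq]
        exact ⟨Nat.mod_eq_of_modEq h1 hab.1.1, Nat.mod_eq_of_modEq h2 hab.2.1⟩

/-- An even truncation of the alternating sum over subsets bounds the indicator of emptiness
from above. -/
theorem indicator_le_sum_powerset_truncated (A : Finset ℕ) (r : ℕ) :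
    (if A = ∅ then (1 : ℝ) else 0) ≤
      ∑ B ∈ A.powerset with B.card ≤ 2 * r, (-1 : ℝ) ^ B.card := by
  have h : ∑ B ∈ A.powerset with B.card ≤ 2 * r, (-1 : ℝ) ^ B.card
      = ∑ j ∈ range (2 * r + 1), (-1 : ℝ) ^ j * (A.card.choose j) := by
    rw [← sum_fiberwise_of_maps_to (g := Finset.card) (t := range (2 * r + 1))]
    · refine sum_congr rfl fun j hj => ?_
      rw [sum_congr rfl (g := fun _ => (-1 : ℝ) ^ j), sum_const, nsmul_eq_mul, mul_comm]
      · congr 2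
        rw [← card_powersetCard]
        congr 1
        ext B
        simp only [mem_filter, mem_powerset, mem_powersetCard, mem_range] at hj ⊢
        constructor
        · rintro ⟨⟨h1, _⟩, h3⟩; exact ⟨h1, h3⟩
        · rintro ⟨h1, h3⟩; exact ⟨⟨h1, by omega⟩, h3⟩
      · intro B hB
        rw [(mem_filter.1 hB).2]
    · intro B hB
      simp only [mem_filter, mem_range] at hB ⊢
      omega
  rw [h]
  rcases A.eq_empty_or_nonempty with rfl | hA
  · rw [sum_range_succ']
    simp
  · rw [if_neg hA.ne_empty]
    obtain ⟨k, hk⟩ : ∃ k, A.card = k + 1 := ⟨A.card - 1, by have := hA.card_pos; omega⟩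
    have := Int.alternating_sum_range_choose_eq_choose (n := k) (m := 2 * r)
    rw [hk]
    have h2 : ((∑ j ∈ range (2 * r + 1), ((-1) ^ j * ((k + 1).choose j) : ℤ) : ℤ) : ℝ)
       = ∑ j ∈ range (2 * r + 1), (-1 : ℝ) ^ j * ((k + 1).choose j) := by push_cast; rfl
    rw [← h2]
    simp at this
    rw [this]
    positivity

/-- Brun's pure sieve, removing four residue classes modulo each prime of `P`. -/
theorem brun_pure_sieve (P : Finset ℕ) (hP : ∀ p ∈ P, p.Prime) (bad : ℕ → ℕ → Prop)
    [∀ p, DecidablePred (bad p)] (hbad : ∀ p ∈ P, ∀ n, bad p (n + p) ↔ bad p n)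
    (hcount : ∀ p ∈ P, Nat.count (bad p) p = 4) {z : ℝ} (hz : 1 ≤ z) (hcard : (#P : ℝ) ≤ z)
    (T r : ℕ) :
    (#{n ∈ range T | ∀ p ∈ P, ¬ bad p n} : ℝ) ≤
      T * (∏ p ∈ P, (1 - 4 / (p : ℝ)) + Real.exp (-(2 * r) + 11 * ∑ p ∈ P, 1 / (p : ℝ)))
        + Real.exp 4 * z ^ (2 * r) := by
  classical
  set F := P.powerset.filter (fun B => B.card ≤ 2 * r) with hF
  have hsub : ∀ B ∈ F, B ⊆ P := fun B hB => mem_powerset.1 (mem_filter.1 hB).1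
  have h1 : (#{n ∈ range T | ∀ p ∈ P, ¬ bad p n} : ℝ) ≤
      ∑ B ∈ F, (-1 : ℝ) ^ B.card * Nat.count (fun n => ∀ p ∈ B, bad p n) T := by
    have hl : (#{n ∈ range T | ∀ p ∈ P, ¬ bad p n} : ℝ)
        = ∑ n ∈ range T, if P.filter (fun p => bad p n) = ∅ then (1 : ℝ) else 0 := by
      rw [card_filter]
      push_cast
      refine sum_congr rfl fun n _ => ?_
      simp only [filter_eq_empty_iff]
    rw [hl]
    refine (sum_le_sum fun n _ => indicator_le_sum_powerset_truncated _ r).trans_eq ?_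
    have : ∀ n, ∑ B ∈ (P.filter (fun p => bad p n)).powerset with B.card ≤ 2 * r,
        (-1 : ℝ) ^ B.card = ∑ B ∈ F, if ∀ p ∈ B, bad p n then (-1 : ℝ) ^ B.card else 0 := by
      intro n
      rw [← sum_filter]
      refine sum_congr ?_ fun _ _ => rfl
      ext B
      simp only [hF, mem_filter, mem_powerset, subset_iff]
      constructor
      · rintro ⟨h, h'⟩
        exact ⟨⟨fun p hp => (h hp).1, h'⟩, fun p hp => (h hp).2⟩
      · rintro ⟨⟨h, h'⟩, h''⟩
        exact ⟨fun p hp => ⟨h hp, h'' p hp⟩, h'⟩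
    rw [sum_congr rfl fun n _ => this n, sum_comm]
    refine sum_congr rfl fun B _ => ?_
    rw [← sum_filter, sum_const, nsmul_eq_mul, Nat.count_eq_card_filter_range, mul_comm]
  have hBcount : ∀ B ∈ F, Nat.count (fun n => ∀ p ∈ B, bad p n) (∏ p ∈ B, p) = 4 ^ B.card := by
    intro B hB
    rw [count_forall_eq_prod B (fun p hp => hP p (hsub B hB hp)) bad
      (fun p hp => hbad p (hsub B hB hp)),
      prod_congr rfl (fun p hp => hcount p (hsub B hB hp)), prod_const]
  have h2 : ∀ B ∈ F, (-1 : ℝ) ^ B.card * Nat.count (fun n => ∀ p ∈ B, bad p n) T ≤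
      T * ∏ p ∈ B, (-(4 / (p : ℝ))) + 4 ^ B.card := by
    intro B hB
    have hpos : 0 < ∏ p ∈ B, p := prod_pos fun p hp => (hP p (hsub B hB hp)).pos
    have hper : ∀ n, (∀ p ∈ B, bad p (n + ∏ p ∈ B, p)) ↔ ∀ p ∈ B, bad p n := by
      intro n
      refine forall₂_congr fun p hp => ?_
      obtain ⟨k, hk⟩ : p ∣ ∏ p ∈ B, p := dvd_prod_of_mem _ hp
      rw [hk]
      clear hk
      induction k with
      | zero => simp
      | succ k ih => rw [Nat.mul_succ, ← add_assoc, hbad p (hsub B hB hp), ih]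
    have := abs_count_sub_le_of_periodic hpos (fun n => ∀ p ∈ B, bad p n) hper T
    rw [hBcount B hB] at this
    push_cast at this
    have hprod : ∏ p ∈ B, (-(4 / (p : ℝ))) = (-1) ^ B.card * (4 ^ B.card / ∏ p ∈ B, (p : ℝ)) := by
      rw [prod_congr rfl (g := fun p : ℕ => (-1 : ℝ) * (4 / p)) (fun _ _ => by ring),
        prod_mul_distrib, prod_const, prod_div_distrib, prod_const]
    rw [hprod]
    rcases neg_one_pow_eq_or ℝ B.card with h | h <;> rw [h] <;>
      · rw [abs_le] at this
        have e : (4 : ℝ) ^ #B * T / ∏ p ∈ B, (p : ℝ) = T * (4 ^ #B / ∏ p ∈ B, (p : ℝ)) := by ring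
        rw [e] at this
        nlinarith [this.1, this.2]
  have h3 : ∑ B ∈ F, (4 : ℝ) ^ B.card ≤ Real.exp 4 * z ^ (2 * r) := by
    have hz0 : 0 < z := by linarith
    calc ∑ B ∈ F, (4 : ℝ) ^ B.card ≤ ∑ B ∈ F, z ^ (2 * r) * ∏ p ∈ B, (4 / z) := by
          refine sum_le_sum fun B hB => ?_
          rw [prod_const, div_pow]
          have : z ^ B.card ≤ z ^ (2 * r) := pow_le_pow_right₀ hz (mem_filter.1 hB).2
          rw [← mul_div_assoc, le_div_iff₀ (by positivity), mul_comm]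
          gcongr
      _ ≤ ∑ B ∈ P.powerset, z ^ (2 * r) * ∏ p ∈ B, (4 / z) :=
          sum_le_sum_of_subset_of_nonneg (filter_subset _ _) fun _ _ _ => by positivity
      _ = z ^ (2 * r) * (1 + 4 / z) ^ #P := by
          rw [← mul_sum, ← prod_one_add, prod_const]
      _ ≤ z ^ (2 * r) * Real.exp 4 := by
          gcongr
          calc (1 + 4 / z) ^ #P ≤ Real.exp (4 / z) ^ #P := by
                gcongr
                rw [add_comm]; exact Real.add_one_le_exp _
            _ = Real.exp (#P * (4 / z)) := by rw [Real.exp_nat_mul]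
            _ ≤ Real.exp 4 := by
                apply Real.exp_le_exp.2
                rw [← mul_div_assoc, div_le_iff₀ hz0]
                nlinarith
      _ = _ := mul_comm _ _
  have h4 : ∑ B ∈ F, ∏ p ∈ B, (-(4 / (p : ℝ))) ≤
      ∏ p ∈ P, (1 - 4 / (p : ℝ)) + Real.exp (-(2 * r) + 11 * ∑ p ∈ P, 1 / (p : ℝ)) := by
    have hall : ∏ p ∈ P, (1 - 4 / (p : ℝ)) = ∑ B ∈ P.powerset, ∏ p ∈ B, (-(4 / (p : ℝ))) := by
      rw [← prod_one_add]
      simp only [sub_eq_add_neg]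
    rw [hall, ← sum_filter_add_sum_filter_not P.powerset (fun B => B.card ≤ 2 * r)]
    have h5 : -(∑ B ∈ P.powerset with ¬ B.card ≤ 2 * r, ∏ p ∈ B, (-(4 / (p : ℝ)))) ≤
        Real.exp (-(2 * r) + 11 * ∑ p ∈ P, 1 / (p : ℝ)) := by
      rw [← sum_neg_distrib]
      calc _ ≤ ∑ B ∈ P.powerset with ¬ B.card ≤ 2 * r,
            Real.exp (-(2 * r)) * ∏ p ∈ B, (11 / (p : ℝ)) := by
            refine sum_le_sum fun B hB => ?_
            have hlt : 2 * r < B.card := by simpa using (mem_filter.1 hB).2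
            refine (neg_le_abs _).trans ?_
            rw [abs_prod]
            have e1 : ∀ p ∈ B, |(-(4 / (p : ℝ)))| = 4 / p := fun p _ => by
              rw [abs_neg, abs_of_nonneg (by positivity)]
            rw [prod_congr rfl e1]
            calc ∏ p ∈ B, (4 / (p : ℝ)) = Real.exp (-B.card) * ∏ p ∈ B, (Real.exp 1 * (4 / p)) := by
                  rw [prod_mul_distrib, prod_const, ← Real.exp_nat_mul, ← mul_assoc, ← Real.exp_add]
                  simp
              _ ≤ Real.exp (-(2 * r)) * ∏ p ∈ B, (11 / (p : ℝ)) := by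
                  have : (2 * r : ℝ) ≤ B.card := by exact_mod_cast hlt.le
                  gcongr with p hp
                  rw [← mul_div_assoc]
                  gcongr
                  have := Real.exp_one_lt_d9
                  linarith
        _ ≤ ∑ B ∈ P.powerset, Real.exp (-(2 * r)) * ∏ p ∈ B, (11 / (p : ℝ)) :=
            sum_le_sum_of_subset_of_nonneg (filter_subset _ _) fun _ _ _ => by positivity
        _ = Real.exp (-(2 * r)) * ∏ p ∈ P, (1 + 11 / (p : ℝ)) := by
            rw [← mul_sum, ← prod_one_add]
        _ ≤ Real.exp (-(2 * r)) * ∏ p ∈ P, Real.exp (11 * (1 / (p : ℝ))) := by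
            gcongr with p hp
            rw [mul_one_div, add_comm]
            exact Real.add_one_le_exp _
        _ = _ := by rw [← Real.exp_sum, ← mul_sum, ← Real.exp_add]
    linarith
  calc _ ≤ _ := h1
    _ ≤ ∑ B ∈ F, (T * ∏ p ∈ B, (-(4 / (p : ℝ))) + 4 ^ B.card) := sum_le_sum h2
    _ = T * ∑ B ∈ F, ∏ p ∈ B, (-(4 / (p : ℝ))) + ∑ B ∈ F, (4 : ℝ) ^ B.card := by
        rw [sum_add_distrib, mul_sum]
    _ ≤ _ := by gcongr

/-- An upper bound of Mertens type for the sum of prime reciprocals. -/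
theorem sum_prime_inv_le (K : ℕ) (hK : 1 ≤ K) :
    ∑ p ∈ (range (2 ^ K + 1)).filter Nat.Prime, 1 / (p : ℝ) ≤ 5 + 4 * Real.log K := by
  have hdyad : ∀ k : ℕ, 1 ≤ k →
      ∑ p ∈ (Ioc (2 ^ k) (2 ^ (k + 1)) : Finset ℕ) with p.Prime, 1 / (p : ℝ) ≤ 4 / k := by
    intro k hk
    have hl2 : 0 < Real.log 2 := Real.log_pos (by norm_num)
    have hk0 : (0 : ℝ) < k := by exact_mod_cast hk
    have h1 : ∑ p ∈ (Ioc (2 ^ k) (2 ^ (k + 1)) : Finset ℕ) with p.Prime, 1 / (p : ℝ) ≤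
        ∑ p ∈ (Ioc (2 ^ k) (2 ^ (k + 1)) : Finset ℕ) with p.Prime, Real.log p / (2 ^ k * (k * Real.log 2)) := by
      refine sum_le_sum fun p hp => ?_
      simp only [mem_filter, mem_Ioc] at hp
      have hp1 : (2 : ℝ) ^ k ≤ p := by exact_mod_cast hp.1.1.le
      have hlog : k * Real.log 2 ≤ Real.log p := by
        rw [← Real.log_pow]; exact Real.log_le_log (by positivity) hp1
      have hp0 : (0 : ℝ) < p := lt_of_lt_of_le (by positivity) hp1
      rw [div_le_div_iff₀ hp0 (by positivity)]
      have : 0 < k * Real.log 2 := by positivity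
      nlinarith [mul_le_mul hp1 hlog this.le hp0.le]
    have h2 : ∑ p ∈ (Ioc (2 ^ k) (2 ^ (k + 1)) : Finset ℕ) with p.Prime, Real.log p ≤
        Chebyshev.theta ((2 : ℝ) ^ (k + 1)) := by
      rw [Chebyshev.theta_eq_sum_Icc]
      have : ⌊(2 : ℝ) ^ (k + 1)⌋₊ = 2 ^ (k + 1) := by
        have : ((2 : ℝ) ^ (k + 1)) = ((2 ^ (k + 1) : ℕ) : ℝ) := by push_cast; rfl
        rw [this, Nat.floor_natCast]
      rw [this]
      refine sum_le_sum_of_subset_of_nonneg ?_ fun p _ _ => Real.log_natCast_nonneg p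
      intro p hp
      simp only [mem_filter, mem_Ioc, mem_Icc] at hp ⊢
      exact ⟨⟨by omega, hp.1.2⟩, hp.2⟩
    have h3 := Chebyshev.theta_le_log4_mul_x (x := (2 : ℝ) ^ (k + 1)) (by positivity)
    have hl4 : Real.log 4 = 2 * Real.log 2 := by
      rw [show (4 : ℝ) = 2 ^ 2 by norm_num, Real.log_pow]; norm_num
    rw [← sum_div] at h1
    refine h1.trans ?_
    rw [div_le_div_iff₀ (by positivity) hk0]
    have h4 := h2.trans h3
    rw [hl4] at h4
    calc _ ≤ 2 * Real.log 2 * 2 ^ (k + 1) * k := by gcongr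
      _ = _ := by ring
  have key : ∀ k : ℕ, ∑ p ∈ (range (2 ^ (k + 1) + 1)).filter Nat.Prime, 1 / (p : ℝ) ≤
      1 / 2 + 4 * harmonic k := by
    intro k
    induction k with
    | zero =>
      have : (range (2 ^ (0 + 1) + 1)).filter Nat.Prime = {2} := by decide
      rw [this]; simp
    | succ k ih =>
      have hsplit : (range (2 ^ (k + 1 + 1) + 1)).filter Nat.Prime =
          (range (2 ^ (k + 1) + 1)).filter Nat.Prime ∪
            (Ioc (2 ^ (k + 1)) (2 ^ (k + 1 + 1))).filter Nat.Prime := by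
        have := Nat.pow_le_pow_right (n := 2) (by norm_num) (Nat.le_succ (k + 1))
        ext p
        simp only [mem_filter, mem_range, mem_union, mem_Ioc]
        simp only [Nat.succ_eq_add_one] at this
        constructor
        · rintro ⟨h, h'⟩
          by_cases hp : p < 2 ^ (k + 1) + 1
          · exact Or.inl ⟨hp, h'⟩
          · exact Or.inr ⟨⟨by omega, by omega⟩, h'⟩
        · rintro (⟨h, h'⟩ | ⟨h, h'⟩)
          · exact ⟨by omega, h'⟩
          · exact ⟨by omega, h'⟩
      rw [hsplit, sum_union]
      · have := hdyad (k + 1) (by omega)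
        rw [harmonic_succ]
        push_cast at this ⊢
        have e : 4 * ((harmonic k : ℝ) + (k + 1 : ℝ)⁻¹) = 4 * harmonic k + 4 / (k + 1) := by
          ring
        linarith
      · rw [disjoint_left]
        intro p hp hp'
        simp only [mem_filter, mem_range, mem_Ioc] at hp hp'
        omega
  obtain ⟨k, rfl⟩ : ∃ k, K = k + 1 := ⟨K - 1, by omega⟩
  have h1 := key k
  have h2 := harmonic_le_one_add_log k
  have h3 : Real.log k ≤ Real.log (k + 1 : ℕ) := by
    rcases Nat.eq_zero_or_pos k with rfl | hk
    · simp
    · exact Real.log_le_log (by exact_mod_cast hk) (by push_cast; linarith)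
  linarith

theorem log_le_prod_primesBelow (M : ℕ) (hM : 1 ≤ M) :
    Real.log M ≤ ∏ p ∈ M.primesBelow, (1 - (p : ℝ)⁻¹)⁻¹ := by
  let f : ℕ →* ℝ :=
    { toFun := fun n => (n : ℝ)⁻¹
      map_one' := by simp
      map_mul' := fun a b => by push_cast; rw [mul_inv] }
  obtain ⟨h1, h2⟩ := EulerProduct.summable_and_hasSum_smoothNumbers_prod_primesBelow_geometric
    (f := f) (fun {p} hp => by
      have : (1 : ℝ) < p := by exact_mod_cast hp.one_lt
      simp only [f, MonoidHom.coe_mk, OneHom.coe_mk, norm_inv, RCLike.norm_natCast]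
      exact inv_lt_one_of_one_lt₀ this) M
  have h3 : ∏ p ∈ M.primesBelow, (1 - (p : ℝ)⁻¹)⁻¹ = ∏ p ∈ M.primesBelow, (1 - f p)⁻¹ := rfl
  rw [h3]
  have h4 : Real.log M ≤ (harmonic (M - 1) : ℝ) := by
    have := log_add_one_le_harmonic (M - 1)
    have e : M - 1 + 1 = M := by omega
    rwa [e] at this
  refine h4.trans ?_
  have h5 : (harmonic (M - 1) : ℝ) = ∑ m ∈ Ico 1 M, (m : ℝ)⁻¹ := by
    rw [harmonic_eq_sum_Icc]
    push_cast
    refine sum_congr ?_ fun _ _ => rfl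
    ext m; simp only [mem_Icc, mem_Ico]; omega
  have hsm : ∀ m ∈ Ico 1 M, m ∈ M.smoothNumbers := fun m hm => by
    rw [mem_Ico] at hm
    exact Nat.mem_smoothNumbers_of_lt (by omega) hm.2
  rw [h5, ← h2.tsum_eq]
  have h6 : ∑ m ∈ Ico 1 M, (m : ℝ)⁻¹ = ∑ m ∈ (Ico 1 M).subtype (· ∈ M.smoothNumbers), f m := by
    rw [sum_subtype_of_mem (f := fun m : ℕ => f m) hsm]
    rfl
  rw [h6]
  refine Summable.sum_le_tsum _ (fun m _ => ?_) h2.summable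
  simp [f]

theorem prod_one_sub_four_div_le {M E : ℕ} (hM : 2 ≤ M) (h6 : 6 ∣ E) :
    ∏ p ∈ M.primesBelow with ¬ p ∣ E, (1 - 4 / (p : ℝ)) ≤
      (Real.log M)⁻¹ ^ 4 * Real.exp (8 * ∑ p ∈ M.primesBelow with p ∣ E, 1 / (p : ℝ)) := by
  have hlogM : 0 < Real.log M := Real.log_pos (by exact_mod_cast hM)
  have hpr : ∀ p ∈ M.primesBelow, (2 : ℝ) ≤ p := fun p hp => by
    exact_mod_cast (Nat.prime_of_mem_primesBelow hp).two_le
  have h5 : ∀ p ∈ M.primesBelow, ¬ p ∣ E → 4 ≤ p := by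
    intro p hp hE
    by_contra h
    have := (Nat.prime_of_mem_primesBelow hp).two_le
    have : p = 2 ∨ p = 3 := by omega
    rcases this with rfl | rfl
    · exact hE (dvd_trans (by norm_num) h6)
    · exact hE (dvd_trans (by norm_num) h6)
  calc ∏ p ∈ M.primesBelow with ¬ p ∣ E, (1 - 4 / (p : ℝ))
      ≤ ∏ p ∈ M.primesBelow with ¬ p ∣ E, (1 - (p : ℝ)⁻¹) ^ 4 := by
        refine prod_le_prod (fun p hp => ?_) (fun p hp => ?_)
        · rw [mem_filter] at hp
          have h4 : (4 : ℝ) ≤ p := by exact_mod_cast h5 p hp.1 hp.2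
          rw [sub_nonneg, div_le_one (by linarith)]; exact h4
        · rw [mem_filter] at hp
          have h4 : (4 : ℝ) ≤ p := by exact_mod_cast h5 p hp.1 hp.2
          have h7 : (p : ℝ)⁻¹ ≤ 1 := inv_le_one_of_one_le₀ (by linarith)
          have := one_add_mul_le_pow (a := -(p : ℝ)⁻¹) (by linarith) 4
          calc 1 - 4 / (p : ℝ) = 1 + (4 : ℕ) * -(p : ℝ)⁻¹ := by push_cast; ring
            _ ≤ _ := this
            _ = _ := by ring
    _ = ((∏ p ∈ M.primesBelow, (1 - (p : ℝ)⁻¹)⁻¹)⁻¹) ^ 4 *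
          ∏ p ∈ M.primesBelow with p ∣ E, ((1 - (p : ℝ)⁻¹)⁻¹) ^ 4 := by
        rw [prod_pow, prod_pow, ← mul_pow]
        congr 1
        rw [← prod_filter_mul_prod_filter_not M.primesBelow (fun p => p ∣ E)
          (fun p => (1 - (p : ℝ)⁻¹)⁻¹)]
        have hne : ∏ p ∈ M.primesBelow with p ∣ E, (1 - (p : ℝ)⁻¹)⁻¹ ≠ 0 := by
          refine prod_ne_zero_iff.2 fun p hp => inv_ne_zero ?_
          have := hpr p (mem_filter.1 hp).1
          have : (p : ℝ)⁻¹ < 1 := inv_lt_one_of_one_lt₀ (by linarith)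
          linarith
        rw [mul_inv, mul_comm, ← mul_assoc, mul_inv_cancel₀ hne, one_mul, prod_inv_distrib, inv_inv]
    _ ≤ (Real.log M)⁻¹ ^ 4 * ∏ p ∈ M.primesBelow with p ∣ E, Real.exp (8 * (1 / (p : ℝ))) := by
        have hA := log_le_prod_primesBelow M (by omega)
        have hA0 := hlogM.le.trans hA
        gcongr with p hp
        · have h2 := hpr p (mem_filter.1 hp).1
          have e : Real.exp (8 * (1 / (p : ℝ))) = Real.exp (2 / p) ^ 4 := by
            rw [← Real.exp_nat_mul]; congr 1; push_cast; ring
          rw [e]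
          have h7 : (p : ℝ)⁻¹ < 1 := inv_lt_one_of_one_lt₀ (by linarith)
          have h8 : 0 ≤ (1 - (p : ℝ)⁻¹)⁻¹ := inv_nonneg.2 (by linarith)
          refine pow_le_pow_left₀ h8 ?_ 4
          refine le_trans ?_ (Real.add_one_le_exp _)
          rw [inv_le_iff_one_le_mul₀ (by linarith)]
          have hp0 : (0 : ℝ) < p := by linarith
          have : (2 / (p : ℝ) + 1) * (1 - (p : ℝ)⁻¹) = 1 + (p - 2) / p ^ 2 := by
            field_simp; ring
          rw [this]
          have : 0 ≤ ((p : ℝ) - 2) / p ^ 2 := div_nonneg (by linarith) (by positivity)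
          linarith
    _ = _ := by rw [← Real.exp_sum, ← mul_sum]

theorem card_primeFactors_mul_log_two_le {E : ℕ} (hE : 0 < E) :
    (#E.primeFactors : ℝ) * Real.log 2 ≤ Real.log E := by
  rw [← Real.log_pow]
  refine Real.log_le_log (by positivity) ?_
  have h1 : 2 ^ #E.primeFactors ≤ ∏ p ∈ E.primeFactors, p :=
    pow_card_le_prod _ _ _ fun p hp => (Nat.prime_of_mem_primeFactors hp).two_le
  exact_mod_cast h1.trans (Nat.le_of_dvd hE (Nat.prod_primeFactors_dvd E))

theorem sum_inv_prime_dvd_le {M E K : ℕ} (hE : 0 < E) (hK : 1 ≤ K) :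
    ∑ p ∈ M.primesBelow with p ∣ E, 1 / (p : ℝ) ≤
      5 + 4 * Real.log K + 2 * Real.log E / 2 ^ K := by
  have h1 := sum_prime_inv_le K hK
  have h2 := card_primeFactors_mul_log_two_le hE
  have hl2 : (1 : ℝ) / 2 ≤ Real.log 2 := by have := Real.log_two_gt_d9; linarith
  rw [← sum_filter_add_sum_filter_not _ (fun p => p ≤ 2 ^ K)]
  refine add_le_add ((sum_le_sum_of_subset_of_nonneg ?_ fun _ _ _ => by positivity).trans h1) ?_
  · intro p hp
    simp only [mem_filter, mem_range] at hp ⊢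
    exact ⟨by omega, Nat.prime_of_mem_primesBelow hp.1.1⟩
  · calc _ ≤ ∑ p ∈ E.primeFactors, (1 : ℝ) / 2 ^ K := by
          refine (sum_le_sum (g := fun _ => (1 : ℝ) / 2 ^ K) fun p hp => ?_).trans
            (sum_le_sum_of_subset_of_nonneg ?_ fun _ _ _ => by positivity)
          · simp only [mem_filter, not_le] at hp
            have : (2 : ℝ) ^ K ≤ p := by exact_mod_cast hp.2.le
            gcongr
          · intro p hp
            simp only [mem_filter] at hp
            exact Nat.mem_primeFactors.2 ⟨Nat.prime_of_mem_primesBelow hp.1.1, hp.1.2, hE.ne'⟩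
      _ = #E.primeFactors / 2 ^ K := by rw [sum_const, nsmul_eq_mul, mul_one_div]
      _ ≤ _ := by
          gcongr
          have : (0 : ℝ) ≤ #E.primeFactors := by positivity
          nlinarith

theorem exists_sieve_bound : ∃ C X0 : ℝ, 0 < C ∧ ∀ X : ℝ, X0 ≤ X → ∃ z : ℕ,
    (z : ℝ) ≤ Real.exp (Real.log X / 4) ∧ 1 ≤ Real.log X ∧
    Real.log X ^ 3 ≤ Real.exp (Real.log X / 4) ∧
    ∀ (T E : ℕ) (bad : ℕ → ℕ → Prop) [∀ p, DecidablePred (bad p)],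
      Real.exp (Real.log X / 2) ≤ T → 0 < E → 6 ∣ E → Real.log E ≤ 40 * Real.log X →
      (∀ p : ℕ, p.Prime → ∀ n, bad p (n + p) ↔ bad p n) →
      (∀ p : ℕ, p.Prime → ¬ p ∣ E → Nat.count (bad p) p = 4) →
      ∀ S ⊆ range T, (∀ n ∈ S, ∀ p : ℕ, p.Prime → p ≤ z → ¬ p ∣ E → ¬ bad p n) →
      (#S : ℝ) ≤ C * T / Real.log X ^ 3 := by
  have ev : ∀ᶠ X : ℝ in atTop, 1 ≤ Real.log (Real.log X) ∧
      Real.log (Real.log X) ^ 36 ≤ Real.log X ∧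
      Real.log X ^ 3 ≤ Real.exp (Real.log X / 4) ∧ 2 ≤ Real.exp (Real.log X /
        (200 * Real.log (Real.log X))) := by
    have h0 : Tendsto (fun X : ℝ => Real.log X) atTop atTop := Real.tendsto_log_atTop
    have h1 : Tendsto (fun X : ℝ => Real.log (Real.log X)) atTop atTop := h0.comp h0
    have h2 : ∀ᶠ L : ℝ in atTop, Real.log L ^ 36 ≤ L := by
      have := (Real.isLittleO_pow_log_id_atTop (n := 36)).bound (c := 1) one_pos
      filter_upwards [this, eventually_ge_atTop 1] with L hL hL1
      have h3 : 0 ≤ Real.log L := Real.log_nonneg hL1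
      simpa [abs_of_nonneg h3, abs_of_nonneg (by linarith : (0 : ℝ) ≤ L)] using hL
    have h2' : ∀ᶠ L : ℝ in atTop, Real.log L ^ 2 ≤ L / 200 := by
      have := (Real.isLittleO_pow_log_id_atTop (n := 2)).bound (c := 1 / 200) (by norm_num)
      filter_upwards [this, eventually_ge_atTop 1] with L hL hL1
      have h3 : 0 ≤ Real.log L := Real.log_nonneg hL1
      simp only [norm_pow, Real.norm_eq_abs, id, sq_abs, abs_of_nonneg (by linarith : (0 : ℝ) ≤ L)] at hL
      linarith
    have h3 : ∀ᶠ L : ℝ in atTop, L ^ 3 ≤ Real.exp (L / 4) := by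
      have h := (Real.tendsto_exp_div_pow_atTop 3).comp
        (tendsto_id.atTop_div_const (by norm_num : (0 : ℝ) < 4))
      filter_upwards [h.eventually_ge_atTop 64, eventually_gt_atTop 0] with L hL hL0
      simp only [Function.comp, id] at hL
      rw [le_div_iff₀ (by positivity)] at hL
      have : 64 * (L / 4) ^ 3 = L ^ 3 := by ring
      linarith
    filter_upwards [h1.eventually_ge_atTop 1, h0.eventually h2, h0.eventually h3,
      h0.eventually h2', h0.eventually_ge_atTop 1] with X a b c d e
    refine ⟨a, b, c, ?_⟩
    have : 1 ≤ Real.log X / (200 * Real.log (Real.log X)) := by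
      rw [le_div_iff₀ (by linarith)]
      nlinarith
    have h4 := Real.add_one_le_exp (Real.log X / (200 * Real.log (Real.log X)))
    linarith
  obtain ⟨X0, hX0⟩ := eventually_atTop.1 ev
  refine ⟨200 ^ 4 * Real.exp 800 + Real.exp 110 + Real.exp 4, X0, by positivity, fun X hX => ?_⟩
  obtain ⟨hl1, hl36, hL3, hz2⟩ := hX0 X hX
  set L := Real.log X with hL
  set l := Real.log L with hl
  have hLpos : 0 < L := lt_of_lt_of_le (by positivity) hl36
  have hLexp : L = Real.exp l := (Real.exp_log hLpos).symm
  have hL1 : 1 ≤ L := (one_le_pow₀ hl1).trans hl36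
  set z := ⌊Real.exp (L / (200 * l))⌋₊ with hz
  have hzle : (z : ℝ) ≤ Real.exp (L / (200 * l)) := Nat.floor_le (Real.exp_pos _).le
  have hz2' : 2 ≤ z := Nat.le_floor (by exact_mod_cast hz2)
  refine ⟨z, hzle.trans (Real.exp_le_exp.2 ?_), hL1, hL3, ?_⟩
  · gcongr; linarith
  intro T E bad _ hT hE h6 hElog hper hcount S hS hgood
  set P := (z + 1).primesBelow.filter (fun p => ¬ p ∣ E) with hP
  have hPprime : ∀ p ∈ P, p.Prime := fun p hp =>
    Nat.prime_of_mem_primesBelow (mem_filter.1 hp).1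
  have hPcard : (#P : ℝ) ≤ z := by
    have : P ⊆ Ioc 0 z := fun p hp => by
      have h1 := (hPprime p hp).pos
      have h2 := Nat.lt_of_mem_primesBelow (mem_filter.1 hp).1
      rw [mem_Ioc]; omega
    have := card_le_card this
    rw [Nat.card_Ioc] at this
    exact_mod_cast this
  set r := ⌈24 * l⌉₊ with hr
  have hr1 : 24 * l ≤ r := Nat.le_ceil _
  have hr2 : (r : ℝ) < 24 * l + 1 := Nat.ceil_lt_add_one (by positivity)
  have hbrun := brun_pure_sieve P hPprime bad (fun p hp => hper p (hPprime p hp))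
    (fun p hp => hcount p (hPprime p hp) (mem_filter.1 hp).2)
    (z := z) (by exact_mod_cast (by omega : 1 ≤ z)) hPcard T r
  have hS' : (#S : ℝ) ≤ #{n ∈ range T | ∀ p ∈ P, ¬ bad p n} := by
    have : S ⊆ {n ∈ range T | ∀ p ∈ P, ¬ bad p n} := fun n hn => by
      rw [mem_filter]
      refine ⟨hS hn, fun p hp => hgood n hn p (hPprime p hp) ?_ (mem_filter.1 hp).2⟩
      have := Nat.lt_of_mem_primesBelow (mem_filter.1 hp).1
      omega
    exact_mod_cast card_le_card this
  have hl2 : (1 : ℝ) / 2 ≤ Real.log 2 := by have := Real.log_two_gt_d9; linarith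
  have hlog3 : Real.log 3 ≤ 5 / 4 := by
    rw [Real.log_le_iff_le_exp (by norm_num)]
    have := Real.quadratic_le_exp_of_nonneg (x := 5 / 4) (by norm_num)
    linarith
  -- a dyadic ceiling
  have ceil : ∀ y : ℝ, 1 ≤ y → Real.exp y ≤ 2 ^ ⌈2 * y⌉₊ ∧ 1 ≤ ⌈2 * y⌉₊ ∧
      Real.log ⌈2 * y⌉₊ ≤ 5 / 4 + Real.log y := by
    intro y hy
    have h1 : 2 * y ≤ ⌈2 * y⌉₊ := Nat.le_ceil _
    have h2 : (⌈2 * y⌉₊ : ℝ) < 2 * y + 1 := Nat.ceil_lt_add_one (by linarith)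
    refine ⟨?_, ?_, ?_⟩
    · rw [← Real.exp_log (by positivity : (0 : ℝ) < 2 ^ ⌈2 * y⌉₊), Real.log_pow]
      apply Real.exp_le_exp.2
      nlinarith
    · have : 0 < ⌈2 * y⌉₊ := Nat.ceil_pos.2 (by linarith)
      omega
    · have h3 : Real.log ⌈2 * y⌉₊ ≤ Real.log (3 * y) :=
        Real.log_le_log (by linarith) (by linarith)
      rw [Real.log_mul (by norm_num) (by linarith)] at h3
      linarith
  have hsumP : ∑ p ∈ P, 1 / (p : ℝ) ≤ 10 + 4 * l := by
    obtain ⟨c1, c2, c3⟩ := ceil L hL1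
    have h1 := sum_prime_inv_le _ c2
    have hz3 : z ≤ 2 ^ ⌈2 * L⌉₊ := by
      have h3 : (z : ℝ) ≤ 2 ^ ⌈2 * L⌉₊ := by
        refine hzle.trans (le_trans (Real.exp_le_exp.2 ?_) c1)
        rw [div_le_iff₀ (by positivity)]
        nlinarith
      exact_mod_cast h3
    have h2 : ∑ p ∈ P, 1 / (p : ℝ) ≤
        ∑ p ∈ (range (2 ^ ⌈2 * L⌉₊ + 1)).filter Nat.Prime, 1 / (p : ℝ) := by
      refine sum_le_sum_of_subset_of_nonneg (fun p hp => ?_) fun _ _ _ => by positivity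
      have := Nat.lt_of_mem_primesBelow (mem_filter.1 hp).1
      rw [mem_filter, mem_range]
      exact ⟨by omega, hPprime p hp⟩
    linarith
  have hexp1 : Real.exp (-(2 * r) + 11 * ∑ p ∈ P, 1 / (p : ℝ)) ≤ Real.exp 110 / L ^ 3 := by
    have : -(2 * r : ℝ) + 11 * ∑ p ∈ P, 1 / (p : ℝ) ≤ 110 - 3 * l := by linarith
    refine (Real.exp_le_exp.2 this).trans_eq ?_
    rw [Real.exp_sub, hLexp, ← Real.exp_nat_mul]
    norm_num
  have hprod : ∏ p ∈ P, (1 - 4 / (p : ℝ)) ≤ 200 ^ 4 * Real.exp 800 / L ^ 3 := by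
    have h1 := prod_one_sub_four_div_le (M := z + 1) (E := E) (by omega) h6
    have hlogM : L / (200 * l) ≤ Real.log (z + 1 : ℕ) := by
      rw [Real.le_log_iff_exp_le (by positivity)]
      push_cast
      exact (Nat.lt_floor_add_one _).le
    obtain ⟨c1, c2, c3⟩ := ceil l hl1
    have h2 := sum_inv_prime_dvd_le (M := z + 1) hE c2
    rw [← hLexp] at c1
    have h3 : 2 * Real.log E / 2 ^ ⌈2 * l⌉₊ ≤ 80 := by
      rw [div_le_iff₀ (by positivity)]
      nlinarith
    have h4 : ∑ p ∈ (z + 1).primesBelow with p ∣ E, 1 / (p : ℝ) ≤ 90 + 4 * Real.log l := by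
      linarith
    have hl0 : 0 < l := by linarith
    calc _ ≤ _ := h1
      _ ≤ (L / (200 * l))⁻¹ ^ 4 * Real.exp (8 * (90 + 4 * Real.log l)) := by gcongr
      _ = 200 ^ 4 * Real.exp 720 * l ^ 36 / L ^ 4 := by
          rw [show 8 * (90 + 4 * Real.log l) = 720 + (32 : ℕ) * Real.log l by push_cast; ring,
            Real.exp_add, Real.exp_nat_mul, Real.exp_log hl0]
          field_simp
      _ ≤ 200 ^ 4 * Real.exp 800 * L / L ^ 4 := by
          gcongr
          norm_num
      _ = _ := by field_simp
  have herr : Real.exp 4 * (z : ℝ) ^ (2 * r) ≤ Real.exp 4 * T / L ^ 3 := by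
    rw [mul_div_assoc]
    gcongr
    calc (z : ℝ) ^ (2 * r) ≤ Real.exp (L / (200 * l)) ^ (2 * r) := by gcongr
      _ = Real.exp ((2 * r : ℕ) * (L / (200 * l))) := by rw [Real.exp_nat_mul]
      _ ≤ Real.exp (L / 4) := by
          apply Real.exp_le_exp.2
          have : ((2 * r : ℕ) : ℝ) ≤ 50 * l := by push_cast; linarith
          calc _ ≤ 50 * l * (L / (200 * l)) := by gcongr
            _ = _ := by field_simp; norm_num
      _ ≤ T / L ^ 3 := by
          rw [le_div_iff₀ (by positivity)]
          calc _ ≤ Real.exp (L / 4) * Real.exp (L / 4) := by gcongr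
            _ = Real.exp (L / 2) := by rw [← Real.exp_add]; congr 1; ring
            _ ≤ T := hT
  calc (#S : ℝ) ≤ _ := hS'
    _ ≤ _ := hbrun
    _ ≤ T * (200 ^ 4 * Real.exp 800 / L ^ 3 + Real.exp 110 / L ^ 3) + Real.exp 4 * T / L ^ 3 := by
        gcongr
    _ = _ := by ring

theorem count_dvd_eq_four {A B C D p : ℕ} (hp : p.Prime)
    (h : ¬ p ∣ 6 * A * B * C * D * (((A * D : ℤ)) ^ 2 - (B * C) ^ 2).natAbs) :
    Nat.count (fun n : ℕ => (p : ℤ) ∣ ((A * n : ℤ) ^ 2 - B ^ 2) * ((C * n : ℤ) ^ 2 - D ^ 2)) p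
      = 4 := by
  have := Fact.mk hp
  have h' : (6 * A * B * C * D * ((A * D) ^ 2 - (B * C) ^ 2) : ZMod p) ≠ 0 := by
    intro h0
    apply h
    rw [← Int.natCast_dvd_natCast]
    push_cast
    have : (p : ℤ) ∣ 6 * A * B * C * D * (((A * D : ℤ)) ^ 2 - (B * C) ^ 2) := by
      rw [← ZMod.intCast_zmod_eq_zero_iff_dvd]
      push_cast
      exact h0
    rw [← dvd_abs] at this
    rwa [abs_mul, abs_of_nonneg (by positivity : (0 : ℤ) ≤ 6 * A * B * C * D)] at this
  simp only [mul_ne_zero_iff, ne_eq] at h'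
  obtain ⟨⟨⟨⟨⟨h6, hA⟩, hB⟩, hC⟩, hD⟩, hX⟩ := h'
  have h2 : (2 : ZMod p) ≠ 0 := fun h0 => h6 (by linear_combination 3 * h0)
  set a : ZMod p := (A : ZMod p)
  set b : ZMod p := (B : ZMod p)
  set c : ZMod p := (C : ZMod p)
  set d : ZMod p := (D : ZMod p)
  have hX1 : a * d - b * c ≠ 0 := fun h0 => hX (by linear_combination (a * d + b * c) * h0)
  have hX2 : a * d + b * c ≠ 0 := fun h0 => hX (by linear_combination (a * d - b * c) * h0)
  rw [Nat.count_eq_card_filter_range]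
  have hcard : #({b / a, -(b / a), d / c, -(d / c)} : Finset (ZMod p)) = 4 := by
    have e1 : b / a ≠ -(b / a) := by
      intro h0
      have h1 : (1 : ZMod p) = -1 := by field_simp at h0; exact h0
      exact h2 (by linear_combination h1)
    have e2 : d / c ≠ -(d / c) := by
      intro h0
      have h1 : (1 : ZMod p) = -1 := by field_simp at h0; exact h0
      exact h2 (by linear_combination h1)
    have e3 : b / a ≠ d / c := by
      intro h0
      rw [div_eq_div_iff hA hC] at h0
      exact hX1 (by linear_combination -h0)
    have e4 : b / a ≠ -(d / c) := by
      intro h0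
      rw [← neg_div, div_eq_div_iff hA hC] at h0
      exact hX2 (by linear_combination h0)
    have e5 : -(b / a) ≠ d / c := fun h0 => e4 (by rw [← h0, neg_neg])
    have e6 : -(b / a) ≠ -(d / c) := fun h0 => e3 (neg_injective h0)
    rw [card_insert_of_notMem, card_insert_of_notMem, card_insert_of_notMem, card_singleton]
    · simpa using e2
    · simp only [mem_insert, mem_singleton, not_or]; exact ⟨e5, e6⟩
    · simp only [mem_insert, mem_singleton, not_or]; exact ⟨e1, e3, e4⟩
  rw [← hcard]
  refine card_bij (fun n _ => (n : ZMod p)) ?_ ?_ ?_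
  · intro n hn
    simp only [mem_filter] at hn
    have := (ZMod.intCast_zmod_eq_zero_iff_dvd _ _).2 hn.2
    push_cast at this
    rw [mul_eq_zero] at this
    simp only [mem_insert, mem_singleton]
    rcases this with h0 | h0
    · have : (a * n - b) * (a * n + b) = 0 := by linear_combination h0
      rcases mul_eq_zero.1 this with h0 | h0
      · left; rw [eq_div_iff hA]; linear_combination h0
      · right; left; rw [← neg_div, eq_div_iff hA]; linear_combination h0
    · have : (c * n - d) * (c * n + d) = 0 := by linear_combination h0
      rcases mul_eq_zero.1 this with h0 | h0
      · right; right; left; rw [eq_div_iff hC]; linear_combination h0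
      · right; right; right; rw [← neg_div, eq_div_iff hC]; linear_combination h0
  · intro m hm n hn hmn
    simp only [mem_filter, mem_range] at hm hn
    have := (ZMod.natCast_eq_natCast_iff' _ _ _).1 hmn
    rwa [Nat.mod_eq_of_lt hm.1, Nat.mod_eq_of_lt hn.1] at this
  · intro x hx
    refine ⟨x.val, ?_, by simp⟩
    simp only [mem_filter, mem_range]
    refine ⟨ZMod.val_lt x, ?_⟩
    rw [← ZMod.intCast_zmod_eq_zero_iff_dvd]
    push_cast
    rw [ZMod.natCast_val, ZMod.cast_id', id]
    simp only [mem_insert, mem_singleton] at hx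
    rcases hx with rfl | rfl | rfl | rfl
    · rw [mul_eq_zero]; left; field_simp; ring
    · rw [mul_eq_zero]; left; field_simp; ring
    · rw [mul_eq_zero]; right; field_simp; ring
    · rw [mul_eq_zero]; right; field_simp; ring

theorem card_filter_abs_linear_le (S : Finset ℕ) {A : ℕ} (hA : 0 < A) (B : ℤ) (z : ℕ) :
    #(S.filter fun n : ℕ => |(A * n + B : ℤ)| ≤ 2 * z) ≤ 4 * z + 1 := by
  have : #(Icc (-(2 * z : ℤ)) (2 * z)) = 4 * z + 1 := by
    rw [Int.card_Icc]; omega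
  rw [← this]
  refine card_le_card_of_injOn (fun n : ℕ => (A * n + B : ℤ)) ?_ ?_
  · intro n hn
    simp only [coe_filter, Set.mem_ofPred_eq, abs_le] at hn
    simpa using hn.2
  · intro m _ n _ h
    have h1 : (A : ℤ) * m = A * n := by simpa using h
    have : (m : ℤ) = n := mul_left_cancel₀ (by exact_mod_cast hA.ne') h1
    exact_mod_cast this

/-- The number of `n < T` for which four linear forms `A n ± B`, `C n ± D` are all twice a prime,
up to sign. -/
theorem exists_card_linear_forms_le : ∃ K X0 : ℝ, 0 < K ∧ ∀ X : ℝ, X0 ≤ X → 1 ≤ Real.log X ∧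
    ∀ A B C D T : ℕ, 0 < A → 0 < B → 0 < C → 0 < D → A * D ≠ B * C →
      (A : ℝ) ≤ X ^ 3 → (B : ℝ) ≤ X ^ 3 → (C : ℝ) ≤ X ^ 3 → (D : ℝ) ≤ X ^ 3 →
      Real.exp (Real.log X / 2) ≤ T → ∀ S ⊆ range T,
      (∀ n ∈ S, ∃ q₁ q₂ q₃ q₄ : ℕ, q₁.Prime ∧ q₂.Prime ∧ q₃.Prime ∧ q₄.Prime ∧
        |(A * n + B : ℤ)| = 2 * q₁ ∧ |(A * n - B : ℤ)| = 2 * q₂ ∧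
        |(C * n + D : ℤ)| = 2 * q₃ ∧ |(C * n - D : ℤ)| = 2 * q₄) →
      (#S : ℝ) ≤ K * T / Real.log X ^ 3 := by
  obtain ⟨K, X0, hK, h⟩ := exists_sieve_bound
  refine ⟨K + 20, max X0 1, by positivity, fun X hX => ?_⟩
  obtain ⟨z, hz, hL1, hL3, hS⟩ := h X ((le_max_left _ _).trans hX)
  have hX1 : 1 ≤ X := (le_max_right _ _).trans hX
  refine ⟨hL1, fun A B C D T hA hB hC hD hne hAX hBX hCX hDX hT S hST hgood => ?_⟩
  set L := Real.log X with hL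
  set E : ℕ := 6 * A * B * C * D * (((A * D : ℤ)) ^ 2 - (B * C) ^ 2).natAbs with hE
  have hsq : (((A * D : ℤ)) ^ 2 - (B * C) ^ 2) ≠ 0 := by
    intro h0
    apply hne
    have h1 : ((A * D : ℤ)) ^ 2 = (B * C) ^ 2 := by linarith
    have h2 := (sq_eq_sq₀ (by positivity) (by positivity)).1 h1
    exact_mod_cast h2
  have hE0 : 0 < E := by
    have := Int.natAbs_pos.2 hsq
    positivity
  have hElog : Real.log E ≤ 40 * L := by
    have hsqle : ((((A * D : ℤ)) ^ 2 - (B * C) ^ 2).natAbs : ℝ) ≤ X ^ 12 := by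
      rw [Nat.cast_natAbs]
      push_cast
      have h1 : (A * D : ℝ) ^ 2 ≤ (X ^ 3 * X ^ 3) ^ 2 := by gcongr
      have h2 : (B * C : ℝ) ^ 2 ≤ (X ^ 3 * X ^ 3) ^ 2 := by gcongr
      have e : X ^ 12 = (X ^ 3 * X ^ 3) ^ 2 := by ring
      rw [e, abs_le]
      constructor <;> nlinarith [sq_nonneg (A * D : ℝ), sq_nonneg (B * C : ℝ)]
    have hEX : (E : ℝ) ≤ 6 * X ^ 24 := by
      rw [hE]
      push_cast
      calc _ ≤ 6 * X ^ 3 * X ^ 3 * X ^ 3 * X ^ 3 * X ^ 12 := by gcongr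
        _ = _ := by ring
    have hlog6 : Real.log 6 ≤ 2 := by
      rw [Real.log_le_iff_le_exp (by norm_num), show (2 : ℝ) = 1 + 1 by norm_num, Real.exp_add]
      have := Real.exp_one_gt_d9
      nlinarith
    calc _ ≤ Real.log (6 * X ^ 24) := Real.log_le_log (by exact_mod_cast hE0) hEX
      _ = Real.log 6 + 24 * L := by
          rw [Real.log_mul (by norm_num) (by positivity), Real.log_pow]; norm_num; rfl
      _ ≤ _ := by linarith
  set bad : ℕ → ℕ → Prop := fun p n =>
    (p : ℤ) ∣ ((A * n : ℤ) ^ 2 - B ^ 2) * ((C * n : ℤ) ^ 2 - D ^ 2) with hbad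
  let S1 := S.filter fun n : ℕ => |(A * n + (B : ℤ) : ℤ)| ≤ 2 * z
  let S2 := S.filter fun n : ℕ => |(A * n + (-B : ℤ) : ℤ)| ≤ 2 * z
  let S3 := S.filter fun n : ℕ => |(C * n + (D : ℤ) : ℤ)| ≤ 2 * z
  let S4 := S.filter fun n : ℕ => |(C * n + (-D : ℤ) : ℤ)| ≤ 2 * z
  let S5 := S.filter fun n : ℕ => n ∉ S1 ∧ n ∉ S2 ∧ n ∉ S3 ∧ n ∉ S4
  have hcover : S ⊆ S1 ∪ (S2 ∪ (S3 ∪ (S4 ∪ S5))) := by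
    intro n hn
    by_cases h1 : n ∈ S1
    · simp [h1]
    by_cases h2 : n ∈ S2
    · simp [h2]
    by_cases h3 : n ∈ S3
    · simp [h3]
    by_cases h4 : n ∈ S4
    · simp [h4]
    · simp [S5, hn, h1, h2, h3, h4]
  have h5 : (#S5 : ℝ) ≤ K * T / L ^ 3 := by
    refine hS T E bad hT hE0 ?_ hElog ?_ (fun p hp hpE => count_dvd_eq_four hp hpE) S5
      ((filter_subset _ _).trans hST) ?_
    · exact ⟨A * B * C * D * (((A * D : ℤ)) ^ 2 - (B * C) ^ 2).natAbs, by rw [hE]; ring⟩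
    · intro p hp n
      simp only [hbad]
      push_cast
      refine (dvd_iff_dvd_of_dvd_sub ?_).symm.symm
      refine (Int.modEq_iff_dvd.1 ?_)
      have : (n : ℤ) ≡ n + p [ZMOD p] := by simp [Int.ModEq]
      exact ((((this.mul_left _).pow 2).sub_right _).mul (((this.mul_left _).pow 2).sub_right _))
    · intro n hn p hp hpz hpE hdvd
      simp only [S5, mem_filter] at hn
      obtain ⟨hnS, h1, h2, h3, h4⟩ := hn
      obtain ⟨q₁, q₂, q₃, q₄, p1, p2, p3, p4, e1, e2, e3, e4⟩ := hgood n hnS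
      simp only [S1, S2, S3, S4, mem_filter, hnS, true_and, not_le, ← sub_eq_add_neg] at h1 h2 h3 h4
      rw [e1] at h1
      rw [e2] at h2
      rw [e3] at h3
      rw [e4] at h4
      have hp2 : ¬ p ∣ 2 := fun h2 => hpE (h2.trans ⟨3 * (A * B * C * D *
        (((A * D : ℤ)) ^ 2 - (B * C) ^ 2).natAbs), by rw [hE]; ring⟩)
      have key : ∀ q : ℕ, q.Prime → (2 * z : ℤ) < 2 * q → ¬ (p : ℤ) ∣ 2 * q := by
        intro q hq hlt hd
        have hd' : p ∣ 2 * q := by exact_mod_cast hd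
        rcases (Nat.Prime.dvd_mul hp).1 hd' with h | h
        · exact hp2 h
        · rw [(Nat.prime_dvd_prime_iff_eq hp hq).1 h] at hpz
          omega
      have hpi : Prime (p : ℤ) := Nat.prime_iff_prime_int.1 hp
      have fac : ((A * n : ℤ) ^ 2 - B ^ 2) * ((C * n : ℤ) ^ 2 - D ^ 2) =
        ((A * n + B) * (A * n - B)) * ((C * n + D) * (C * n - D)) := by ring
      simp only [hbad] at hdvd
      rw [fac] at hdvd
      rcases hpi.dvd_or_dvd hdvd with h | h <;> rcases hpi.dvd_or_dvd h with h | h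
      · exact key _ p1 h1 (e1 ▸ (dvd_abs _ _).2 h)
      · exact key _ p2 h2 (e2 ▸ (dvd_abs _ _).2 h)
      · exact key _ p3 h3 (e3 ▸ (dvd_abs _ _).2 h)
      · exact key _ p4 h4 (e4 ▸ (dvd_abs _ _).2 h)
  have hcard : #S ≤ 4 * (4 * z + 1) + #S5 := by
    have c1 : #S1 ≤ _ := card_filter_abs_linear_le S hA B z
    have c2 : #S2 ≤ _ := card_filter_abs_linear_le S hA (-B) z
    have c3 : #S3 ≤ _ := card_filter_abs_linear_le S hC D z
    have c4 : #S4 ≤ _ := card_filter_abs_linear_le S hC (-D) z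
    have u1 := card_union_le S1 (S2 ∪ (S3 ∪ (S4 ∪ S5)))
    have u2 := card_union_le S2 (S3 ∪ (S4 ∪ S5))
    have u3 := card_union_le S3 (S4 ∪ S5)
    have u4 := card_union_le S4 S5
    have := card_le_card hcover
    omega
  have hcard' : (#S : ℝ) ≤ 4 * (4 * z + 1) + #S5 := by exact_mod_cast hcard
  have hone : 1 ≤ Real.exp (L / 4) := Real.one_le_exp (by linarith)
  have hsmall : Real.exp (L / 4) ≤ T / L ^ 3 := by
    rw [le_div_iff₀ (by positivity)]
    calc _ ≤ Real.exp (L / 4) * Real.exp (L / 4) := by gcongr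
      _ = Real.exp (L / 2) := by rw [← Real.exp_add]; congr 1; ring
      _ ≤ T := hT
  calc (#S : ℝ) ≤ 20 * (T / L ^ 3) + K * T / L ^ 3 := by linarith
    _ = _ := by ring

theorem card_le_of_fibers {α : Type*} (W : Finset α) (c b a : α → ℕ) (R : ℕ → ℕ → ℕ) (Q : ℕ)
    (F : ℝ) (hQ : 1 ≤ Q) (hF : 0 ≤ F)
    (hc : ∀ x ∈ W, 1 ≤ c x ∧ c x ≤ Q) (hb : ∀ x ∈ W, b x < c x)
    (ha : ∀ x ∈ W, 1 ≤ a x ∧ a x ≤ R (c x) (b x)) (hR : ∀ c b, b < c → R c b * c ≤ Q)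
    (hfib : ∀ i j k : ℕ, 1 ≤ i → (#{x ∈ W | c x = i ∧ b x = j ∧ a x = k} : ℝ) ≤ F / i) :
    (#W : ℝ) ≤ Q * F * (1 + Real.log Q) := by
  classical
  let t : Finset (Σ _ : ℕ, Σ _ : ℕ, ℕ) :=
    (Icc 1 Q).sigma fun i => (range i).sigma fun j => Icc 1 (R i j)
  let f : α → Σ _ : ℕ, Σ _ : ℕ, ℕ := fun x => ⟨c x, b x, a x⟩
  have hmaps : Set.MapsTo f (W : Set α) (t : Set (Σ _ : ℕ, Σ _ : ℕ, ℕ)) := by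
    intro x hx
    simp only [t, f, coe_sigma, mem_coe, Finset.mem_coe] at hx ⊢
    simp only [Set.mem_sigma_iff, coe_Icc, Set.mem_Icc, coe_range, Set.mem_Iio]
    exact ⟨hc x hx, hb x hx, ha x hx⟩
  have h1 : (#W : ℝ) = ∑ y ∈ t, (#{x ∈ W | f x = y} : ℝ) := by
    rw [card_eq_sum_card_fiberwise hmaps]; push_cast; rfl
  rw [h1]
  calc ∑ y ∈ t, (#{x ∈ W | f x = y} : ℝ) ≤ ∑ y ∈ t, F / y.1 := by
        refine sum_le_sum fun y hy => ?_
        obtain ⟨i, j, k⟩ := y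
        simp only [t, mem_sigma, mem_Icc] at hy
        refine le_trans ?_ (hfib i j k hy.1.1)
        have : W.filter (fun x => f x = ⟨i, j, k⟩) ⊆ {x ∈ W | c x = i ∧ b x = j ∧ a x = k} := by
          intro x hx
          simp only [mem_filter, f, Sigma.mk.injEq, heq_eq_eq] at hx ⊢
          exact hx
        exact_mod_cast card_le_card this
    _ = ∑ i ∈ Icc 1 Q, ∑ j ∈ range i, ∑ k ∈ Icc 1 (R i j), F / i := by
        simp only [t, sum_sigma]
    _ ≤ ∑ i ∈ Icc 1 Q, Q * F * (i : ℝ)⁻¹ := by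
        refine sum_le_sum fun i hi => ?_
        rw [mem_Icc] at hi
        have hi0 : (0 : ℝ) < i := by exact_mod_cast hi.1
        calc _ ≤ ∑ j ∈ range i, Q * F * (i : ℝ)⁻¹ / i := by
              refine sum_le_sum fun j hj => ?_
              rw [sum_const, Nat.card_Icc, Nat.add_sub_cancel, nsmul_eq_mul]
              have h2 : (R i j : ℝ) * i ≤ Q := by exact_mod_cast hR i j (mem_range.1 hj)
              have : (R i j : ℝ) * (F / i) = (R i j * i) * F * (i : ℝ)⁻¹ / i := by
                field_simp
              rw [this]
              gcongr
          _ = _ := by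
              rw [sum_const, card_range, nsmul_eq_mul]
              field_simp
    _ = Q * F * (harmonic Q : ℝ) := by
        rw [← mul_sum, harmonic_eq_sum_Icc]
        push_cast
        rfl
    _ ≤ _ := by
        gcongr
        exact harmonic_le_one_add_log Q

/-- Parameters of the solutions of `p₁² + p₂² = p₃² + p₄²` in primes. -/
def IsPrimeSquareParam (M : ℕ) (x : ℕ × ℕ × ℕ × ℕ) : Prop :=
  0 < x.1 ∧ 0 < x.2.1 ∧ x.2.1 < x.2.2.1 ∧ 0 < x.2.2.2 ∧ x.2.2.1 * x.2.2.2 ≤ 2 * M ∧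
  x.1 * x.2.2.1 < x.2.1 * x.2.2.2 ∧
  ∃ q₁ q₂ q₃ q₄ : ℕ, q₁.Prime ∧ q₂.Prime ∧ q₃.Prime ∧ q₄.Prime ∧
    x.2.2.1 * x.2.2.2 + x.1 * x.2.1 = 2 * q₁ ∧ x.2.2.1 * x.2.2.2 = x.1 * x.2.1 + 2 * q₂ ∧
    x.2.1 * x.2.2.2 + x.1 * x.2.2.1 = 2 * q₃ ∧ x.2.1 * x.2.2.2 = x.1 * x.2.2.1 + 2 * q₄

set_option maxHeartbeats 1000000 in
theorem exists_card_param_le : ∃ (K : ℝ) (M0 : ℕ), 0 < K ∧ ∀ M : ℕ, M0 ≤ M →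
    ∀ W : Finset (ℕ × ℕ × ℕ × ℕ), (∀ x ∈ W, IsPrimeSquareParam M x) →
      (#W : ℝ) ≤ K * M ^ 2 / Real.log M ^ 2 := by
  classical
  obtain ⟨K, X0, hK, h⟩ := exists_card_linear_forms_le
  refine ⟨32 * K, max 2 ⌈X0⌉₊, by positivity, fun M hM W hW => ?_⟩
  have hM2 : 2 ≤ M := (le_max_left _ _).trans hM
  have hM2' : (2 : ℝ) ≤ M := by exact_mod_cast hM2
  have hX0 : X0 ≤ ((2 * M : ℕ) : ℝ) := by
    have h1 : X0 ≤ ⌈X0⌉₊ := Nat.le_ceil _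
    have h2 : (⌈X0⌉₊ : ℝ) ≤ M := by exact_mod_cast (le_max_right _ _).trans hM
    push_cast; linarith
  obtain ⟨hL1, hsieve⟩ := h _ hX0
  set Q : ℕ := 2 * M with hQ
  set L := Real.log (Q : ℝ) with hL
  have hQ1 : (1 : ℝ) ≤ Q := by exact_mod_cast (by omega : 1 ≤ Q)
  have hL0 : 0 < L := by linarith
  have hsqrt : Real.exp (L / 2) = √Q := by
    rw [Real.sqrt_eq_rpow, Real.rpow_def_of_pos (by linarith), mul_one_div]
  have hpow : ∀ n : ℕ, n ≤ Q * Q → (n : ℝ) ≤ (Q : ℝ) ^ 3 := by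
    intro n hn
    have : (n : ℝ) ≤ Q * Q := by exact_mod_cast hn
    nlinarith [mul_pos (lt_of_lt_of_le one_pos hQ1) (lt_of_lt_of_le one_pos hQ1)]
  have hpow1 : ∀ n : ℕ, n ≤ Q → (n : ℝ) ≤ (Q : ℝ) ^ 3 := fun n hn =>
    hpow n (hn.trans (Nat.le_mul_self Q))
  have hpow2 : ∀ m n : ℕ, m ≤ Q → n ≤ Q → ((m * n : ℕ) : ℝ) ≤ (Q : ℝ) ^ 3 := fun m n hm hn =>
    hpow _ (Nat.mul_le_mul hm hn)
  -- the range available to the sieving variable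
  have hT : ∀ i : ℕ, 1 ≤ i → i * i ≤ Q → Real.exp (L / 2) ≤ ((Q / i + 1 : ℕ) : ℝ) ∧
      ((Q / i + 1 : ℕ) : ℝ) ≤ 2 * Q / i := by
    intro i hi hi2
    have hi0 : (0 : ℝ) < i := by exact_mod_cast hi
    have h1 : (Q : ℝ) < i * ((Q / i + 1 : ℕ) : ℝ) := by
      exact_mod_cast Nat.lt_mul_div_succ Q (by omega)
    have h2 : (((Q / i : ℕ) : ℝ)) ≤ Q / i := Nat.cast_div_le
    have h4 : (i : ℝ) ≤ √Q := Real.le_sqrt_of_sq_le (by rw [sq]; exact_mod_cast hi2)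
    have h3 : (1 : ℝ) ≤ Q / i := by
      rw [le_div_iff₀ hi0, one_mul]
      exact_mod_cast (Nat.le_mul_self i).trans hi2
    refine ⟨?_, ?_⟩
    · rw [hsqrt]
      have h5 : √(Q : ℝ) * √Q = Q := Real.mul_self_sqrt (by linarith)
      have h6 : 0 < √(Q : ℝ) := by positivity
      by_contra hlt
      push Not at hlt
      nlinarith
    · push_cast
      have e : 2 * (Q : ℝ) / i = Q / i + Q / i := by ring
      linarith
  have hbound : ∀ V : Finset (ℕ × ℕ × ℕ × ℕ), (#V : ℝ) ≤
      Q * (K * (2 * Q) / L ^ 3) * (1 + L) → (#V : ℝ) ≤ 16 * K * M ^ 2 / L ^ 2 := by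
    intro V hV
    refine hV.trans ?_
    calc Q * (K * (2 * Q) / L ^ 3) * (1 + L) ≤ Q * (K * (2 * Q) / L ^ 3) * (L + L) := by gcongr
      _ = _ := by rw [hQ]; push_cast; field_simp; ring
  let W1 := W.filter fun x => x.2.2.1 * x.2.2.1 ≤ Q
  let W2 := W.filter fun x => ¬ x.2.2.1 * x.2.2.1 ≤ Q
  have hW1 : (#W1 : ℝ) ≤ 16 * K * M ^ 2 / L ^ 2 := by
    apply hbound
    refine card_le_of_fibers W1 (fun x => x.2.2.1) (fun x => x.2.1) (fun x => x.1)
      (fun c b => Q * b / (c * c)) Q (K * (2 * Q) / L ^ 3) (by omega) (by positivity) ?_ ?_ ?_ ?_ ?_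
    · intro x hx
      obtain ⟨h1, h2, h3, h4, h5, h6, -⟩ := hW x (mem_filter.1 hx).1
      exact ⟨by omega, (Nat.le_mul_of_pos_right _ h4).trans h5⟩
    · intro x hx
      exact (hW x (mem_filter.1 hx).1).2.2.1
    · intro x hx
      obtain ⟨h1, h2, h3, h4, h5, h6, -⟩ := hW x (mem_filter.1 hx).1
      refine ⟨h1, ?_⟩
      rw [Nat.le_div_iff_mul_le (by have : 0 < x.2.2.1 := by omega
                                    positivity)]
      calc _ = (x.1 * x.2.2.1) * x.2.2.1 := by ring
        _ ≤ (x.2.1 * x.2.2.2) * x.2.2.1 := by gcongr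
        _ = (x.2.2.1 * x.2.2.2) * x.2.1 := by ring
        _ ≤ _ := by gcongr
    · intro c b hbc
      have hc0 : 0 < c := by omega
      calc Q * b / (c * c) * c ≤ Q * c / (c * c) * c := by gcongr
        _ = Q / c * c := by rw [Nat.mul_div_mul_right _ _ hc0]
        _ ≤ Q := Nat.div_mul_le_self _ _
    · intro c b a hc
      rcases (W1.filter fun x => x.2.2.1 = c ∧ x.2.1 = b ∧ x.1 = a).eq_empty_or_nonempty with h0 | h0
      · rw [h0]; simp only [card_empty, Nat.cast_zero]; positivity
      obtain ⟨y, hy⟩ := h0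
      simp only [W1, mem_filter] at hy
      obtain ⟨⟨hyW, hcc⟩, rfl, rfl, rfl⟩ := hy
      obtain ⟨h1, h2, h3, h4, h5, h6, -⟩ := hW y hyW
      obtain ⟨hTl, hTu⟩ := hT _ hc hcc
      have hcQ : y.2.2.1 ≤ Q := (Nat.le_mul_of_pos_right _ h4).trans h5
      have hdQ : y.2.2.2 ≤ Q := (Nat.le_mul_of_pos_left _ hc).trans h5
      have hbQ : y.2.1 ≤ Q := h3.le.trans hcQ
      have had : y.1 ≤ Q := by
        have : y.1 * y.2.2.1 ≤ Q :=
          h6.le.trans ((Nat.mul_le_mul_right _ h3.le).trans h5)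
        exact (Nat.le_mul_of_pos_right _ hc).trans this
      have key := hsieve y.2.2.1 (y.1 * y.2.1) y.2.1 (y.1 * y.2.2.1) (Q / y.2.2.1 + 1)
        hc (by positivity) h2 (by positivity) ?_ (hpow1 _ hcQ) (hpow2 _ _ had hbQ)
        (hpow1 _ hbQ) (hpow2 _ _ had hcQ) hTl
        ((W1.filter fun x => x.2.2.1 = y.2.2.1 ∧ x.2.1 = y.2.1 ∧ x.1 = y.1).image fun x => x.2.2.2)
        ?_ ?_
      · rw [card_image_of_injOn] at key
        · refine key.trans ?_
          calc _ ≤ K * (2 * Q / y.2.2.1) / L ^ 3 := by gcongr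
            _ = _ := by ring
        · intro u hu v hv huv
          simp only [coe_filter, Set.mem_ofPred_eq] at hu hv
          obtain ⟨-, u1, u2, u3⟩ := hu
          obtain ⟨-, v1, v2, v3⟩ := hv
          ext
          · rw [u3, v3]
          · rw [u2, v2]
          · rw [u1, v1]
          · exact huv
      · intro h
        have e : y.1 * (y.2.2.1 * y.2.2.1) = y.1 * (y.2.1 * y.2.1) := by linarith
        have := Nat.mul_self_inj.1 (Nat.eq_of_mul_eq_mul_left h1 e)
        omega
      · intro d hd
        simp only [W1, mem_image, mem_filter] at hd
        obtain ⟨x, ⟨⟨hxW, -⟩, e1, e2, e3⟩, rfl⟩ := hd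
        have h7 := (hW x hxW).2.2.2.2.1
        rw [mem_range, Nat.lt_succ_iff, Nat.le_div_iff_mul_le (by omega), ← e1]
        linarith
      · intro d hd
        simp only [W1, mem_image, mem_filter] at hd
        obtain ⟨x, ⟨⟨hxW, -⟩, e1, e2, e3⟩, rfl⟩ := hd
        obtain ⟨-, -, -, -, -, -, q₁, q₂, q₃, q₄, p1, p2, p3, p4, f1, f2, f3, f4⟩ := hW x hxW
        rw [e1, e2, e3] at f1 f2 f3 f4
        refine ⟨q₁, q₂, q₃, q₄, p1, p2, p3, p4, ?_, ?_, ?_, ?_⟩ <;> zify at f1 f2 f3 f4 <;> push_cast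
        · rw [f1]; exact abs_of_nonneg (by positivity)
        · rw [f2, add_sub_cancel_left]; exact abs_of_nonneg (by positivity)
        · rw [f3]; exact abs_of_nonneg (by positivity)
        · rw [f4, add_sub_cancel_left]; exact abs_of_nonneg (by positivity)
  have hW2 : (#W2 : ℝ) ≤ 16 * K * M ^ 2 / L ^ 2 := by
    apply hbound
    have hlt : ∀ x ∈ W, x.1 < x.2.2.2 := by
      intro x hx
      obtain ⟨h1, h2, h3, h4, h5, h6, -⟩ := hW x hx
      by_contra hle
      push Not at hle
      have := Nat.mul_le_mul h3.le hle
      rw [mul_comm x.2.2.1] at this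
      omega
    refine card_le_of_fibers W2 (fun x => x.2.2.2) (fun x => x.1) (fun x => x.2.1)
      (fun d _ => Q / d) Q (K * (2 * Q) / L ^ 3) (by omega) (by positivity) ?_ ?_ ?_ ?_ ?_
    · intro x hx
      obtain ⟨h1, h2, h3, h4, h5, h6, -⟩ := hW x (mem_filter.1 hx).1
      exact ⟨by omega, (Nat.le_mul_of_pos_left _ (by omega)).trans h5⟩
    · intro x hx
      exact hlt x (mem_filter.1 hx).1
    · intro x hx
      obtain ⟨h1, h2, h3, h4, h5, h6, -⟩ := hW x (mem_filter.1 hx).1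
      refine ⟨h2, ?_⟩
      rw [Nat.le_div_iff_mul_le (by omega)]
      exact (Nat.mul_le_mul_right _ h3.le).trans h5
    · intro d _ _
      exact Nat.div_mul_le_self _ _
    · intro d a b hd
      rcases (W2.filter fun x => x.2.2.2 = d ∧ x.1 = a ∧ x.2.1 = b).eq_empty_or_nonempty with h0 | h0
      · rw [h0]; simp only [card_empty, Nat.cast_zero]; positivity
      obtain ⟨y, hy⟩ := h0
      simp only [W2, mem_filter] at hy
      obtain ⟨⟨hyW, hcc⟩, rfl, rfl, rfl⟩ := hy
      obtain ⟨h1, h2, h3, h4, h5, h6, -⟩ := hW y hyW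
      have had' := hlt y hyW
      have hc : 1 ≤ y.2.2.1 := by omega
      have hdd : y.2.2.2 * y.2.2.2 ≤ Q := by
        rcases le_total y.2.2.1 y.2.2.2 with h | h
        · exact absurd ((Nat.mul_le_mul_left _ h).trans h5) hcc
        · exact (Nat.mul_le_mul_right _ h).trans h5
      obtain ⟨hTl, hTu⟩ := hT _ hd hdd
      have hcQ : y.2.2.1 ≤ Q := (Nat.le_mul_of_pos_right _ h4).trans h5
      have hdQ : y.2.2.2 ≤ Q := (Nat.le_mul_of_pos_left _ hc).trans h5
      have had : y.1 ≤ Q := by omega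
      have hbQ : y.2.1 ≤ Q := h3.le.trans hcQ
      have key := hsieve y.2.2.2 (y.1 * y.2.1) y.1 (y.2.1 * y.2.2.2) (Q / y.2.2.2 + 1)
        hd (by positivity) h1 (by positivity) ?_ (hpow1 _ hdQ) (hpow2 _ _ had hbQ)
        (hpow1 _ had) (hpow2 _ _ hbQ hdQ) hTl
        ((W2.filter fun x => x.2.2.2 = y.2.2.2 ∧ x.1 = y.1 ∧ x.2.1 = y.2.1).image fun x => x.2.2.1)
        ?_ ?_
      · rw [card_image_of_injOn] at key
        · refine key.trans ?_
          calc _ ≤ K * (2 * Q / y.2.2.2) / L ^ 3 := by gcongr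
            _ = _ := by ring
        · intro u hu v hv huv
          simp only [coe_filter, Set.mem_ofPred_eq] at hu hv
          obtain ⟨-, u1, u2, u3⟩ := hu
          obtain ⟨-, v1, v2, v3⟩ := hv
          ext
          · rw [u2, v2]
          · rw [u3, v3]
          · exact huv
          · rw [u1, v1]
      · intro h
        have e : y.2.1 * (y.2.2.2 * y.2.2.2) = y.2.1 * (y.1 * y.1) := by linarith
        have := Nat.mul_self_inj.1 (Nat.eq_of_mul_eq_mul_left h2 e)
        omega
      · intro d hd
        simp only [W2, mem_image, mem_filter] at hd
        obtain ⟨x, ⟨⟨hxW, -⟩, e1, e2, e3⟩, rfl⟩ := hd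
        have h7 := (hW x hxW).2.2.2.2.1
        rw [mem_range, Nat.lt_succ_iff, Nat.le_div_iff_mul_le (by omega), ← e1]
        linarith
      · intro d hd
        simp only [W2, mem_image, mem_filter] at hd
        obtain ⟨x, ⟨⟨hxW, -⟩, e1, e2, e3⟩, rfl⟩ := hd
        obtain ⟨-, -, -, -, -, -, q₁, q₂, q₃, q₄, p1, p2, p3, p4, f1, f2, f3, f4⟩ := hW x hxW
        rw [e1, e2, e3] at f1 f2 f3 f4
        refine ⟨q₁, q₂, q₃, q₄, p1, p2, p3, p4, ?_, ?_, ?_, ?_⟩ <;> zify at f1 f2 f3 f4 <;> push_cast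
        · rw [abs_of_nonneg (by positivity)]; linarith
        · rw [abs_of_nonneg] <;> linarith
        · rw [abs_of_nonneg (by positivity)]; linarith
        · rw [abs_of_nonpos] <;> linarith
  have hcard : (#W : ℝ) = #W1 + #W2 := by
    have := card_filter_add_card_filter_not (s := W) (fun x => x.2.2.1 * x.2.2.1 ≤ Q)
    exact_mod_cast this.symm
  have hlogM : 0 < Real.log M := Real.log_pos (by linarith)
  have hlogle : Real.log M ≤ L := Real.log_le_log (by linarith) (by rw [hQ]; push_cast; linarith)
  calc (#W : ℝ) ≤ 32 * K * M ^ 2 / L ^ 2 := by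
        rw [hcard]
        have e : 32 * K * (M : ℝ) ^ 2 / L ^ 2 = 16 * K * M ^ 2 / L ^ 2 + 16 * K * M ^ 2 / L ^ 2 := by
          ring
        linarith
    _ ≤ _ := by gcongr

theorem exists_factor_param {p₁ p₂ p₃ p₄ : ℕ} (h : p₁ ^ 2 + p₂ ^ 2 = p₃ ^ 2 + p₄ ^ 2)
    (h31 : p₃ < p₁) (h14 : p₁ ≠ p₄) :
    ∃ x : ℕ × ℕ × ℕ × ℕ, 0 < x.1 ∧ 0 < x.2.1 ∧ 0 < x.2.2.1 ∧ 0 < x.2.2.2 ∧ x.2.1 ≠ x.2.2.1 ∧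
      x.2.2.1 * x.2.2.2 + x.1 * x.2.1 = 2 * p₁ ∧ x.2.2.1 * x.2.2.2 = x.1 * x.2.1 + 2 * p₃ ∧
      x.2.1 * x.2.2.2 + x.1 * x.2.2.1 = 2 * p₄ ∧ x.2.1 * x.2.2.2 = x.1 * x.2.2.1 + 2 * p₂ := by
  have h24 : p₂ < p₄ := by nlinarith
  obtain ⟨u, rfl⟩ : ∃ u, p₁ = p₃ + u := ⟨p₁ - p₃, by omega⟩
  obtain ⟨w, rfl⟩ : ∃ w, p₄ = p₂ + w := ⟨p₄ - p₂, by omega⟩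
  have hu : 0 < u := by omega
  have hw : 0 < w := by omega
  have hprod : u * (p₃ + u + p₃) = w * (p₂ + w + p₂) := by nlinarith
  have ha : 0 < Nat.gcd u w := Nat.gcd_pos_of_pos_left _ hu
  obtain ⟨b, c, hcop, hb, hc⟩ := Nat.exists_coprime u w
  set a := Nat.gcd u w
  have hb0 : 0 < b := Nat.pos_of_ne_zero fun h => by rw [h] at hb; omega
  have hc0 : 0 < c := Nat.pos_of_ne_zero fun h => by rw [h] at hc; omega
  have h3 : b * (p₃ + u + p₃) = c * (p₂ + w + p₂) := by
    have : a * (b * (p₃ + u + p₃)) = a * (c * (p₂ + w + p₂)) := by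
      calc _ = b * a * (p₃ + u + p₃) := by ring
        _ = u * (p₃ + u + p₃) := by rw [← hb]
        _ = w * (p₂ + w + p₂) := hprod
        _ = c * a * (p₂ + w + p₂) := by rw [← hc]
        _ = _ := by ring
    exact Nat.eq_of_mul_eq_mul_left ha this
  have h4 : c ∣ p₃ + u + p₃ := hcop.symm.dvd_of_dvd_mul_left ⟨_, h3⟩
  obtain ⟨d, hd⟩ := h4
  have h5 : p₂ + w + p₂ = b * d := by
    rw [hd] at h3
    have : c * (p₂ + w + p₂) = c * (b * d) := by rw [← h3]; ring
    exact Nat.eq_of_mul_eq_mul_left hc0 this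
  have hd0 : 0 < d := Nat.pos_of_ne_zero fun h => by rw [h] at hd; omega
  have hb' : a * b = u := by rw [mul_comm]; exact hb.symm
  have hc' : a * c = w := by rw [mul_comm]; exact hc.symm
  refine ⟨(a, b, c, d), ha, hb0, hc0, hd0, ?_, ?_, ?_, ?_, ?_⟩
  · intro hbc
    simp only at hbc
    subst hbc
    omega
  all_goals dsimp only
  · rw [← hd, hb']; ring
  · rw [← hd, hb']; ring
  · rw [← h5, hc']; ring
  · rw [← h5, hc']; ring

/-- Off-diagonal solutions of `p₁² + p₂² = p₃² + p₄²` in primes are rare. -/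
theorem exists_card_offdiag_le : ∃ (K : ℝ) (M0 : ℕ), 0 < K ∧ ∀ M : ℕ, M0 ≤ M →
    ∀ W : Finset ((ℕ × ℕ) × ℕ × ℕ), (∀ x ∈ W, (x.1.1.Prime ∧ x.1.1 ≤ M) ∧ (x.1.2.Prime ∧ x.1.2 ≤ M) ∧
      (x.2.1.Prime ∧ x.2.1 ≤ M) ∧ (x.2.2.Prime ∧ x.2.2 ≤ M) ∧
      x.1.1 ^ 2 + x.1.2 ^ 2 = x.2.1 ^ 2 + x.2.2 ^ 2 ∧ x.1.1 ≠ x.2.1 ∧ x.1.1 ≠ x.2.2) →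
      (#W : ℝ) ≤ K * M ^ 2 / Real.log M ^ 2 := by
  classical
  obtain ⟨K, M0, hK, h⟩ := exists_card_param_le
  refine ⟨4 * K, M0, by positivity, fun M hM => ?_⟩
  have h := h M hM
  have half : ∀ W : Finset ((ℕ × ℕ) × ℕ × ℕ), (∀ x ∈ W, (x.1.1.Prime ∧ x.1.1 ≤ M) ∧
      (x.1.2.Prime ∧ x.1.2 ≤ M) ∧ (x.2.1.Prime ∧ x.2.1 ≤ M) ∧ (x.2.2.Prime ∧ x.2.2 ≤ M) ∧
      x.1.1 ^ 2 + x.1.2 ^ 2 = x.2.1 ^ 2 + x.2.2 ^ 2 ∧ x.2.1 < x.1.1 ∧ x.1.1 ≠ x.2.2) →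
      (#W : ℝ) ≤ 2 * (K * M ^ 2 / Real.log M ^ 2) := by
    intro W hW
    have hex : ∀ x : (ℕ × ℕ) × ℕ × ℕ, ∃ y : ℕ × ℕ × ℕ × ℕ, x ∈ W → 0 < y.1 ∧ 0 < y.2.1 ∧
        0 < y.2.2.1 ∧ 0 < y.2.2.2 ∧ y.2.1 ≠ y.2.2.1 ∧
        y.2.2.1 * y.2.2.2 + y.1 * y.2.1 = 2 * x.1.1 ∧
        y.2.2.1 * y.2.2.2 = y.1 * y.2.1 + 2 * x.2.1 ∧
        y.2.1 * y.2.2.2 + y.1 * y.2.2.1 = 2 * x.2.2 ∧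
        y.2.1 * y.2.2.2 = y.1 * y.2.2.1 + 2 * x.1.2 := by
      intro x
      by_cases hx : x ∈ W
      · obtain ⟨h1, h2, h3, h4, h5, h6, h7⟩ := hW x hx
        obtain ⟨y, hy⟩ := exists_factor_param h5 h6 h7
        exact ⟨y, fun _ => hy⟩
      · exact ⟨0, fun h => absurd h hx⟩
    choose g hg using hex
    have h1 : (#(W.filter fun x => (g x).2.1 < (g x).2.2.1) : ℝ) ≤ K * M ^ 2 / Real.log M ^ 2 := by
      rw [← card_image_of_injOn (f := g)]
      · refine h _ fun y hy => ?_
        obtain ⟨x, hx, rfl⟩ := mem_image.1 hy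
        obtain ⟨hxW, hlt⟩ := mem_filter.1 hx
        obtain ⟨w1, w2, w3, w4, w5, w6, w7⟩ := hW x hxW
        obtain ⟨g1, g2, g3, g4, g5, g6, g7, g8, g9⟩ := hg x hxW
        have := w2.1.pos
        exact ⟨g1, g2, hlt, g4, by omega, by omega, x.1.1, x.2.1, x.2.2, x.1.2, w1.1, w3.1, w4.1,
          w2.1, g6, g7, g8, g9⟩
      · intro x hx y hy hxy
        have hx' := hg x (mem_filter.1 hx).1
        have hy' := hg y (mem_filter.1 hy).1
        rw [hxy] at hx'
        ext <;> omega
    have h2 : (#(W.filter fun x => ¬ (g x).2.1 < (g x).2.2.1) : ℝ) ≤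
        K * M ^ 2 / Real.log M ^ 2 := by
      rw [← card_image_of_injOn (f := fun x => ((g x).1, (g x).2.2.1, (g x).2.1, (g x).2.2.2))]
      · refine h _ fun y hy => ?_
        obtain ⟨x, hx, rfl⟩ := mem_image.1 hy
        obtain ⟨hxW, hlt⟩ := mem_filter.1 hx
        obtain ⟨w1, w2, w3, w4, w5, w6, w7⟩ := hW x hxW
        obtain ⟨g1, g2, g3, g4, g5, g6, g7, g8, g9⟩ := hg x hxW
        have := w3.1.pos
        refine ⟨g1, g3, ?_, g4, ?_, ?_, x.2.2, x.1.2, x.1.1, x.2.1, w4.1, w2.1, w1.1,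
          w3.1, g8, g9, g6, g7⟩
        all_goals dsimp only
        all_goals omega
      · intro x hx y hy hxy
        have hx' := hg x (mem_filter.1 hx).1
        have hy' := hg y (mem_filter.1 hy).1
        have e : g x = g y := by
          simp only [Prod.mk.injEq] at hxy
          ext
          exacts [hxy.1, hxy.2.2.1, hxy.2.1, hxy.2.2.2]
        rw [e] at hx'
        ext <;> omega
    have hcard : (#W : ℝ) = #(W.filter fun x => (g x).2.1 < (g x).2.2.1) +
        #(W.filter fun x => ¬ (g x).2.1 < (g x).2.2.1) := by
      have := card_filter_add_card_filter_not (s := W) (fun x => (g x).2.1 < (g x).2.2.1)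
      exact_mod_cast this.symm
    linarith
  intro W hW
  have h1 := half (W.filter fun x => x.2.1 < x.1.1) fun x hx => by
    obtain ⟨hxW, hlt⟩ := mem_filter.1 hx
    obtain ⟨w1, w2, w3, w4, w5, w6, w7⟩ := hW x hxW
    exact ⟨w1, w2, w3, w4, w5, hlt, w7⟩
  have h2 := half ((W.filter fun x => ¬ x.2.1 < x.1.1).image Prod.swap) fun y hy => by
    obtain ⟨x, hx, rfl⟩ := mem_image.1 hy
    obtain ⟨hxW, hlt⟩ := mem_filter.1 hx
    obtain ⟨w1, w2, w3, w4, w5, w6, w7⟩ := hW x hxW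
    refine ⟨w3, w4, w1, w2, w5.symm, ?_, ?_⟩
    · simp only [Prod.fst_swap, Prod.snd_swap]; omega
    · simp only [Prod.fst_swap, Prod.snd_swap]
      intro e
      rw [e] at w5
      have : x.1.1 ^ 2 = x.2.2 ^ 2 := by omega
      exact w7 (Nat.pow_left_injective (by norm_num) this)
  rw [card_image_of_injective _ Prod.swap_injective] at h2
  have hcard : (#W : ℝ) = #(W.filter fun x => x.2.1 < x.1.1) +
      #(W.filter fun x => ¬ x.2.1 < x.1.1) := by
    have := card_filter_add_card_filter_not (s := W) (fun x => x.2.1 < x.1.1)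
    exact_mod_cast this.symm
  have e : 4 * K * (M : ℝ) ^ 2 / Real.log M ^ 2 = 2 * (K * M ^ 2 / Real.log M ^ 2) +
    2 * (K * M ^ 2 / Real.log M ^ 2) := by ring
  linarith

/-- The weighted number of representations of `m` as a sum of two squares of primes. -/
noncomputable def primeSquareConv (m : ℕ) : ℝ :=
  ∑ x ∈ (range (m + 1)).filter Nat.Prime ×ˢ (range (m + 1)).filter Nat.Prime,
    if x.1 ^ 2 + x.2 ^ 2 = m then Real.log x.1 * Real.log x.2 else 0

theorem primeSquareConv_nonneg (m : ℕ) : 0 ≤ primeSquareConv m := by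
  refine sum_nonneg fun x _ => ?_
  split_ifs
  · exact mul_nonneg (Real.log_natCast_nonneg _) (Real.log_natCast_nonneg _)
  · exact le_rfl

theorem primeSquareConv_eq {m R : ℕ} (h : m < (R + 1) ^ 2) :
    primeSquareConv m = ∑ x ∈ (range (R + 1)).filter Nat.Prime ×ˢ (range (R + 1)).filter Nat.Prime,
      if x.1 ^ 2 + x.2 ^ 2 = m then Real.log x.1 * Real.log x.2 else 0 := by
  rw [primeSquareConv, ← sum_filter, ← sum_filter]
  refine sum_congr ?_ fun _ _ => rfl
  ext ⟨p, q⟩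
  simp only [mem_filter, mem_product, mem_range]
  constructor
  · rintro ⟨⟨⟨-, h1⟩, -, h2⟩, h3⟩
    refine ⟨⟨⟨?_, h1⟩, ?_, h2⟩, h3⟩
    · exact lt_of_pow_lt_pow_left₀ 2 (by omega) (by omega)
    · exact lt_of_pow_lt_pow_left₀ 2 (by omega) (by omega)
  · rintro ⟨⟨⟨-, h1⟩, -, h2⟩, h3⟩
    have := Nat.le_self_pow (n := 2) (by norm_num) p
    have := Nat.le_self_pow (n := 2) (by norm_num) q
    exact ⟨⟨⟨by omega, h1⟩, by omega, h2⟩, h3⟩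

theorem exists_sum_primeSquareConv_sq_le : ∃ (C : ℝ) (N0 : ℕ), 0 < C ∧ ∀ N : ℕ, N0 ≤ N →
    ∑ m ∈ range (N + 1), primeSquareConv m ^ 2 ≤ C * N * Real.log N ^ 2 := by
  classical
  obtain ⟨K, M0, hK, hoff⟩ := exists_card_offdiag_le
  refine ⟨8 + K, max 4 (M0 ^ 2), by positivity, fun N hN => ?_⟩
  set M := Nat.sqrt N with hM
  have hN4 : 4 ≤ N := (le_max_left _ _).trans hN
  have hM0 : M0 ≤ M := Nat.le_sqrt'.2 ((le_max_right _ _).trans hN)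
  have hM2 : 2 ≤ M := Nat.le_sqrt'.2 (by omega)
  have hMN : M ^ 2 ≤ N := Nat.sqrt_le' N
  have hNM : N < (M + 1) ^ 2 := Nat.lt_succ_sqrt' N
  have hMN' : (M : ℝ) ^ 2 ≤ N := by exact_mod_cast hMN
  have hlogM : 0 < Real.log M := Real.log_pos (by exact_mod_cast hM2)
  have hlogMN : Real.log M ≤ Real.log N :=
    Real.log_le_log (by exact_mod_cast (by omega : 0 < M))
      (by exact_mod_cast (Nat.sqrt_le_self N))
  set P := (range (M + 1)).filter Nat.Prime with hP
  have hPM : ∀ p ∈ P, p.Prime ∧ p ≤ M := fun p hp => by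
    rw [hP, mem_filter, mem_range] at hp
    exact ⟨hp.2, by omega⟩
  let w : ℕ × ℕ → ℝ := fun x => Real.log x.1 * Real.log x.2
  let s : ℕ × ℕ → ℕ := fun x => x.1 ^ 2 + x.2 ^ 2
  have hw0 : ∀ x, 0 ≤ w x := fun x =>
    mul_nonneg (Real.log_natCast_nonneg _) (Real.log_natCast_nonneg _)
  have hwM : ∀ x ∈ P ×ˢ P, w x ≤ Real.log M ^ 2 := by
    intro x hx
    rw [mem_product] at hx
    have h1 := hPM _ hx.1
    have h2 := hPM _ hx.2
    rw [sq]
    refine mul_le_mul ?_ ?_ (Real.log_natCast_nonneg _) hlogM.le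
    · exact Real.log_le_log (by exact_mod_cast h1.1.pos) (by exact_mod_cast h1.2)
    · exact Real.log_le_log (by exact_mod_cast h2.1.pos) (by exact_mod_cast h2.2)
  have hsum : ∑ m ∈ range (N + 1), primeSquareConv m ^ 2 ≤
      ∑ x ∈ P ×ˢ P, ∑ y ∈ P ×ˢ P, if s x = s y then w x * w y else 0 := by
    calc _ = ∑ m ∈ range (N + 1), ∑ x ∈ P ×ˢ P, ∑ y ∈ P ×ˢ P,
          (if s x = m then w x else 0) * (if s y = m then w y else 0) := by
          refine sum_congr rfl fun m hm => ?_
          rw [mem_range] at hm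
          rw [primeSquareConv_eq (R := M) (by omega), sq, sum_mul_sum]
      _ = ∑ x ∈ P ×ˢ P, ∑ y ∈ P ×ˢ P, ∑ m ∈ range (N + 1),
          (if s x = m then w x else 0) * (if s y = m then w y else 0) := by
          rw [sum_comm]
          refine sum_congr rfl fun x _ => sum_comm
      _ ≤ _ := by
          refine sum_le_sum fun x _ => sum_le_sum fun y _ => ?_
          split_ifs with h
          · rw [h]
            calc _ = ∑ m ∈ range (N + 1), if s y = m then w x * w y else 0 := by
                  refine sum_congr rfl fun m _ => ?_
                  split_ifs <;> simp
              _ ≤ w x * w y := by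
                  rw [sum_ite_eq]
                  split_ifs
                  · exact le_rfl
                  · exact mul_nonneg (hw0 _) (hw0 _)
          · refine (sum_eq_zero fun m _ => ?_).le
            by_cases h1 : s x = m
            · rw [if_neg (c := s y = m) (fun h2 => h (h1.trans h2.symm)), mul_zero]
            · rw [if_neg h1, zero_mul]
  set W := ((P ×ˢ P) ×ˢ (P ×ˢ P)).filter
    fun z => s z.1 = s z.2 ∧ z.1.1 ≠ z.2.1 ∧ z.1.1 ≠ z.2.2 with hW
  have hWcard := hoff M hM0 W (by
    intro z hz
    simp only [hW, mem_filter, mem_product] at hz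
    exact ⟨hPM _ hz.1.1.1, hPM _ hz.1.1.2, hPM _ hz.1.2.1, hPM _ hz.1.2.2, hz.2.1, hz.2.2⟩)
  have hdiag : ∑ x ∈ P ×ˢ P, w x * w x ≤ 4 * N * Real.log N ^ 2 := by
    have h1 : ∑ p ∈ P, Real.log p ^ 2 ≤ Real.log M * (2 * M) := by
      calc _ ≤ ∑ p ∈ P, Real.log M * Real.log p := by
            refine sum_le_sum fun p hp => ?_
            rw [sq]
            have := hPM p hp
            exact mul_le_mul_of_nonneg_right (Real.log_le_log (by exact_mod_cast this.1.pos)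
              (by exact_mod_cast this.2)) (Real.log_natCast_nonneg _)
        _ ≤ Real.log M * Chebyshev.theta M := by
            rw [← mul_sum, Chebyshev.theta_eq_sum_Icc, Nat.floor_natCast]
            gcongr
            intro p hp
            have := hPM p hp
            rw [mem_filter, mem_Icc]
            exact ⟨⟨by omega, this.2⟩, this.1⟩
        _ ≤ Real.log M * (2 * M) := by
            gcongr
            refine (Chebyshev.theta_le_log4_mul_x (by positivity)).trans ?_
            gcongr
            rw [show (4 : ℝ) = 2 ^ 2 by norm_num, Real.log_pow]
            have := Real.log_two_lt_d9
            push_cast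
            linarith
    calc _ = (∑ p ∈ P, Real.log p ^ 2) ^ 2 := by
          rw [sq (∑ p ∈ P, Real.log p ^ 2), sum_mul_sum, sum_product]
          refine sum_congr rfl fun x _ => sum_congr rfl fun y _ => ?_
          simp only [w]; ring
      _ ≤ (Real.log M * (2 * M)) ^ 2 := by
          have : 0 ≤ ∑ p ∈ P, Real.log p ^ 2 := sum_nonneg fun _ _ => sq_nonneg _
          gcongr
      _ = 4 * (M : ℝ) ^ 2 * Real.log M ^ 2 := by ring
      _ ≤ _ := by gcongr
  have hsplit : ∑ x ∈ P ×ˢ P, ∑ y ∈ P ×ˢ P, (if s x = s y then w x * w y else 0) ≤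
      ∑ x ∈ P ×ˢ P, w x * w x + ∑ x ∈ P ×ˢ P, w x * w x + ∑ z ∈ W, w z.1 * w z.2 := by
    rw [hW, sum_filter, sum_product (s := P ×ˢ P) (t := P ×ˢ P), ← sum_add_distrib,
      ← sum_add_distrib]
    refine sum_le_sum fun x hx => ?_
    have e1 : w x * w x = ∑ y ∈ P ×ˢ P, if y = x then w x * w y else 0 := by
      rw [sum_ite_eq', if_pos hx]
    have e2 : w x * w x = ∑ y ∈ P ×ˢ P, if y = x.swap then w x * w y else 0 := by
      rw [sum_ite_eq', if_pos (by rw [mem_product] at hx ⊢; exact hx.symm)]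
      simp only [w, Prod.fst_swap, Prod.snd_swap]; ring
    calc _ ≤ ∑ y ∈ P ×ˢ P, ((if y = x then w x * w y else 0) +
          (if y = x.swap then w x * w y else 0) +
          (if s x = s y ∧ x.1 ≠ y.1 ∧ x.1 ≠ y.2 then w x * w y else 0)) := by
          refine sum_le_sum fun y hy => ?_
          have hww := mul_nonneg (hw0 x) (hw0 y)
          by_cases h : s x = s y
          · rw [if_pos h]
            by_cases h1 : x.1 = y.1
            · have : y = x := by
                have h2 : x.2 ^ 2 = y.2 ^ 2 := by simp only [s, h1] at h; omega
                ext
                · exact h1.symm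
                · exact (Nat.pow_left_injective (n := 2) (by norm_num) h2).symm
              rw [if_pos this]
              have a1 : 0 ≤ (if y = x.swap then w x * w y else 0) := by split_ifs <;> simp [hww]
              have a2 : 0 ≤ (if s x = s y ∧ x.1 ≠ y.1 ∧ x.1 ≠ y.2 then w x * w y else 0) := by
                split_ifs <;> simp [hww]
              linarith
            by_cases h1' : x.1 = y.2
            · have : y = x.swap := by
                have h2 : x.2 ^ 2 = y.1 ^ 2 := by simp only [s, h1'] at h; omega
                ext
                · exact (Nat.pow_left_injective (n := 2) (by norm_num) h2).symm
                · exact h1'.symm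
              rw [if_pos this]
              have a1 : 0 ≤ (if y = x then w x * w y else 0) := by split_ifs <;> simp [hww]
              have a2 : 0 ≤ (if s x = s y ∧ x.1 ≠ y.1 ∧ x.1 ≠ y.2 then w x * w y else 0) := by
                split_ifs <;> simp [hww]
              linarith
            rw [if_pos (c := s x = s y ∧ x.1 ≠ y.1 ∧ x.1 ≠ y.2) ⟨h, h1, h1'⟩]
            have a1 : 0 ≤ (if y = x.swap then w x * w y else 0) := by split_ifs <;> simp [hww]
            have a2 : 0 ≤ (if y = x then w x * w y else 0) := by split_ifs <;> simp [hww]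
            linarith
          · rw [if_neg h]
            positivity
      _ = _ := by
          rw [sum_add_distrib, sum_add_distrib, ← e1, ← e2]
  have hWsum : ∑ z ∈ W, w z.1 * w z.2 ≤ K * N * Real.log N ^ 2 := by
    calc _ ≤ ∑ z ∈ W, Real.log M ^ 2 * Real.log M ^ 2 := by
          refine sum_le_sum fun z hz => ?_
          simp only [hW, mem_filter, mem_product] at hz
          exact mul_le_mul (hwM _ (mem_product.2 hz.1.1)) (hwM _ (mem_product.2 hz.1.2))
            (hw0 _) (sq_nonneg _)
      _ = #W * (Real.log M ^ 2 * Real.log M ^ 2) := by rw [sum_const, nsmul_eq_mul]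
      _ ≤ K * M ^ 2 / Real.log M ^ 2 * (Real.log M ^ 2 * Real.log M ^ 2) := by gcongr
      _ = K * M ^ 2 * Real.log M ^ 2 := by field_simp
      _ ≤ _ := by gcongr
  linarith

/-- Splitting a zero off an entire function. -/
lemma exists_entire_factor {f : ℂ → ℂ} (hf : Differentiable ℂ f) {ρ : ℂ} (h : f ρ = 0) :
    ∃ g : ℂ → ℂ, Differentiable ℂ g ∧ ∀ s, f s = (s - ρ) * g s := by
  refine ⟨dslope f ρ, ?_, fun s => ?_⟩
  · rw [← differentiableOn_univ]
    exact (Complex.differentiableOn_dslope univ_mem).2 hf.differentiableOn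
  · have := sub_smul_dslope f ρ s
    simp only [smul_eq_mul, h, sub_zero] at this
    exact this.symm

lemma logDeriv_list_prod_sub (l : List ℂ) {s : ℂ} (hs : s ∉ l) :
    (l.map fun ρ => s - ρ).prod ≠ 0 ∧
    logDeriv (fun z => (l.map fun ρ => z - ρ).prod) s = (l.map fun ρ => (s - ρ)⁻¹).sum := by
  induction l with
  | nil => simp [logDeriv]
  | cons a l ih =>
    simp only [List.mem_cons, not_or] at hs
    obtain ⟨h1, h2⟩ := ih hs.2
    have ha : s - a ≠ 0 := sub_ne_zero.2 hs.1
    have hd : ∀ l : List ℂ, Differentiable ℂ fun z : ℂ => (l.map fun ρ => z - ρ).prod := by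
      intro l
      induction l with
      | nil => simp
      | cons b l ih => simp only [List.map_cons, List.prod_cons]; fun_prop
    refine ⟨by simp [ha, h1], ?_⟩
    simp only [List.map_cons, List.prod_cons, List.sum_cons]
    rw [logDeriv_mul (f := fun z => z - a) (g := fun z => (l.map fun ρ => z - ρ).prod) s ha h1
      (by fun_prop) (hd l s), h2]
    simp [logDeriv]

/-- On the circle of radius `r`, the Blaschke companion has the norm of the linear factor. -/
lemma norm_blaschke_companion {r : ℝ} (hr : 0 < r) {s ρ : ℂ} (hs : ‖s‖ = r) :
    ‖((r : ℂ) ^ 2 - (starRingEnd ℂ) ρ * s) / r‖ = ‖s - ρ‖ := by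
  have h1 : ((r : ℂ) ^ 2 - (starRingEnd ℂ) ρ * s) = s * (starRingEnd ℂ) (s - ρ) := by
    rw [map_sub, mul_sub, Complex.mul_conj, Complex.normSq_eq_norm_sq, hs]
    push_cast; ring
  rw [h1, norm_div, norm_mul, hs, Complex.norm_conj, Complex.norm_real, Real.norm_of_nonneg hr.le]
  field_simp

/-- A bound for the number of zeros that can be split off an entire function. -/
lemma length_mul_log_le_of_factor {f g : ℂ → ℂ} {l : List ℂ} {R R2 M : ℝ} (hR : 0 < R)
    (hR2 : R < R2) (hg : Differentiable ℂ g) (hfg : ∀ s, f s = (l.map fun ρ => s - ρ).prod * g s)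
    (hl : ∀ ρ ∈ l, ‖ρ‖ ≤ R) (hf0 : f 0 ≠ 0)
    (hM : ∀ s : ℂ, ‖s‖ = R2 → ‖f s‖ ≤ Real.exp M * ‖f 0‖) :
    l.length * Real.log (R2 / R) ≤ M := by
  have hR2' : 0 < R2 := hR.trans hR2
  set F : ℂ → ℂ := fun s =>
    (l.map fun ρ => ((R2 : ℂ) ^ 2 - (starRingEnd ℂ) ρ * s) / R2).prod * g s with hF
  have hFd : Differentiable ℂ F := by
    have : ∀ l : List ℂ, Differentiable ℂ fun s : ℂ =>
        (l.map fun ρ => ((R2 : ℂ) ^ 2 - (starRingEnd ℂ) ρ * s) / R2).prod := by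
      intro l
      induction l with
      | nil => simp
      | cons b l ih => simp only [List.map_cons, List.prod_cons]; fun_prop
    exact (this l).mul hg
  have hFn : ∀ s : ℂ, ‖s‖ = R2 → ‖F s‖ = ‖f s‖ := by
    intro s hs
    rw [hfg s, hF]
    simp only [norm_mul]
    congr 1
    clear hfg hl hF hFd
    induction l with
    | nil => simp
    | cons b l ih =>
      simp only [List.map_cons, List.prod_cons, norm_mul]
      rw [norm_blaschke_companion hR2' hs, ih]
  have h1 : ‖F 0‖ ≤ Real.exp M * ‖f 0‖ := by
    refine Complex.norm_le_of_forall_mem_frontier_norm_le (U := Metric.ball 0 R2)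
      Metric.isBounded_ball (hFd.diffContOnCl) ?_ ?_
    · intro z hz
      rw [frontier_ball _ hR2'.ne', mem_sphere_zero_iff_norm] at hz
      rw [hFn z hz]; exact hM z hz
    · rw [closure_ball _ hR2'.ne']; simp [hR2'.le]
  have h2 : ‖F 0‖ = R2 ^ l.length * ‖g 0‖ := by
    simp only [hF, mul_zero, sub_zero, norm_mul]
    congr 1
    have : ((R2 : ℂ) ^ 2 / R2) = R2 := by
      have : (R2 : ℂ) ≠ 0 := by exact_mod_cast hR2'.ne'
      field_simp
    simp [this, abs_of_pos hR2']
  have h3 : ‖f 0‖ ≤ R ^ l.length * ‖g 0‖ := by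
    rw [hfg 0, norm_mul]
    gcongr
    clear hfg hF hFd hFn h2 h1
    induction l with
    | nil => simp
    | cons b l ih =>
      simp only [List.map_cons, List.prod_cons, norm_mul, List.length_cons, pow_succ']
      gcongr
      · simpa using hl b (by simp)
      · exact ih fun ρ hρ => hl ρ (by simp [hρ])
  have hg0 : 0 < ‖g 0‖ := by
    rw [norm_pos_iff]; intro h; apply hf0; rw [hfg 0, h, mul_zero]
  have h4 : R2 ^ l.length ≤ Real.exp M * R ^ l.length := by
    have : R2 ^ l.length * ‖g 0‖ ≤ (Real.exp M * R ^ l.length) * ‖g 0‖ := by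
      rw [← h2]
      refine h1.trans ?_
      rw [mul_assoc]; gcongr
    exact le_of_mul_le_mul_right this hg0
  have h5 : (R2 / R) ^ l.length ≤ Real.exp M := by
    rw [div_pow, div_le_iff₀ (by positivity)]; exact h4
  have := Real.log_le_log (by positivity) h5
  rwa [Real.log_pow, Real.log_exp] at this

/-- A maximal splitting-off of the zeros in a disc. -/
lemma exists_factor_ne_zero {f : ℂ → ℂ} {R R2 M : ℝ} (hR : 0 < R)
    (hR2 : R < R2) (hf : Differentiable ℂ f) (hf0 : f 0 ≠ 0)
    (hM : ∀ s : ℂ, ‖s‖ = R2 → ‖f s‖ ≤ Real.exp M * ‖f 0‖) :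
    ∃ (g : ℂ → ℂ) (l : List ℂ), Differentiable ℂ g ∧
      (∀ s, f s = (l.map fun ρ => s - ρ).prod * g s) ∧ (∀ ρ ∈ l, ‖ρ‖ ≤ R) ∧
      ∀ s : ℂ, ‖s‖ ≤ R → g s ≠ 0 := by
  by_contra! hcon
  have hlog : 0 < Real.log (R2 / R) := Real.log_pos ((one_lt_div hR).2 hR2)
  have key : ∀ n : ℕ, ∃ (g : ℂ → ℂ) (l : List ℂ), Differentiable ℂ g ∧
      (∀ s, f s = (l.map fun ρ => s - ρ).prod * g s) ∧ (∀ ρ ∈ l, ‖ρ‖ ≤ R) ∧ l.length = n := by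
    intro n
    induction n with
    | zero => exact ⟨f, [], hf, by simp, by simp, rfl⟩
    | succ n ih =>
      obtain ⟨g, l, h1, h2, h3, h4⟩ := ih
      obtain ⟨s, hs, hs0⟩ := hcon g l h1 h2 h3
      obtain ⟨g', h5, h6⟩ := exists_entire_factor h1 hs0
      refine ⟨g', s :: l, h5, fun z => ?_, ?_, by simp [h4]⟩
      · rw [h2 z, h6 z]; simp only [List.map_cons, List.prod_cons]; ring
      · intro ρ hρ
        rcases List.mem_cons.1 hρ with rfl | h
        · exact hs
        · exact h3 ρ h
  obtain ⟨n, hn⟩ := exists_nat_gt (M / Real.log (R2 / R))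
  obtain ⟨g, l, h1, h2, h3, h4⟩ := key n
  have := length_mul_log_le_of_factor hR hR2 h1 h2 h3 hf0 hM
  rw [div_lt_iff₀ hlog, ← h4] at hn
  linarith

/-- The logarithmic derivative of a zero-free function of controlled growth. -/
lemma norm_logDeriv_le_of_ne_zero {g : ℂ → ℂ} {R1 R K : ℝ} (hR1 : 0 < R1) (hR : R1 < R)
    (hK : 0 < K) (hg : Differentiable ℂ g) (hg0 : ∀ s : ℂ, ‖s‖ ≤ R → g s ≠ 0)
    (hb : ∀ s : ℂ, ‖s‖ ≤ R → ‖g s‖ ≤ Real.exp K * ‖g 0‖) {s : ℂ} (hs : ‖s‖ ≤ R1) :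
    ‖logDeriv g s‖ ≤ 8 * R / (R - R1) ^ 2 * K := by
  have hRp : 0 < R := hR1.trans hR
  have hgb : ∀ z ∈ Metric.ball (0 : ℂ) R, g z ≠ 0 := fun z hz =>
    hg0 z (by simpa using (mem_ball_zero_iff.1 hz).le)
  have hdl : DifferentiableOn ℂ (logDeriv g) (Metric.ball 0 R) := by
    have : DifferentiableOn ℂ (fun z => deriv g z / g z) (Metric.ball 0 R) :=
      (hg.differentiableOn.deriv Metric.isOpen_ball).fun_div hg.differentiableOn hgb
    exact this
  obtain ⟨h, hh0, hh⟩ := hdl.isExactOn_ball.with_val_at 0 0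
  have hexp : ∀ z ∈ Metric.ball (0 : ℂ) R, g z = g 0 * Complex.exp (h z) := by
    have hconst : ∀ z ∈ Metric.ball (0 : ℂ) R,
        g z * Complex.exp (-h z) = g 0 * Complex.exp (-h 0) := by
      intro z hz
      refine (convex_ball (0 : ℂ) R).is_const_of_fderivWithin_eq_zero (𝕜 := ℂ)
        (f := fun z => g z * Complex.exp (-h z)) ?_ ?_ hz (Metric.mem_ball_self hRp)
      · intro w hw
        exact ((hg w).mul ((hh w hw).differentiableAt.neg.cexp)).differentiableWithinAt
      · intro w hw
        have h1 : HasDerivAt (fun z => g z * Complex.exp (-h z))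
            (deriv g w * Complex.exp (-h w) + g w * (Complex.exp (-h w) * -logDeriv g w)) w :=
          (hg w).hasDerivAt.mul (hh w hw).neg.cexp
        have h2 : deriv g w * Complex.exp (-h w) + g w * (Complex.exp (-h w) * -logDeriv g w)
            = 0 := by
          have := hgb w hw
          simp only [logDeriv_apply]
          field_simp
          ring
        rw [h2] at h1
        rw [fderivWithin_of_isOpen Metric.isOpen_ball hw]
        have := h1.hasFDerivAt.fderiv
        rw [this]; ext; simp
    intro z hz
    have := hconst z hz
    rw [hh0, neg_zero, Complex.exp_zero, mul_one] at this
    rw [← this, mul_assoc, ← Complex.exp_add]; simp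
  have hhd : DifferentiableOn ℂ h (Metric.ball 0 R) := fun z hz =>
    (hh z hz).differentiableAt.differentiableWithinAt
  have hg00 : 0 < ‖g 0‖ := norm_pos_iff.2 (hg0 0 (by simp [hRp.le]))
  have hmaps : Set.MapsTo h (Metric.ball 0 R) {z | z.re ≤ K} := by
    intro z hz
    have h1 := hb z (by simpa using (mem_ball_zero_iff.1 hz).le)
    rw [hexp z hz, norm_mul, Complex.norm_exp, mul_comm] at h1
    exact Real.exp_le_exp.1 (le_of_mul_le_mul_right h1 hg00)
  set δ := (R - R1) / 2 with hδ
  have hδp : 0 < δ := by rw [hδ]; linarith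
  have hsb : s ∈ Metric.ball (0 : ℂ) R := by simpa using hs.trans_lt hR
  have hbound : ∀ z ∈ Metric.sphere s δ, ‖h z‖ ≤ 2 * K * R / δ := by
    intro z hz
    have hz1 : ‖z‖ ≤ R - δ := by
      have : ‖z - s‖ = δ := by simpa [dist_eq_norm] using hz
      have h2 : ‖z‖ ≤ ‖z - s‖ + ‖s‖ := by simpa using norm_add_le (z - s) s
      rw [hδ] at *; linarith
    have h1 := Complex.borelCaratheodory_zero hK hhd hmaps hRp
      (z := z) (by simp; linarith) hh0
    refine h1.trans ?_
    gcongr <;> linarith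
  have hcl : DiffContOnCl ℂ h (Metric.ball s δ) := by
    apply DifferentiableOn.diffContOnCl
    refine hhd.mono ?_
    rw [closure_ball _ hδp.ne']
    intro z hz
    have : ‖z - s‖ ≤ δ := by simpa [dist_eq_norm] using hz
    have h2 : ‖z‖ ≤ ‖z - s‖ + ‖s‖ := by simpa using norm_add_le (z - s) s
    simp only [mem_ball_zero_iff]
    rw [hδ] at *; linarith
  have := Complex.norm_deriv_le_of_forall_mem_sphere_norm_le hδp hcl hbound
  rw [(hh s hsb).deriv] at this
  refine this.trans_eq ?_
  rw [hδ]
  have : R - R1 ≠ 0 := by linarith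
  field_simp; ring

/-- The local partial-fraction approximation of the logarithmic derivative. -/
lemma exists_logDeriv_approx {R1 R R2 : ℝ} (hR1 : 0 < R1) (hR : R1 < R) (hR2 : R < R2) :
    ∃ C : ℝ, 0 < C ∧ ∀ (f : ℂ → ℂ) (M : ℝ), Differentiable ℂ f → f 0 ≠ 0 → 1 ≤ M →
      (∀ s : ℂ, ‖s‖ ≤ R2 → ‖f s‖ ≤ Real.exp M * ‖f 0‖) →
      ∃ l : List ℂ, (l.length : ℝ) ≤ C * M ∧ (∀ ρ ∈ l, ‖ρ‖ ≤ R ∧ f ρ = 0) ∧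
        ∀ s : ℂ, ‖s‖ ≤ R1 → f s ≠ 0 →
          ‖logDeriv f s - (l.map fun ρ => (s - ρ)⁻¹).sum‖ ≤ C * M := by
  have hRp : 0 < R := hR1.trans hR
  have hlog : 0 < Real.log (R2 / R) := Real.log_pos ((one_lt_div hRp).2 hR2)
  set A : ℝ := 1 + R / (R2 - R) with hA
  have hdiff : 0 < R2 - R := by linarith
  have hA1 : 1 < A := by rw [hA]; have : 0 < R / (R2 - R) := by positivity
                         linarith
  have hlA : 0 < Real.log A := Real.log_pos hA1
  set C1 : ℝ := 1 / Real.log (R2 / R) with hC1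
  have hC1p : 0 < C1 := by positivity
  set C2 : ℝ := 8 * R / (R - R1) ^ 2 * (1 + C1 * Real.log A) with hC2
  have hC2p : 0 < C2 := by
    have : 0 < R - R1 := by linarith
    positivity
  refine ⟨C1 + C2, by positivity, fun f M hf hf0 hM hb => ?_⟩
  obtain ⟨g, l, hg, hfg, hl, hgz⟩ := exists_factor_ne_zero hRp hR2 hf hf0
    (fun s hs => hb s hs.le)
  have hlen : (l.length : ℝ) ≤ C1 * M := by
    have := length_mul_log_le_of_factor hRp hR2 hg hfg hl hf0 (fun s hs => hb s hs.le)
    rw [hC1, one_div, ← div_eq_inv_mul, le_div_iff₀ hlog]; exact this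
  have hMp : 0 < M := by linarith
  refine ⟨l, hlen.trans ?_, ?_, ?_⟩
  · gcongr; linarith
  · intro ρ hρ
    refine ⟨hl ρ hρ, ?_⟩
    rw [hfg ρ, List.prod_eq_zero, zero_mul]
    exact List.mem_map.2 ⟨ρ, hρ, by simp⟩
  intro s hs hfs
  have hsl : s ∉ l := by
    intro h; apply hfs; rw [hfg s, List.prod_eq_zero, zero_mul]
    exact List.mem_map.2 ⟨s, h, by simp⟩
  obtain ⟨hp0, hpl⟩ := logDeriv_list_prod_sub l hsl
  have hgs : g s ≠ 0 := hgz s (by linarith)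
  have hld : logDeriv f s = (l.map fun ρ => (s - ρ)⁻¹).sum + logDeriv g s := by
    have hfe : f = fun s => (l.map fun ρ => s - ρ).prod * g s := funext hfg
    have hd : Differentiable ℂ fun z : ℂ => (l.map fun ρ => z - ρ).prod := by
      clear * -
      induction l with
      | nil => simp
      | cons b l ih => simp only [List.map_cons, List.prod_cons]; fun_prop
    rw [hfe, logDeriv_mul (f := fun z => (l.map fun ρ => z - ρ).prod) (g := g) s hp0 hgs
      (hd s) (hg s), hpl]
  rw [hld, add_sub_cancel_left]
  have hg0p : 0 < ‖g 0‖ := norm_pos_iff.2 (hgz 0 (by simp [hRp.le]))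
  have hgb : ∀ s : ℂ, ‖s‖ ≤ R2 → ‖g s‖ ≤ Real.exp (M * (1 + C1 * Real.log A)) * ‖g 0‖ := by
    have hsph : ∀ s : ℂ, ‖s‖ = R2 →
        ‖g s‖ ≤ Real.exp (M * (1 + C1 * Real.log A)) * ‖g 0‖ := by
      intro s hs
      have h1 : (R2 - R) ^ l.length ≤ ‖(l.map fun ρ => s - ρ).prod‖ := by
        clear * - hl hs hdiff
        induction l with
        | nil => simp
        | cons b l ih =>
          simp only [List.map_cons, List.prod_cons, norm_mul, List.length_cons, pow_succ']
          have h1 := hl b (by simp)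
          have h2 : ‖s‖ ≤ ‖s - b‖ + ‖b‖ := by simpa using norm_add_le (s - b) b
          gcongr
          · linarith
          · exact ih fun ρ hρ => hl ρ (by simp [hρ])
      have h3 : ‖f 0‖ ≤ R ^ l.length * ‖g 0‖ := by
        rw [hfg 0, norm_mul]
        gcongr
        clear * - hl hRp
        induction l with
        | nil => simp
        | cons b l ih =>
          simp only [List.map_cons, List.prod_cons, norm_mul, List.length_cons, pow_succ']
          gcongr
          · simpa using hl b (by simp)
          · exact ih fun ρ hρ => hl ρ (by simp [hρ])
      have h4 : (R2 - R) ^ l.length * ‖g s‖ ≤ Real.exp M * (R ^ l.length * ‖g 0‖) := by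
        calc _ ≤ ‖(l.map fun ρ => s - ρ).prod‖ * ‖g s‖ := by gcongr
          _ = ‖f s‖ := by rw [hfg s, norm_mul]
          _ ≤ Real.exp M * ‖f 0‖ := hb s hs.le
          _ ≤ _ := by gcongr
      have h5 : ‖g s‖ ≤ Real.exp M * (R / (R2 - R)) ^ l.length * ‖g 0‖ := by
        rw [div_pow]
        have : 0 < (R2 - R) ^ l.length := by positivity
        rw [← le_div_iff₀' this] at h4
        refine h4.trans_eq ?_
        field_simp
      refine h5.trans ?_
      gcongr
      have h6 : (R / (R2 - R)) ^ l.length ≤ A ^ l.length := by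
        gcongr; linarith
      have h7 : A ^ l.length = Real.exp (l.length * Real.log A) := by
        rw [mul_comm, Real.exp_mul, Real.exp_log (by linarith), Real.rpow_natCast]
      calc Real.exp M * (R / (R2 - R)) ^ l.length
          ≤ Real.exp M * Real.exp (C1 * M * Real.log A) := by
            gcongr
            rw [h7] at h6
            refine h6.trans ?_
            gcongr
        _ = _ := by rw [← Real.exp_add]; congr 1; ring
    intro s hs
    refine Complex.norm_le_of_forall_mem_frontier_norm_le (U := Metric.ball 0 R2)
      Metric.isBounded_ball hg.diffContOnCl ?_ ?_
    · intro z hz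
      rw [frontier_ball _ (by linarith), mem_sphere_zero_iff_norm] at hz
      exact hsph z hz
    · rw [closure_ball _ (by linarith)]; simpa using hs
  have := norm_logDeriv_le_of_ne_zero hR1 hR (K := M * (1 + C1 * Real.log A)) (by positivity) hg
    hgz (fun s hs => hgb s (by linarith)) hs
  refine this.trans ?_
  have : C2 * M ≤ (C1 + C2) * M := by gcongr; linarith
  refine le_trans (le_of_eq ?_) this
  rw [hC2]; ring

/-- The fractional part on `(1, ∞)`, extended by zero. -/
noncomputable def fractTail : ℝ → ℂ := (Set.Ioi (1 : ℝ)).indicator fun x => ((Int.fract x : ℝ) : ℂ)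

lemma norm_fractTail_le (x : ℝ) : ‖fractTail x‖ ≤ 1 := by
  unfold fractTail
  by_cases h : x ∈ Set.Ioi (1 : ℝ)
  · rw [Set.indicator_of_mem h, Complex.norm_real, Real.norm_of_nonneg (Int.fract_nonneg x)]
    exact (Int.fract_lt_one x).le
  · rw [Set.indicator_of_notMem h]; simp

lemma measurable_fractTail : Measurable fractTail :=
  (Complex.measurable_ofReal.comp measurable_fract).indicator measurableSet_Ioi

lemma differentiableAt_mellin_fractTail {s : ℂ} (hs : s.re < 0) :
    MellinConvergent fractTail s ∧ DifferentiableAt ℂ (mellin fractTail) s := by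
  have h1 : MeasureTheory.LocallyIntegrableOn fractTail (Set.Ioi 0) := by
    apply MeasureTheory.LocallyIntegrable.locallyIntegrableOn
    refine (MeasureTheory.locallyIntegrable_const (1 : ℝ)).mono
      measurable_fractTail.aestronglyMeasurable ?_
    filter_upwards with x
    simpa using norm_fractTail_le x
  have h2 : fractTail =O[atTop] (fun x : ℝ => x ^ (-(0 : ℝ))) := by
    refine IsBigO.of_bound 1 ?_
    filter_upwards with x
    simpa using norm_fractTail_le x
  have h3 : fractTail =O[nhdsWithin 0 (Set.Ioi 0)] (fun x : ℝ => x ^ (-(s.re - 1))) := by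
    refine IsBigO.of_bound 1 ?_
    have : Set.Iio (1 : ℝ) ∈ nhdsWithin (0 : ℝ) (Set.Ioi 0) :=
      mem_nhdsWithin_of_mem_nhds (Iio_mem_nhds one_pos)
    filter_upwards [this] with x hx
    have : fractTail x = 0 := Set.indicator_of_notMem (by simp at hx ⊢; linarith) _
    rw [this]; simp
  exact ⟨mellinConvergent_of_isBigO_rpow h1 h2 hs h3 (by linarith),
    mellin_differentiableAt_of_isBigO_rpow h1 h2 hs h3 (by linarith)⟩

lemma mellin_fractTail_eq (s : ℂ) :
    mellin fractTail s = ∫ x in Set.Ioi (1 : ℝ), (x : ℂ) ^ (s - 1) * ((Int.fract x : ℝ) : ℂ) := by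
  unfold mellin fractTail
  have : ∀ x : ℝ, (x : ℂ) ^ (s - 1) • (Set.Ioi (1 : ℝ)).indicator
      (fun x => ((Int.fract x : ℝ) : ℂ)) x = (Set.Ioi (1 : ℝ)).indicator
      (fun x : ℝ => (x : ℂ) ^ (s - 1) * ((Int.fract x : ℝ) : ℂ)) x := by
    intro x
    by_cases h : x ∈ Set.Ioi (1 : ℝ)
    · simp [Set.indicator_of_mem h]
    · simp [Set.indicator_of_notMem h]
  simp_rw [this]
  rw [MeasureTheory.setIntegral_indicator measurableSet_Ioi]
  congr 2
  ext x; simp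

lemma norm_mellin_fractTail_le {s : ℂ} (hs : s.re ≤ -1 / 4) : ‖mellin fractTail s‖ ≤ 4 := by
  rw [mellin_fractTail_eq]
  have hi : MeasureTheory.IntegrableOn (fun x : ℝ => x ^ (-5 / 4 : ℝ)) (Set.Ioi 1) :=
    integrableOn_Ioi_rpow_of_lt (by norm_num) one_pos
  refine (MeasureTheory.norm_integral_le_of_norm_le hi ?_).trans ?_
  · refine (MeasureTheory.ae_restrict_iff' measurableSet_Ioi).2 (Eventually.of_forall fun x hx => ?_)
    have hx : (1 : ℝ) < x := hx
    rw [norm_mul, Complex.norm_cpow_eq_rpow_re_of_pos (by linarith), Complex.norm_real,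
      Real.norm_of_nonneg (Int.fract_nonneg x)]
    calc _ ≤ x ^ (s - 1).re * 1 := by
          gcongr; exact (Int.fract_lt_one x).le
      _ ≤ _ := by
          rw [mul_one]
          apply Real.rpow_le_rpow_of_exponent_le hx.le
          simp; linarith
  · rw [integral_Ioi_rpow_of_lt (by norm_num) one_pos]; norm_num

lemma riemannZeta₁_eq_of_one_lt {s : ℂ} (hs : 1 < s.re) :
    riemannZeta₁ s = s - s * (s - 1) * mellin fractTail (-s) := by
  have hs1 : s ≠ 1 := by rintro rfl; simp at hs
  have hs1' : s - 1 ≠ 0 := sub_ne_zero.2 hs1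
  have h1 : riemannZeta s = s * ∫ t in Set.Ioi (1 : ℝ),
      ((⌊t⌋₊ : ℝ) : ℂ) * (t : ℂ) ^ (-(s + 1)) := by
    rw [← LSeries_one_eq_riemannZeta hs]
    have := LSeries_eq_mul_integral_of_nonneg (fun _ => (1 : ℝ)) zero_le_one hs
      (by simpa using isBigO_refl _ _) (fun _ => zero_le_one)
    simp only [Finset.sum_const, Nat.card_Icc, add_tsub_cancel_right] at this
    convert this using 3
    · simp
    · ext t; simp
  have hpow : ∀ t ∈ Set.Ioi (1 : ℝ), ((⌊t⌋₊ : ℝ) : ℂ) * (t : ℂ) ^ (-(s + 1)) =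
      (t : ℂ) ^ (-s) - (t : ℂ) ^ (-s - 1) * ((Int.fract t : ℝ) : ℂ) := by
    intro t ht
    have ht : (1 : ℝ) < t := ht
    have ht0 : (t : ℂ) ≠ 0 := by exact_mod_cast (by linarith : t ≠ 0)
    have h2 : ((⌊t⌋₊ : ℝ)) = t - Int.fract t := by
      rw [natCast_floor_eq_intCast_floor (by linarith)]; simp [Int.self_sub_fract]
    rw [h2]
    have h3 : (t : ℂ) ^ (-s) = t * (t : ℂ) ^ (-s - 1) := by
      rw [Complex.cpow_sub _ _ ht0, Complex.cpow_one]; field_simp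
    rw [h3, show -(s + 1) = -s - 1 by ring]; push_cast; ring
  have hi2 : MeasureTheory.IntegrableOn
      (fun t : ℝ => (t : ℂ) ^ (-s - 1) * ((Int.fract t : ℝ) : ℂ)) (Set.Ioi 1) := by
    have := (differentiableAt_mellin_fractTail (s := -s) (by simp; linarith)).1
    have := MeasureTheory.IntegrableOn.mono_set this (Set.Ioi_subset_Ioi zero_le_one)
    refine this.congr_fun (fun x hx => ?_) measurableSet_Ioi
    simp only [smul_eq_mul, fractTail, Set.indicator_of_mem hx]
  rw [MeasureTheory.setIntegral_congr_fun measurableSet_Ioi hpow,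
    MeasureTheory.integral_sub (integrableOn_Ioi_cpow_of_lt (by simpa using hs) one_pos) hi2,
    integral_Ioi_cpow_of_lt (by simpa using hs) one_pos, ← mellin_fractTail_eq] at h1
  have h4 : riemannZeta₁ s = (s - 1) * riemannZeta s := by
    rw [riemannZeta_eq_inv_sub_mul hs1]; field_simp
  rw [h4, h1]
  have h5 : -s + 1 ≠ 0 := by intro h; apply hs1'; linear_combination -h
  simp only [Complex.ofReal_one, Complex.one_cpow]
  field_simp
  ring

lemma riemannZeta₁_eq {s : ℂ} (hs : 0 < s.re) :
    riemannZeta₁ s = s - s * (s - 1) * mellin fractTail (-s) := by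
  have hopen : IsOpen {s : ℂ | 0 < s.re} := isOpen_lt continuous_const Complex.continuous_re
  have hconv : Convex ℝ {s : ℂ | 0 < s.re} := convex_halfSpace_re_gt 0
  have hd : DifferentiableOn ℂ (fun s => s - s * (s - 1) * mellin fractTail (-s))
      {s : ℂ | 0 < s.re} := by
    intro z hz
    have h1 : DifferentiableAt ℂ (mellin fractTail) (-z) :=
      (differentiableAt_mellin_fractTail (by simpa using hz)).2
    have h2 : DifferentiableAt ℂ (fun s => mellin fractTail (-s)) z :=
      DifferentiableAt.comp (g := mellin fractTail) z h1 differentiableAt_id.neg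
    have h3 : DifferentiableAt ℂ (fun s => s - s * (s - 1) * mellin fractTail (-s)) z := by
      fun_prop
    exact h3.differentiableWithinAt
  have := (differentiable_riemannZeta₁.differentiableOn.analyticOnNhd hopen).eqOn_of_preconnected_of_eventuallyEq
    (hd.analyticOnNhd hopen) hconv.isPreconnected (z₀ := 2) (by simp) (by
      have : {s : ℂ | 1 < s.re} ∈ nhds (2 : ℂ) :=
        (isOpen_lt continuous_const Complex.continuous_re).mem_nhds (by simp)
      filter_upwards [this] with z hz
      exact riemannZeta₁_eq_of_one_lt hz)
  exact this hs

lemma norm_riemannZeta₁_le {s : ℂ} (hs : 1 / 4 ≤ s.re) :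
    ‖riemannZeta₁ s‖ ≤ 5 * (1 + ‖s‖) ^ 2 := by
  rw [riemannZeta₁_eq (by linarith)]
  have h1 := norm_mellin_fractTail_le (s := -s) (by simp; linarith)
  have h2 : ‖s - 1‖ ≤ ‖s‖ + 1 := by simpa using norm_sub_le s 1
  calc _ ≤ ‖s‖ + ‖s‖ * ‖s - 1‖ * ‖mellin fractTail (-s)‖ := by
        refine (norm_sub_le _ _).trans ?_
        rw [norm_mul, norm_mul]
    _ ≤ ‖s‖ + ‖s‖ * (‖s‖ + 1) * 4 := by gcongr
    _ ≤ _ := by nlinarith [norm_nonneg s]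

lemma norm_riemannZeta₁_two_add_ge (t : ℝ) : 1 / 4 ≤ ‖riemannZeta₁ (2 + t * Complex.I)‖ := by
  set s : ℂ := 2 + t * Complex.I with hs
  have hre : s.re = 2 := by simp [hs]
  have hs1 : s ≠ 1 := by intro h; rw [h] at hre; norm_num at hre
  have hs1' : s - 1 ≠ 0 := sub_ne_zero.2 hs1
  have h4 : riemannZeta₁ s = (s - 1) * riemannZeta s := by
    rw [riemannZeta_eq_inv_sub_mul hs1]; field_simp
  have h5 : 1 ≤ ‖s - 1‖ := by
    have := Complex.re_le_norm (s - 1)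
    simp [hre] at this; linarith
  have hsum : HasSum (fun n : ℕ => 1 / ((n : ℝ) + 1) ^ 2) (Real.pi ^ 2 / 6) := by
    have := (hasSum_nat_add_iff' 1).2 hasSum_zeta_two
    simpa using this
  have hsum2 : HasSum (fun n : ℕ => 1 / ((n : ℝ) + 2) ^ 2) (Real.pi ^ 2 / 6 - 1) := by
    have := (hasSum_nat_add_iff' 1).2 hsum
    simp only [Finset.range_one, Finset.sum_singleton, Nat.cast_zero] at this
    norm_num at this
    refine this.congr_fun fun n => ?_
    rw [show (n : ℝ) + 1 + 1 = n + 2 by ring]; simp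
  have hz : riemannZeta s = 1 + ∑' n : ℕ, 1 / ((n : ℂ) + 2) ^ s := by
    rw [zeta_eq_tsum_one_div_nat_add_one_cpow (by rw [hre]; norm_num)]
    have hsm : Summable fun n : ℕ => 1 / ((n : ℂ) + 1) ^ s := by
      have := (Complex.summable_one_div_nat_cpow (p := s)).2 (by rw [hre]; norm_num)
      have := (summable_nat_add_iff 1).2 this
      simpa using this
    rw [hsm.tsum_eq_zero_add]
    simp [add_assoc]; norm_num
  have hn : ∀ n : ℕ, ‖1 / ((n : ℂ) + 2) ^ s‖ = 1 / ((n : ℝ) + 2) ^ 2 := by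
    intro n
    rw [norm_div, norm_one, show ((n : ℂ) + 2) = ((n + 2 : ℝ) : ℂ) by push_cast; ring,
      Complex.norm_cpow_eq_rpow_re_of_pos (by positivity), hre]
    norm_num
  have h6 : ‖∑' n : ℕ, 1 / ((n : ℂ) + 2) ^ s‖ ≤ Real.pi ^ 2 / 6 - 1 :=
    tsum_of_norm_bounded hsum2 (fun n => (hn n).le)
  have h7 : 1 / 4 ≤ ‖riemannZeta s‖ := by
    rw [hz]
    have h8 := norm_sub_le_norm_add (1 : ℂ) (∑' n : ℕ, 1 / ((n : ℂ) + 2) ^ s)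
    rw [norm_one] at h8
    have : Real.pi ^ 2 < 10.1 := by
      nlinarith [Real.pi_lt_d2, Real.pi_gt_three]
    linarith
  rw [h4, norm_mul]
  nlinarith [norm_nonneg (riemannZeta s)]

/-- `-ζ'/ζ(s) - 1/(s-1)`, completed at `s = 1`. -/
noncomputable def zetaG (s : ℂ) : ℂ := -logDeriv riemannZeta₁ s

/-- The logarithmic height. -/
noncomputable def ell (t : ℝ) : ℝ := Real.log (|t| + 3)

lemma one_le_ell (t : ℝ) : 1 ≤ ell t := by
  unfold ell
  rw [Real.le_log_iff_exp_le (by positivity)]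
  have := Real.exp_one_lt_d9
  linarith [abs_nonneg t]

lemma re_eq_half_of_riemannZeta₁_eq_zero (hRH : RiemannHypothesis) {s : ℂ} (hs : 0 < s.re)
    (h : riemannZeta₁ s = 0) : s.re = 1 / 2 := by
  have hs1 : s ≠ 1 := by rintro rfl; simp at h
  refine hRH s ?_ ?_ hs1
  · rw [riemannZeta_eq_inv_sub_mul hs1, h, mul_zero]
  · rintro ⟨n, hn⟩
    rw [hn] at hs
    simp at hs
    have : (0 : ℝ) ≤ n := n.cast_nonneg
    linarith

lemma riemannZeta₁_ne_zero (hRH : RiemannHypothesis) {s : ℂ} (hs : 1 / 2 < s.re) :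
    riemannZeta₁ s ≠ 0 := fun h => by
  have := re_eq_half_of_riemannZeta₁_eq_zero hRH (by linarith) h
  linarith

lemma differentiableAt_zetaG (hRH : RiemannHypothesis) {s : ℂ} (hs : 1 / 2 < s.re) :
    DifferentiableAt ℂ zetaG s := by
  have h1 : DifferentiableAt ℂ (fun z => deriv riemannZeta₁ z / riemannZeta₁ z) s :=
    (differentiable_riemannZeta₁.deriv s).fun_div (differentiable_riemannZeta₁ s)
      (riemannZeta₁_ne_zero hRH hs)
  exact h1.neg

lemma norm_riemannZeta₁_ratio_le (T : ℝ) {z : ℂ} (hz : ‖z‖ ≤ 1.7) :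
    ‖riemannZeta₁ (2 + T * Complex.I + z)‖ ≤
      Real.exp (6 * ell T) * ‖riemannZeta₁ (2 + T * Complex.I + 0)‖ := by
  have h1 := norm_riemannZeta₁_two_add_ge T
  rw [add_zero]
  have hre : -1.7 ≤ z.re := by
    have := Complex.abs_re_le_norm z
    linarith [(abs_le.1 (this.trans hz)).1]
  have h2 := norm_riemannZeta₁_le (s := 2 + T * Complex.I + z) (by simp; linarith)
  have h3 : ‖2 + T * Complex.I + z‖ ≤ 3.7 + |T| := by
    have h4 : ‖(2 : ℂ) + T * Complex.I‖ ≤ 2 + |T| := by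
      refine (norm_add_le _ _).trans ?_
      simp
    refine (norm_add_le _ _).trans ?_
    linarith
  have h5 : Real.exp (6 * ell T) = (|T| + 3) ^ 6 := by
    unfold ell
    rw [mul_comm, Real.exp_mul, Real.exp_log (by positivity)]
    norm_cast
  rw [h5]
  have hx := abs_nonneg T
  set x := |T|
  have h6 : 20 * (4.7 + x) ^ 2 ≤ (x + 3) ^ 6 := by
    have h7 : (81 : ℝ) ≤ (x + 3) ^ 4 := by
      calc (81 : ℝ) = 3 ^ 4 := by norm_num
        _ ≤ _ := by gcongr; linarith
    calc 20 * (4.7 + x) ^ 2 ≤ 81 * (x + 3) ^ 2 := by nlinarith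
      _ ≤ (x + 3) ^ 4 * (x + 3) ^ 2 := by gcongr
      _ = _ := by ring
  calc _ ≤ 5 * (1 + ‖2 + T * Complex.I + z‖) ^ 2 := h2
    _ ≤ 5 * (1 + (3.7 + x)) ^ 2 := by gcongr
    _ = 20 * (4.7 + x) ^ 2 * (1 / 4) := by ring
    _ ≤ _ := by gcongr

lemma exists_zetaG_bound (hRH : RiemannHypothesis) :
    ∃ C : ℝ, 0 < C ∧ ∀ T : ℝ, ∃ l : List ℝ, (l.length : ℝ) ≤ C * ell T ∧
      ∀ η t : ℝ, 0 < η → η ≤ 1 → |t - T| ≤ 1 / 2 →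
        ‖zetaG (((1 / 2 + η : ℝ) : ℂ) + t * Complex.I)‖ ≤ C * ell T / η ∧
        |(zetaG (((1 / 2 + η : ℝ) : ℂ) + t * Complex.I)).re| ≤
          (l.map fun γ => η / (η ^ 2 + (t - γ) ^ 2)).sum + C * ell T := by
  obtain ⟨C, hC, hmain⟩ := exists_logDeriv_approx (R1 := 1.59) (R := 1.65) (R2 := 1.7)
    (by norm_num) (by norm_num) (by norm_num)
  refine ⟨12 * C, by positivity, fun T => ?_⟩
  have hℓ := one_le_ell T
  set c : ℂ := 2 + T * Complex.I with hc
  obtain ⟨l, hl, hlz, happ⟩ := hmain (fun z => riemannZeta₁ (c + z)) (6 * ell T)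
    (differentiable_riemannZeta₁.comp (by fun_prop)) (by
      simp only [add_zero]
      exact riemannZeta₁_ne_zero hRH (by simp [hc]; norm_num)) (by linarith)
    (fun z hz => norm_riemannZeta₁_ratio_le T hz)
  have hzero : ∀ ρ ∈ l, (c + ρ).re = 1 / 2 := by
    intro ρ hρ
    obtain ⟨h1, h2⟩ := hlz ρ hρ
    refine re_eq_half_of_riemannZeta₁_eq_zero hRH ?_ h2
    have := (abs_le.1 ((Complex.abs_re_le_norm ρ).trans h1)).1
    simp [hc]; linarith
  refine ⟨l.map fun ρ => (c + ρ).im, ?_, fun η t hη hη1 ht => ?_⟩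
  · rw [List.length_map]; linarith [mul_pos hC (by linarith : 0 < ell T)]
  set s : ℂ := ((1 / 2 + η : ℝ) : ℂ) + t * Complex.I with hs
  have hsre : s.re = 1 / 2 + η := by simp [hs]
  have hsim : s.im = t := by simp [hs]
  have hz : ‖s - c‖ ≤ 1.59 := by
    have h1 : (s - c).re = -3 / 2 + η := by simp [hs, hc]; ring
    have h2 : (s - c).im = t - T := by simp [hs, hc]
    have h3 := abs_le.1 ht
    rw [Complex.norm_eq_sqrt_sq_add_sq, h1, h2]
    apply Real.sqrt_le_iff.2 ⟨by norm_num, ?_⟩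
    nlinarith
  have hne : riemannZeta₁ s ≠ 0 := riemannZeta₁_ne_zero hRH (by rw [hsre]; linarith)
  have h1 := happ (s - c) hz (by simpa using hne)
  have h2 : logDeriv (fun z => riemannZeta₁ (c + z)) (s - c) = logDeriv riemannZeta₁ s := by
    have := logDeriv_comp (f := riemannZeta₁) (g := fun z => c + z) (x := s - c)
      (differentiable_riemannZeta₁ _) (by fun_prop)
    rw [show (riemannZeta₁ ∘ fun z => c + z) = fun z => riemannZeta₁ (c + z) from rfl] at this
    rw [this]; simp
  rw [h2] at h1
  have hre : ∀ ρ ∈ l, (s - c - ρ) = (η : ℂ) + ((t - (c + ρ).im : ℝ) : ℂ) * Complex.I := by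
    intro ρ hρ
    have := hzero ρ hρ
    apply Complex.ext
    · have h3 : (s - c - ρ).re = s.re - (c + ρ).re := by simp; ring
      rw [h3, this, hsre]; simp
    · have h3 : (s - c - ρ).im = s.im - (c + ρ).im := by simp; ring
      rw [h3, hsim]; simp
  have hnorm : ∀ l' : List ℂ, (∀ ρ ∈ l', ρ ∈ l) →
      ‖(l'.map fun ρ => (s - c - ρ)⁻¹).sum‖ ≤ l'.length / η := by
    intro l'
    induction l' with
    | nil => simp
    | cons ρ l' ih =>
      intro h
      simp only [List.map_cons, List.sum_cons, List.length_cons, Nat.cast_add, Nat.cast_one]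
      have h3 : ‖(s - c - ρ)⁻¹‖ ≤ 1 / η := by
        rw [norm_inv, ← one_div]
        apply one_div_le_one_div_of_le hη
        have := Complex.re_le_norm (s - c - ρ)
        rw [hre ρ (h ρ (by simp))] at this ⊢
        simpa using this
      calc _ ≤ _ := norm_add_le _ _
        _ ≤ 1 / η + l'.length / η := add_le_add h3 (ih fun ρ hρ => h ρ (by simp [hρ]))
        _ = _ := by ring
  have hreal : ∀ l' : List ℂ, (∀ ρ ∈ l', ρ ∈ l) →
      ((l'.map fun ρ => (s - c - ρ)⁻¹).sum).re =
        ((l'.map fun ρ => (c + ρ).im).map fun γ => η / (η ^ 2 + (t - γ) ^ 2)).sum ∧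
      0 ≤ ((l'.map fun ρ => (c + ρ).im).map fun γ => η / (η ^ 2 + (t - γ) ^ 2)).sum := by
    intro l'
    induction l' with
    | nil => simp
    | cons ρ l' ih =>
      intro h
      obtain ⟨ih1, ih2⟩ := ih fun ρ hρ => h ρ (by simp [hρ])
      simp only [List.map_cons, List.sum_cons, Complex.add_re]
      refine ⟨?_, by positivity⟩
      rw [ih1, hre ρ (h ρ (by simp)), Complex.inv_re]
      congr 1
      rw [Complex.normSq_add_mul_I]
      simp
  have hCl : 0 < C * ell T := by positivity
  constructor
  · have h3 := hnorm l fun ρ h => h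
    have h4 : ‖logDeriv riemannZeta₁ s‖ ≤ l.length / η + C * (6 * ell T) := by
      have := norm_le_insert' (logDeriv riemannZeta₁ s) (l.map fun ρ => (s - c - ρ)⁻¹).sum
      linarith
    rw [zetaG, norm_neg]
    refine h4.trans ?_
    have h5 : C * (6 * ell T) ≤ C * (6 * ell T) / η := by
      rw [le_div_iff₀ hη]; nlinarith
    calc _ ≤ C * (6 * ell T) / η + C * (6 * ell T) / η := by gcongr
      _ = _ := by ring
  · obtain ⟨h3, h4⟩ := hreal l fun ρ h => h
    have h5 := (Complex.abs_re_le_norm _).trans h1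
    rw [Complex.sub_re, h3] at h5
    rw [zetaG, Complex.neg_re, abs_neg]
    have h6 := abs_le.1 h5
    rw [abs_le]
    constructor <;> nlinarith

/-- The real part of `zetaG` on a vertical line to the right of the critical line. -/
noncomputable def zetaMu (η t : ℝ) : ℝ := (zetaG (((1 / 2 + η : ℝ) : ℂ) + t * Complex.I)).re

lemma continuous_zetaG_line (hRH : RiemannHypothesis) {η : ℝ} (hη : 0 < η) :
    Continuous fun t : ℝ => zetaG (((1 / 2 + η : ℝ) : ℂ) + t * Complex.I) := by
  refine continuous_iff_continuousAt.2 fun t => ?_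
  have h1 : ContinuousAt zetaG (((1 / 2 + η : ℝ) : ℂ) + t * Complex.I) :=
    (differentiableAt_zetaG hRH (by simp; linarith)).continuousAt
  exact ContinuousAt.comp (f := fun t : ℝ => ((1 / 2 + η : ℝ) : ℂ) + t * Complex.I) h1
    (by fun_prop)

lemma continuous_zetaMu (hRH : RiemannHypothesis) {η : ℝ} (hη : 0 < η) :
    Continuous (zetaMu η) := Complex.continuous_re.comp (continuous_zetaG_line hRH hη)

lemma intervalIntegral_poisson_le_pi {η : ℝ} (hη : 0 < η) (γ a b : ℝ) :
    ∫ t in a..b, η / (η ^ 2 + (t - γ) ^ 2) ≤ Real.pi := by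
  have h : ∀ t ∈ Set.uIcc a b, HasDerivAt (fun t => Real.arctan ((t - γ) / η))
      (η / (η ^ 2 + (t - γ) ^ 2)) t := by
    intro t _
    have h1 : HasDerivAt (fun t => (t - γ) / η) (1 / η) t :=
      ((hasDerivAt_id t).sub_const γ).div_const η
    convert h1.arctan using 1
    field_simp
  have hc : Continuous fun t => η / (η ^ 2 + (t - γ) ^ 2) := by
    refine Continuous.div (by fun_prop) (by fun_prop) fun t => ?_
    positivity
  rw [intervalIntegral.integral_eq_sub_of_hasDerivAt h (hc.intervalIntegrable _ _)]
  have h1 := Real.arctan_lt_pi_div_two ((b - γ) / η)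
  have h2 := Real.neg_pi_div_two_lt_arctan ((a - γ) / η)
  linarith

lemma exists_window_integral_le (hRH : RiemannHypothesis) :
    ∃ C : ℝ, 0 < C ∧ ∀ η T : ℝ, 0 < η → η ≤ 1 →
      ∫⁻ t in Set.Icc (T - 1 / 2) (T + 1 / 2), ENNReal.ofReal |zetaMu η t| ≤
        ENNReal.ofReal (C * ell T) := by
  obtain ⟨C, hC, hmain⟩ := exists_zetaG_bound hRH
  refine ⟨C * (Real.pi + 1), by positivity, fun η T hη hη1 => ?_⟩
  obtain ⟨l, hl, hb⟩ := hmain T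
  have hle : T - 1 / 2 ≤ T + 1 / 2 := by linarith
  have hcm : Continuous fun t => |zetaMu η t| := (continuous_zetaMu hRH hη).abs
  rw [← MeasureTheory.ofReal_integral_eq_lintegral_ofReal
    (hcm.integrableOn_Icc) (Eventually.of_forall fun t => abs_nonneg _)]
  apply ENNReal.ofReal_le_ofReal
  rw [MeasureTheory.integral_Icc_eq_integral_Ioc, ← intervalIntegral.integral_of_le hle]
  have hsum : ∀ l : List ℝ, Continuous (fun t => (l.map fun γ => η / (η ^ 2 + (t - γ) ^ 2)).sum) ∧
      ∫ t in (T - 1 / 2)..(T + 1 / 2), (l.map fun γ => η / (η ^ 2 + (t - γ) ^ 2)).sum ≤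
        l.length * Real.pi := by
    intro l
    induction l with
    | nil => simp [continuous_const]
    | cons γ l ih =>
      have hc : Continuous fun t => η / (η ^ 2 + (t - γ) ^ 2) := by
        refine Continuous.div (by fun_prop) (by fun_prop) fun t => ?_
        positivity
      simp only [List.map_cons, List.sum_cons, List.length_cons, Nat.cast_add, Nat.cast_one]
      refine ⟨hc.add ih.1, ?_⟩
      rw [intervalIntegral.integral_add (hc.intervalIntegrable _ _) (ih.1.intervalIntegrable _ _)]
      have := intervalIntegral_poisson_le_pi hη γ (T - 1 / 2) (T + 1 / 2)
      linarith [ih.2]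
  calc ∫ t in (T - 1 / 2)..(T + 1 / 2), |zetaMu η t|
      ≤ ∫ t in (T - 1 / 2)..(T + 1 / 2),
          ((l.map fun γ => η / (η ^ 2 + (t - γ) ^ 2)).sum + C * ell T) := by
        refine intervalIntegral.integral_mono_on hle (hcm.intervalIntegrable _ _)
          (((hsum l).1.add continuous_const).intervalIntegrable _ _) fun t ht => ?_
        exact (hb η t hη hη1 (abs_le.2 ⟨by linarith [ht.1], by linarith [ht.2]⟩)).2
    _ = (∫ t in (T - 1 / 2)..(T + 1 / 2), (l.map fun γ => η / (η ^ 2 + (t - γ) ^ 2)).sum)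
          + C * ell T := by
        rw [intervalIntegral.integral_add ((hsum l).1.intervalIntegrable _ _) (by simp)]
        simp; left; norm_num
    _ ≤ C * ell T * Real.pi + C * ell T := by
        gcongr
        refine (hsum l).2.trans ?_
        gcongr
    _ = _ := by ring

/-- Averaging an integral over unit windows. -/
lemma lintegral_mul_le_of_window {φ w w' : ℝ → ENNReal} (hφ : Measurable φ) (hw' : Measurable w')
    (h : ∀ t T : ℝ, |t - T| ≤ 1 / 2 → w t ≤ w' T) :
    ∫⁻ t, φ t * w t ≤ ∫⁻ T, w' T * ∫⁻ t in Set.Icc (T - 1 / 2) (T + 1 / 2), φ t := by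
  have hmem : ∀ t T : ℝ, t ∈ Set.Icc (T - 1 / 2) (T + 1 / 2) ↔
      T ∈ Set.Icc (t - 1 / 2) (t + 1 / 2) := by
    intro t T; simp only [Set.mem_Icc]; constructor <;> rintro ⟨h1, h2⟩ <;>
      exact ⟨by linarith, by linarith⟩
  have hmeas : MeasurableSet {p : ℝ × ℝ | p.2 ∈ Set.Icc (p.1 - 1 / 2) (p.1 + 1 / 2)} := by
    have h1 : MeasurableSet {p : ℝ × ℝ | p.1 - 1 / 2 ≤ p.2} :=
      measurableSet_le (f := fun p : ℝ × ℝ => p.1 - 1 / 2) (g := fun p => p.2)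
        (by fun_prop) (by fun_prop)
    have h2 : MeasurableSet {p : ℝ × ℝ | p.2 ≤ p.1 + 1 / 2} :=
      measurableSet_le (f := fun p : ℝ × ℝ => p.2) (g := fun p => p.1 + 1 / 2)
        (by fun_prop) (by fun_prop)
    exact h1.inter h2
  calc ∫⁻ t, φ t * w t
      ≤ ∫⁻ t, φ t * ∫⁻ T in Set.Icc (t - 1 / 2) (t + 1 / 2), w' T := by
        refine MeasureTheory.lintegral_mono fun t => ?_
        gcongr
        calc w t = ∫⁻ T in Set.Icc (t - 1 / 2) (t + 1 / 2), w t := by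
              rw [MeasureTheory.setLIntegral_const, Real.volume_Icc]; norm_num
          _ ≤ _ := by
              refine MeasureTheory.setLIntegral_mono hw' fun T hT => h t T ?_
              rw [abs_le]; constructor <;> linarith [hT.1, hT.2]
    _ = ∫⁻ t, ∫⁻ T, {p : ℝ × ℝ | p.2 ∈ Set.Icc (p.1 - 1 / 2) (p.1 + 1 / 2)}.indicator
          (fun p => φ p.1 * w' p.2) (t, T) := by
        refine MeasureTheory.lintegral_congr fun t => ?_
        rw [← MeasureTheory.lintegral_const_mul _ hw',
          ← MeasureTheory.lintegral_indicator measurableSet_Icc]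
        rfl
    _ = ∫⁻ T, ∫⁻ t, {p : ℝ × ℝ | p.2 ∈ Set.Icc (p.1 - 1 / 2) (p.1 + 1 / 2)}.indicator
          (fun p => φ p.1 * w' p.2) (t, T) := by
        apply MeasureTheory.lintegral_lintegral_swap
        exact (((hφ.comp measurable_fst).mul (hw'.comp measurable_snd)).indicator
          hmeas).aemeasurable
    _ = _ := by
        refine MeasureTheory.lintegral_congr fun T => ?_
        rw [← MeasureTheory.lintegral_const_mul _ hφ,
          ← MeasureTheory.lintegral_indicator measurableSet_Icc]
        refine MeasureTheory.lintegral_congr fun t => ?_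
        by_cases ht : t ∈ Set.Icc (T - 1 / 2) (T + 1 / 2)
        · rw [Set.indicator_of_mem ht, Set.indicator_of_mem (by exact (hmem t T).1 ht), mul_comm]
        · rw [Set.indicator_of_notMem ht,
            Set.indicator_of_notMem (by exact fun h => ht ((hmem t T).2 h))]

lemma ell_le_mul_sqrt (t T : ℝ) : ell T ≤ 3 * ell t * (1 + |T - t|) ^ (1 / 2 : ℝ) := by
  have h1 := one_le_ell t
  have hu : 1 ≤ 1 + |T - t| := by linarith [abs_nonneg (T - t)]
  set y := (1 + |T - t|) ^ (1 / 2 : ℝ) with hy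
  have hy1 : 1 ≤ y := Real.one_le_rpow hu (by norm_num)
  have h2 : ell T ≤ ell t + Real.log (1 + |T - t|) := by
    unfold ell
    rw [← Real.log_mul (by positivity) (by positivity)]
    apply Real.log_le_log (by positivity)
    have : |T| ≤ |t| + |T - t| := by
      have := abs_add_le t (T - t); simpa using this
    nlinarith [abs_nonneg t, abs_nonneg (T - t)]
  have h3 : Real.log (1 + |T - t|) ≤ 2 * y := by
    have : Real.log (1 + |T - t|) = 2 * Real.log y := by
      rw [hy, Real.log_rpow (by linarith)]; ring
    rw [this]
    have := Real.log_le_sub_one_of_pos (by linarith : 0 < y)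
    linarith
  nlinarith

lemma exists_lintegral_zetaMu_cauchy_le (hRH : RiemannHypothesis) :
    ∃ C : ℝ, 0 < C ∧ ∀ η s : ℝ, 0 < η → η ≤ 1 →
      ∫⁻ t, ENNReal.ofReal |zetaMu η t| * ENNReal.ofReal (1 / (1 + (s - t) ^ 2)) ≤
        ENNReal.ofReal (C * ell s) := by
  obtain ⟨C, hC, hwin⟩ := exists_window_integral_le hRH
  have hint : MeasureTheory.Integrable (fun u : ℝ => (1 + ‖u‖) ^ (-(3 / 2 : ℝ))) :=
    integrable_one_add_norm (by simp; norm_num)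
  set J := ∫ u : ℝ, (1 + ‖u‖) ^ (-(3 / 2 : ℝ)) with hJ
  have hJ0 : 0 ≤ J := MeasureTheory.integral_nonneg fun u => by positivity
  refine ⟨12 * C * (J + 1), by positivity, fun η s hη hη1 => ?_⟩
  have hℓ := one_le_ell s
  calc _ ≤ ∫⁻ T, ENNReal.ofReal (2 / (1 + (s - T) ^ 2)) *
        ∫⁻ t in Set.Icc (T - 1 / 2) (T + 1 / 2), ENNReal.ofReal |zetaMu η t| := by
        refine lintegral_mul_le_of_window
          (continuous_zetaMu hRH hη).abs.measurable.ennreal_ofReal (by fun_prop) ?_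
        intro t T htT
        apply ENNReal.ofReal_le_ofReal
        rw [div_le_div_iff₀ (by positivity) (by positivity)]
        have h1 := abs_le.1 htT
        nlinarith [sq_nonneg (s - t - (t - T))]
    _ ≤ ∫⁻ T, ENNReal.ofReal (12 * C * ell s * (1 + ‖T - s‖) ^ (-(3 / 2 : ℝ))) := by
        refine MeasureTheory.lintegral_mono fun T => ?_
        calc _ ≤ ENNReal.ofReal (2 / (1 + (s - T) ^ 2)) * ENNReal.ofReal (C * ell T) := by
              gcongr; exact hwin η T hη hη1
          _ = ENNReal.ofReal (2 / (1 + (s - T) ^ 2) * (C * ell T)) := by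
              exact (ENNReal.ofReal_mul (by positivity)).symm
          _ ≤ _ := by
              apply ENNReal.ofReal_le_ofReal
              have h1 := ell_le_mul_sqrt s T
              rw [Real.norm_eq_abs]
              set u := |T - s| with hu
              have hu0 : 0 ≤ u := abs_nonneg _
              have h2 : 2 / (1 + (s - T) ^ 2) ≤ 4 * (1 + u) ^ (-2 : ℝ) := by
                have h3 : (s - T) ^ 2 = u ^ 2 := by rw [hu, sq_abs]; ring
                rw [h3, Real.rpow_neg (by positivity), Real.rpow_two, ← div_eq_mul_inv,
                  div_le_div_iff₀ (by positivity) (by positivity)]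
                nlinarith [sq_nonneg (u - 1)]
              calc _ ≤ 4 * (1 + u) ^ (-2 : ℝ) * (C * (3 * ell s * (1 + u) ^ (1 / 2 : ℝ))) := by
                    gcongr
                    have := one_le_ell T
                    positivity
                _ = 12 * C * ell s * ((1 + u) ^ (-2 : ℝ) * (1 + u) ^ (1 / 2 : ℝ)) := by ring
                _ = _ := by
                    rw [← Real.rpow_add (by positivity)]; norm_num
    _ = ENNReal.ofReal (12 * C * ell s * J) := by
        rw [← MeasureTheory.ofReal_integral_eq_lintegral_ofReal]
        · rw [MeasureTheory.integral_const_mul]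
          congr 2
          exact MeasureTheory.integral_sub_right_eq_self
            (fun u : ℝ => (1 + ‖u‖) ^ (-(3 / 2 : ℝ))) s
        · exact (hint.comp_sub_right s).const_mul _
        · exact Eventually.of_forall fun T => by positivity
    _ ≤ _ := by
        apply ENNReal.ofReal_le_ofReal
        have : 0 < C * ell s := by positivity
        nlinarith

open Complex in
lemma norm_cpow_neg_line {y : ℝ} (hy : 0 < y) (σ t : ℝ) :
    ‖(y : ℂ) ^ (-((σ : ℂ) + t * I))‖ = y ^ (-σ) := by
  rw [Complex.norm_cpow_eq_rpow_re_of_pos hy]; simp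

open Complex in
lemma integral_cpow_mul_mellin {h : ℝ → ℂ} {σ y : ℝ} (hy : 0 < y)
    (hconv : MellinConvergent h σ) (hint : VerticalIntegrable (mellin h) σ)
    (hc : ContinuousAt h y) :
    ∫ t : ℝ, (y : ℂ) ^ (-((σ : ℂ) + t * I)) * mellin h ((σ : ℂ) + t * I) =
      2 * Real.pi * h y := by
  have := mellinInv_mellin_eq σ h hy hconv hint hc
  rw [← this, mellinInv]
  have hpi : (Real.pi : ℂ) ≠ 0 := by exact_mod_cast Real.pi_ne_zero
  simp only [smul_eq_mul, real_smul]
  push_cast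
  field_simp
  simp only [mul_comm I]

open Complex in
lemma integral_LSeries_vonMangoldt_mul_mellin {h : ℝ → ℂ} {σ : ℝ} (hσ : 1 < σ)
    (hconv : MellinConvergent h σ) (hint : VerticalIntegrable (mellin h) σ)
    (hc : Continuous h) :
    HasSum (fun n : ℕ => 2 * Real.pi * ((ArithmeticFunction.vonMangoldt n : ℂ) * h n))
      (∫ t : ℝ, LSeries (fun n => (ArithmeticFunction.vonMangoldt n : ℂ)) ((σ : ℂ) + t * I) *
        mellin h ((σ : ℂ) + t * I)) := by
  set a : ℕ → ℂ := fun n => (ArithmeticFunction.vonMangoldt n : ℂ) with ha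
  have hterm : ∀ (n : ℕ) (t : ℝ), LSeries.term a ((σ : ℂ) + t * I) n =
      a n * (n : ℂ) ^ (-((σ : ℂ) + t * I)) := by
    intro n t
    rcases eq_or_ne n 0 with rfl | hn
    · simp [ha]
    · rw [LSeries.term_of_ne_zero hn, cpow_neg, div_eq_mul_inv]
  have hnorm : ∀ (n : ℕ) (t : ℝ), ‖LSeries.term a ((σ : ℂ) + t * I) n‖ =
      ‖LSeries.term a (σ : ℂ) n‖ := by
    intro n t
    rw [LSeries.norm_term_eq, LSeries.norm_term_eq]; simp
  have hsum : LSeriesSummable a (σ : ℂ) :=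
    ArithmeticFunction.LSeriesSummable_vonMangoldt (by simpa using hσ)
  have hpow : ∀ (n : ℕ), n ≠ 0 → Continuous fun t : ℝ => (n : ℂ) ^ (-((σ : ℂ) + t * I)) := by
    intro n hn
    refine Continuous.const_cpow (by fun_prop) (Or.inl (by exact_mod_cast hn))
  have hF : ∀ n : ℕ, MeasureTheory.Integrable (fun t : ℝ =>
      LSeries.term a ((σ : ℂ) + t * I) n * mellin h ((σ : ℂ) + t * I)) := by
    intro n
    refine MeasureTheory.Integrable.bdd_mul (c := ‖LSeries.term a (σ : ℂ) n‖) hint ?_ ?_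
    · rcases eq_or_ne n 0 with rfl | hn
      · simpa using MeasureTheory.aestronglyMeasurable_const
      · simp_rw [hterm]
        exact ((hpow n hn).const_mul _).aestronglyMeasurable
    · exact Eventually.of_forall fun t => (hnorm n t).le
  have hFsum : Summable fun n : ℕ => ∫ t : ℝ,
      ‖LSeries.term a ((σ : ℂ) + t * I) n * mellin h ((σ : ℂ) + t * I)‖ := by
    simp_rw [norm_mul, hnorm, MeasureTheory.integral_const_mul]
    exact hsum.norm.mul_right _
  have key := MeasureTheory.hasSum_integral_of_summable_integral_norm hF hFsum
  simp_rw [tsum_mul_right] at key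
  refine key.congr_fun fun n => ?_
  rcases eq_or_ne n 0 with rfl | hn
  · simp [ha]
  · have := integral_cpow_mul_mellin (y := n) (by positivity) hconv hint hc.continuousAt
    simp_rw [hterm, mul_assoc]
    rw [MeasureTheory.integral_const_mul]
    push_cast at this
    rw [this]; ring

open Complex in
lemma integral_inv_sub_one_mul_mellin {h : ℝ → ℂ} {σ : ℝ} (hσ : 1 < σ)
    (hconv : MellinConvergent h σ) (hint : VerticalIntegrable (mellin h) σ)
    (hc : Continuous h) :
    ∫ t : ℝ, 1 / ((σ : ℂ) + t * I - 1) * mellin h ((σ : ℂ) + t * I) =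
      2 * Real.pi * ∫ y in Set.Ioi (1 : ℝ), h y := by
  have h1 : ∀ t : ℝ, 1 / ((σ : ℂ) + t * I - 1) * mellin h ((σ : ℂ) + t * I) =
      ∫ y in Set.Ioi (1 : ℝ), (y : ℂ) ^ (-((σ : ℂ) + t * I)) * mellin h ((σ : ℂ) + t * I) := by
    intro t
    rw [MeasureTheory.integral_mul_const, integral_Ioi_cpow_of_lt (by simp [hσ]) one_pos]
    congr 1
    simp only [ofReal_one, one_cpow]
    rw [neg_div, ← div_neg]; congr 1; ring
  simp_rw [h1]
  rw [MeasureTheory.integral_integral_swap]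
  · rw [← MeasureTheory.integral_const_mul]
    refine MeasureTheory.setIntegral_congr_fun measurableSet_Ioi fun y hy => ?_
    exact integral_cpow_mul_mellin (lt_trans one_pos hy) hconv hint hc.continuousAt
  · have hy : MeasureTheory.Integrable (fun y : ℝ => y ^ (-σ))
        (MeasureTheory.volume.restrict (Set.Ioi (1 : ℝ))) :=
      integrableOn_Ioi_rpow_of_lt (by linarith) one_pos
    have hprod := MeasureTheory.Integrable.mul_prod hint.norm hy
    refine hprod.mono ?_ ?_
    · refine MeasureTheory.AEStronglyMeasurable.mul ?_ ?_
      · have : Measurable fun p : ℝ × ℝ => ((p.2 : ℂ)) ^ (-((σ : ℂ) + (p.1 : ℂ) * I)) := by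
          fun_prop
        exact this.aestronglyMeasurable
      · exact hint.aestronglyMeasurable.comp_fst
    · have : ∀ᵐ p : ℝ × ℝ ∂(MeasureTheory.volume.prod
          (MeasureTheory.volume.restrict (Set.Ioi (1 : ℝ)))), p.2 ∈ Set.Ioi (1 : ℝ) :=
        MeasureTheory.Measure.quasiMeasurePreserving_snd.ae
          (MeasureTheory.ae_restrict_mem measurableSet_Ioi)
      filter_upwards [this] with p hp
      have hp0 : 0 < p.2 := lt_trans one_pos hp
      simp only [Function.uncurry, norm_mul, norm_norm]
      rw [norm_cpow_neg_line hp0, Real.norm_of_nonneg (by positivity), mul_comm]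

open Complex in
lemma zetaG_eq_of_one_lt {s : ℂ} (hs : 1 < s.re) :
    zetaG s = LSeries (fun n => (ArithmeticFunction.vonMangoldt n : ℂ)) s - 1 / (s - 1) := by
  have hs1 : s ≠ 1 := by rintro rfl; simp at hs
  have hev : riemannZeta₁ =ᶠ[nhds s] fun z => (z - 1) * riemannZeta z := by
    filter_upwards [isOpen_ne.mem_nhds hs1] with z hz
    have hz' : z - 1 ≠ 0 := sub_ne_zero.2 hz
    rw [riemannZeta_eq_inv_sub_mul hz, mul_inv_cancel_left₀ hz']
  have h1 : logDeriv riemannZeta₁ s = logDeriv (fun z => (z - 1) * riemannZeta z) s := by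
    rw [logDeriv_apply, logDeriv_apply, hev.deriv_eq, hev.eq_of_nhds]
  have h2 := logDeriv_mul (f := fun z : ℂ => z - 1) (g := riemannZeta) s (sub_ne_zero.2 hs1)
    (riemannZeta_ne_zero_of_one_lt_re hs) (by fun_prop) (differentiableAt_riemannZeta hs1)
  have h3 := ArithmeticFunction.LSeries_vonMangoldt_eq_deriv_riemannZeta_div hs
  rw [zetaG, h1, h2, h3, logDeriv_apply, logDeriv_apply]
  simp
  ring

open Complex in
/-- On a vertical line to the right of `1`, integrating `zetaG` against a Mellin transform
compares the von Mangoldt sum with the integral. -/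
lemma integral_zetaG_mul_mellin {h : ℝ → ℂ} {σ : ℝ} (hσ : 1 < σ)
    (hconv : MellinConvergent h σ) (hint : VerticalIntegrable (mellin h) σ)
    (hc : Continuous h) {N : ℕ} (hN : ∀ n : ℕ, N < n → h n = 0) :
    ∫ t : ℝ, zetaG ((σ : ℂ) + t * I) * mellin h ((σ : ℂ) + t * I) =
      2 * Real.pi * (∑ n ∈ range (N + 1), (ArithmeticFunction.vonMangoldt n : ℂ) * h n -
        ∫ y in Set.Ioi (1 : ℝ), h y) := by
  have hG : ∀ t : ℝ, zetaG ((σ : ℂ) + t * I) =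
      LSeries (fun n => (ArithmeticFunction.vonMangoldt n : ℂ)) ((σ : ℂ) + t * I) -
        1 / ((σ : ℂ) + t * I - 1) := fun t => zetaG_eq_of_one_lt (by simpa using hσ)
  have hdiff : ∀ t : ℝ, σ - 1 ≤ ‖(σ : ℂ) + t * I - 1‖ := fun t => by
    refine le_trans ?_ (re_le_norm _); simp
  have hne : ∀ t : ℝ, (σ : ℂ) + t * I - 1 ≠ 0 := fun t => by
    rw [← norm_pos_iff]; linarith [hdiff t]
  have hi2 : MeasureTheory.Integrable (fun t : ℝ =>
      1 / ((σ : ℂ) + t * I - 1) * mellin h ((σ : ℂ) + t * I)) := by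
    refine MeasureTheory.Integrable.bdd_mul (c := 1 / (σ - 1)) hint ?_ ?_
    · exact (Continuous.div continuous_const (by fun_prop) hne).aestronglyMeasurable
    · refine Eventually.of_forall fun t => ?_
      rw [norm_div, norm_one]
      exact one_div_le_one_div_of_le (by linarith) (hdiff t)
  have hi1 : MeasureTheory.Integrable (fun t : ℝ =>
      LSeries (fun n => (ArithmeticFunction.vonMangoldt n : ℂ)) ((σ : ℂ) + t * I) *
        mellin h ((σ : ℂ) + t * I)) := by
    have hdiffL : ∀ s : ℂ, 1 < s.re → ContinuousAt
        (LSeries (fun n => (ArithmeticFunction.vonMangoldt n : ℂ))) s := by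
      intro s hs
      have h1 := LSeries_analyticOnNhd (fun n => (ArithmeticFunction.vonMangoldt n : ℂ)) s (by
        refine lt_of_le_of_lt ?_ (EReal.coe_lt_coe_iff.2 hs)
        exact LSeries.abscissaOfAbsConv_le_of_forall_lt_LSeriesSummable fun y hy =>
          ArithmeticFunction.LSeriesSummable_vonMangoldt (by simpa using hy))
      exact h1.continuousAt
    obtain ⟨B, hB⟩ : ∃ B : ℝ, ∀ t : ℝ,
        ‖LSeries (fun n => (ArithmeticFunction.vonMangoldt n : ℂ)) ((σ : ℂ) + t * I)‖ ≤ B := by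
      refine ⟨∑' n, ‖LSeries.term (fun n => (ArithmeticFunction.vonMangoldt n : ℂ)) (σ : ℂ) n‖,
        fun t => ?_⟩
      have hs : LSeriesSummable (fun n => (ArithmeticFunction.vonMangoldt n : ℂ)) (σ : ℂ) :=
        ArithmeticFunction.LSeriesSummable_vonMangoldt (by simpa using hσ)
      refine tsum_of_norm_bounded hs.norm.hasSum fun n => ?_
      rw [LSeries.norm_term_eq, LSeries.norm_term_eq]; simp
    refine MeasureTheory.Integrable.bdd_mul (c := B) hint ?_ (Eventually.of_forall hB)
    refine Continuous.aestronglyMeasurable ?_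
    rw [continuous_iff_continuousAt]
    intro t
    exact ContinuousAt.comp (f := fun t : ℝ => (σ : ℂ) + t * I)
      (hdiffL _ (by simpa using hσ)) (by fun_prop)
  simp_rw [hG, sub_mul]
  rw [MeasureTheory.integral_sub hi1 hi2, integral_inv_sub_one_mul_mellin hσ hconv hint hc,
    ← (integral_LSeries_vonMangoldt_mul_mellin hσ hconv hint hc).tsum_eq,
    tsum_eq_sum (s := range (N + 1)), ← Finset.mul_sum]
  · ring
  · intro n hn
    rw [hN n (by simpa using hn)]; simp

open Complex in
/-- Shifting a vertical line of integration. -/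
lemma integral_vertical_line_eq {F : ℂ → ℂ} {σ σ₁ B : ℝ} (hσ : σ ≤ σ₁)
    (hd : ∀ s : ℂ, s.re ∈ Set.Icc σ σ₁ → DifferentiableAt ℂ F s)
    (hB : ∀ s : ℂ, s.re ∈ Set.Icc σ σ₁ → ‖F s‖ ≤ B * (1 + ‖s.im‖) ^ (-(3 / 2 : ℝ))) :
    (∀ x ∈ Set.Icc σ σ₁, MeasureTheory.Integrable fun t : ℝ => F ((x : ℂ) + t * I)) ∧
      ∫ t : ℝ, F ((σ : ℂ) + t * I) = ∫ t : ℝ, F ((σ₁ : ℂ) + t * I) := by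
  have hint : MeasureTheory.Integrable (fun u : ℝ => B * (1 + ‖u‖) ^ (-(3 / 2 : ℝ))) :=
    (integrable_one_add_norm (by simp; norm_num)).const_mul B
  have hI : ∀ x ∈ Set.Icc σ σ₁, MeasureTheory.Integrable fun t : ℝ => F ((x : ℂ) + t * I) := by
    intro x hx
    refine hint.mono' (Continuous.aestronglyMeasurable ?_) (Eventually.of_forall fun t => ?_)
    · rw [continuous_iff_continuousAt]
      intro t
      exact ContinuousAt.comp (f := fun t : ℝ => (x : ℂ) + t * I)
        (hd _ (by simpa using hx)).continuousAt (by fun_prop)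
    · simpa using hB ((x : ℂ) + t * I) (by simpa using hx)
  refine ⟨hI, ?_⟩
  have hrect : ∀ R : ℝ, (∫ x in σ..σ₁, F (x + ((-R : ℝ) : ℂ) * I)) -
      (∫ x in σ..σ₁, F (x + (R : ℂ) * I)) + I • (∫ y in (-R)..R, F ((σ₁ : ℂ) + y * I)) -
      I • (∫ y in (-R)..R, F ((σ : ℂ) + y * I)) = 0 := by
    intro R
    have := integral_boundary_rect_eq_zero_of_differentiableOn F
      ((σ : ℂ) + ((-R : ℝ) : ℂ) * I) ((σ₁ : ℂ) + (R : ℂ) * I) (by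
        intro s hs
        refine (hd s ?_).differentiableWithinAt
        have := (mem_reProdIm.1 hs).1
        simpa [Set.uIcc_of_le hσ] using this)
    simpa using this
  have hzero : Tendsto (fun R : ℝ => B * (1 + ‖R‖) ^ (-(3 / 2 : ℝ)) * |σ₁ - σ|) atTop (nhds 0) := by
    have h1 : Tendsto (fun R : ℝ => (1 + ‖R‖)) atTop atTop :=
      tendsto_atTop_add_const_left _ _ tendsto_norm_atTop_atTop
    have h2 := ((tendsto_rpow_neg_atTop (by norm_num : (0 : ℝ) < 3 / 2)).comp h1)
    simpa using (h2.const_mul B).mul_const |σ₁ - σ|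
  have hbd : ∀ R r : ℝ, |r| = |R| → ‖∫ x in σ..σ₁, F (x + (r : ℂ) * I)‖ ≤
      B * (1 + ‖R‖) ^ (-(3 / 2 : ℝ)) * |σ₁ - σ| := by
    intro R r hr
    refine intervalIntegral.norm_integral_le_of_norm_le_const fun x hx => ?_
    rw [Set.uIoc_of_le hσ] at hx
    have := hB ((x : ℂ) + (r : ℂ) * I) (by simpa using ⟨hx.1.le, hx.2⟩)
    simpa [hr] using this
  have ht1 : Tendsto (fun R : ℝ => ∫ x in σ..σ₁, F (x + ((-R : ℝ) : ℂ) * I)) atTop (nhds 0) :=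
    squeeze_zero_norm (fun R => hbd R (-R) (by simp)) hzero
  have ht2 : Tendsto (fun R : ℝ => ∫ x in σ..σ₁, F (x + (R : ℂ) * I)) atTop (nhds 0) :=
    squeeze_zero_norm (fun R => hbd R R rfl) hzero
  have ht3 := MeasureTheory.intervalIntegral_tendsto_integral
    (hI σ₁ ⟨hσ, le_rfl⟩) tendsto_neg_atTop_atBot tendsto_id
  have ht4 := MeasureTheory.intervalIntegral_tendsto_integral
    (hI σ ⟨le_rfl, hσ⟩) tendsto_neg_atTop_atBot tendsto_id
  have hlim := ((ht1.sub ht2).add (ht3.const_smul I)).sub (ht4.const_smul I)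
  simp only [id] at hlim
  simp_rw [hrect] at hlim
  have := tendsto_nhds_unique tendsto_const_nhds hlim
  simp only [sub_self, zero_add, smul_eq_mul, ← mul_sub] at this
  have h5 := (mul_eq_zero.1 this.symm).resolve_left I_ne_zero
  exact (sub_eq_zero.1 h5).symm

open Complex in
lemma exists_norm_zetaG_strip_le (hRH : RiemannHypothesis) {η : ℝ} (hη : 0 < η) :
    ∃ B : ℝ, 0 < B ∧ ∀ s : ℂ, s.re ∈ Set.Icc (1 / 2 + η) (3 / 2) → ‖zetaG s‖ ≤ B * ell s.im := by
  obtain ⟨C, hC, h⟩ := exists_zetaG_bound hRH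
  refine ⟨C / η, by positivity, fun s hs => ?_⟩
  obtain ⟨l, -, hl⟩ := h s.im
  have h1 := (hl (s.re - 1 / 2) s.im (by linarith [hs.1]) (by linarith [hs.2]) (by simp)).1
  have h2 : (((1 / 2 + (s.re - 1 / 2) : ℝ) : ℂ) + s.im * I) = s := by
    rw [add_sub_cancel]; exact re_add_im s
  rw [h2] at h1
  refine h1.trans ?_
  have := one_le_ell s.im
  rw [div_mul_eq_mul_div]
  gcongr
  linarith [hs.1]

/-- `ell t / (1 + t ^ 2)` is dominated by an integrable power. -/
lemma ell_div_le (t : ℝ) :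
    ell t / (1 + t ^ 2) ≤ 3 * ell 0 * 2 * (1 + ‖t‖) ^ (-(3 / 2 : ℝ)) := by
  have h1 := ell_le_mul_sqrt 0 t
  have h0 := one_le_ell 0
  rw [sub_zero] at h1
  rw [Real.norm_eq_abs]
  set u := |t|
  have hu : 0 ≤ u := abs_nonneg t
  have h2 : (1 + u) ^ 2 ≤ 2 * (1 + t ^ 2) := by
    rw [← sq_abs t]; nlinarith [sq_nonneg (u - 1)]
  have h3 : (1 + u) ^ (-(3 / 2 : ℝ)) = (1 + u) ^ (1 / 2 : ℝ) / (1 + u) ^ 2 := by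
    rw [← Real.rpow_natCast (1 + u) 2, ← Real.rpow_sub (by positivity)]; norm_num
  rw [h3, div_le_iff₀ (by positivity)]
  refine h1.trans ?_
  have : 1 ≤ 2 / (1 + u) ^ 2 * (1 + t ^ 2) := by
    rw [div_mul_eq_mul_div, le_div_iff₀ (by positivity)]; linarith
  calc 3 * ell 0 * (1 + u) ^ (1 / 2 : ℝ) = 3 * ell 0 * (1 + u) ^ (1 / 2 : ℝ) * 1 := by ring
    _ ≤ 3 * ell 0 * (1 + u) ^ (1 / 2 : ℝ) * (2 / (1 + u) ^ 2 * (1 + t ^ 2)) := by gcongr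
    _ = _ := by ring

section CompactSupport

variable {h : ℝ → ℂ} {a b : ℝ}

lemma isBigO_atTop_of_eq_zero (hz : ∀ y, y ∉ Set.Icc a b → h y = 0) (g : ℝ → ℝ) :
    h =O[atTop] g := by
  refine (Asymptotics.isBigO_zero g atTop).congr' ?_ EventuallyEq.rfl
  filter_upwards [eventually_gt_atTop b] with y hy
  exact (hz y fun h => absurd h.2 (not_le.2 hy)).symm

lemma isBigO_nhdsGT_zero_of_eq_zero (ha : 0 < a) (hz : ∀ y, y ∉ Set.Icc a b → h y = 0)
    (g : ℝ → ℝ) : h =O[nhdsWithin 0 (Set.Ioi 0)] g := by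
  refine (Asymptotics.isBigO_zero g _).congr' ?_ EventuallyEq.rfl
  filter_upwards [nhdsWithin_le_nhds (gt_mem_nhds ha)] with y hy
  exact (hz y fun h => absurd h.1 (not_le.2 hy)).symm

lemma mellinConvergent_of_eq_zero (ha : 0 < a) (hc : Continuous h)
    (hz : ∀ y, y ∉ Set.Icc a b → h y = 0) (s : ℂ) : MellinConvergent h s :=
  mellinConvergent_of_isBigO_rpow (a := s.re + 1) (b := s.re - 1)
    (hc.locallyIntegrable.locallyIntegrableOn _)
    (isBigO_atTop_of_eq_zero hz _) (by linarith) (isBigO_nhdsGT_zero_of_eq_zero ha hz _)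
    (by linarith)

lemma differentiableAt_mellin_of_eq_zero (ha : 0 < a) (hc : Continuous h)
    (hz : ∀ y, y ∉ Set.Icc a b → h y = 0) (s : ℂ) : DifferentiableAt ℂ (mellin h) s :=
  mellin_differentiableAt_of_isBigO_rpow (a := s.re + 1) (b := s.re - 1)
    (hc.locallyIntegrable.locallyIntegrableOn _)
    (isBigO_atTop_of_eq_zero hz _) (by linarith) (isBigO_nhdsGT_zero_of_eq_zero ha hz _)
    (by linarith)

end CompactSupport

open Complex in
lemma mellin_reflect (h : ℝ → ℂ) (c s : ℂ) :
    mellin (fun y : ℝ => (y : ℂ) ^ (-c) • h y⁻¹) s = mellin h (c - s) := by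
  rw [mellin_cpow_smul, mellin_comp_inv]; congr 1; ring

lemma reflect_eq_zero {h : ℝ → ℂ} {a b : ℝ} (ha : 0 < a)
    (hz : ∀ y, y ∉ Set.Icc a b → h y = 0) (c : ℂ) (y : ℝ)
    (hy : y ∉ Set.Icc (1 / (|b| + 1)) (1 / a)) : (y : ℂ) ^ (-c) • h y⁻¹ = 0 := by
  rw [hz, smul_zero]
  rintro ⟨h1, h2⟩
  have hy0 : 0 < y := inv_pos.1 (lt_of_lt_of_le ha h1)
  refine hy ⟨?_, ?_⟩
  · rw [one_div, inv_le_comm₀ (by positivity) hy0]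
    linarith [le_abs_self b]
  · rw [one_div, le_inv_comm₀ hy0 ha]; exact h1

lemma continuous_reflect {h : ℝ → ℂ} {a b : ℝ} (ha : 0 < a) (hc : Continuous h)
    (hz : ∀ y, y ∉ Set.Icc a b → h y = 0) (c : ℂ) :
    Continuous fun y : ℝ => (y : ℂ) ^ (-c) • h y⁻¹ := by
  rw [continuous_iff_continuousAt]
  intro y
  rcases lt_or_ge 0 y with hy | hy
  · have h1 : ContinuousAt (fun y : ℝ => (y : ℂ) ^ (-c)) y :=
      Complex.continuousAt_ofReal_cpow_const y (-c) (Or.inr hy.ne')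
    have h2 : ContinuousAt (fun y : ℝ => h y⁻¹) y :=
      ContinuousAt.comp (f := fun y : ℝ => y⁻¹) hc.continuousAt (continuousAt_inv₀ hy.ne')
    exact h1.smul h2
  · have : (fun y : ℝ => (y : ℂ) ^ (-c) • h y⁻¹) =ᶠ[nhds y] fun _ => 0 := by
      filter_upwards [gt_mem_nhds (show y < 1 / (|b| + 1) from
        lt_of_le_of_lt hy (by positivity))] with x hx
      exact reflect_eq_zero ha hz c x fun h => absurd h.1 (not_le.2 hx)
    exact continuousAt_const.congr this.symm

lemma mellin_ofReal_conj (k : ℝ → ℝ) (s : ℂ) :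
    mellin (fun y => (k y : ℂ)) ((starRingEnd ℂ) s) =
      (starRingEnd ℂ) (mellin (fun y => (k y : ℂ)) s) := by
  rw [mellin, mellin, ← integral_conj]
  refine MeasureTheory.setIntegral_congr_fun measurableSet_Ioi fun y hy => ?_
  have hy0 : (0 : ℝ) < y := hy
  simp only [smul_eq_mul, map_mul, Complex.conj_ofReal]
  congr 1
  have harg : (y : ℂ).arg ≠ Real.pi := by
    rw [Complex.arg_ofReal_of_nonneg hy0.le]; exact Real.pi_pos.ne
  have := Complex.cpow_conj (y : ℂ) (s - 1) harg
  rw [Complex.conj_ofReal] at this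
  rw [← this]; simp

open Complex in
/-- Smoothed explicit formula on the line `Re s = 1/2 + η`. -/
theorem integral_zetaMu_mul_mellin (hRH : RiemannHypothesis) {k : ℝ → ℝ} {a b η B : ℝ}
    (ha : 1 < a) (hc : Continuous k) (hz : ∀ y, y ∉ Set.Icc a b → k y = 0)
    (hη : 0 < η) (hη1 : η ≤ 1 / 2)
    (hB : ∀ s : ℂ, s.re ∈ Set.Icc η (3 / 2) →
      ‖mellin (fun y => (k y : ℂ)) s‖ ≤ B / (1 + s.im ^ 2))
    {N : ℕ} (hN : b < N) :
    ∫ t : ℝ, (zetaMu η t : ℂ) * mellin (fun y => (k y : ℂ)) (((1 / 2 + η : ℝ) : ℂ) + t * I) =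
      Real.pi * ((∑ n ∈ range (N + 1), ArithmeticFunction.vonMangoldt n * k n -
        ∫ y in Set.Ioi (1 : ℝ), k y : ℝ) : ℂ) := by
  set h : ℝ → ℂ := fun y => (k y : ℂ) with hh
  have ha0 : 0 < a := by linarith
  have hhc : Continuous h := continuous_ofReal.comp hc
  have hhz : ∀ y, y ∉ Set.Icc a b → h y = 0 := fun y hy => by simp [hh, hz y hy]
  set σ : ℝ := 1 / 2 + η with hσ
  set σ₁ : ℝ := 1 + η with hσ₁
  set h' : ℝ → ℂ := fun y => (y : ℂ) ^ (-((2 * σ : ℝ) : ℂ)) • h y⁻¹ with hh'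
  have hm' : ∀ s, mellin h' s = mellin h (((2 * σ : ℝ) : ℂ) - s) := fun s => mellin_reflect h _ s
  have hh'c : Continuous h' := continuous_reflect ha0 hhc hhz _
  obtain ⟨A, hA, hG⟩ := exists_norm_zetaG_strip_le hRH hη
  have hB0 : 0 ≤ B := by
    have := (norm_nonneg _).trans (hB (1 : ℂ) ⟨by simp; linarith, by norm_num⟩)
    simpa using this
  have bound : ∀ s w : ℂ, s.re ∈ Set.Icc σ σ₁ → w.re ∈ Set.Icc η (3 / 2) → w.im ^ 2 = s.im ^ 2 →
      ‖zetaG s * mellin h w‖ ≤ A * B * (3 * ell 0 * 2) * (1 + ‖s.im‖) ^ (-(3 / 2 : ℝ)) := by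
    intro s w hs hw him
    rw [norm_mul]
    have h1 := hG s ⟨hs.1, hs.2.trans (by linarith)⟩
    have h2 := hB w hw
    rw [him] at h2
    have := one_le_ell s.im
    calc _ ≤ (A * ell s.im) * (B / (1 + s.im ^ 2)) := by gcongr
      _ = A * B * (ell s.im / (1 + s.im ^ 2)) := by ring
      _ ≤ A * B * (3 * ell 0 * 2 * (1 + ‖s.im‖) ^ (-(3 / 2 : ℝ))) := by
        gcongr; exact ell_div_le _
      _ = _ := by ring
  have hvert : ∀ x ∈ Set.Icc η (3 / 2), MeasureTheory.Integrable
      fun t : ℝ => mellin h ((x : ℂ) + t * I) := by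
    intro x hx
    refine (integrable_inv_one_add_sq.const_mul B).mono' ?_ (Eventually.of_forall fun t => ?_)
    · refine Continuous.aestronglyMeasurable ?_
      rw [continuous_iff_continuousAt]
      intro t
      exact ContinuousAt.comp (f := fun t : ℝ => (x : ℂ) + t * I)
        (differentiableAt_mellin_of_eq_zero ha0 hhc hhz _).continuousAt (by fun_prop)
    · have := hB ((x : ℂ) + t * I) (by simpa using hx)
      simpa [div_eq_mul_inv] using this
  have hI1 := integral_vertical_line_eq (F := fun s => zetaG s * mellin h s)
    (B := A * B * (3 * ell 0 * 2)) (show σ ≤ σ₁ by linarith)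
    (fun s hs => (differentiableAt_zetaG hRH (by linarith [hs.1])).mul
      (differentiableAt_mellin_of_eq_zero ha0 hhc hhz _))
    (fun s hs => bound s s hs ⟨by linarith [hs.1], by linarith [hs.2]⟩ rfl)
  have hI2 := integral_vertical_line_eq (F := fun s => zetaG s * mellin h (((2 * σ : ℝ) : ℂ) - s))
    (B := A * B * (3 * ell 0 * 2)) (show σ ≤ σ₁ by linarith)
    (fun s hs => (differentiableAt_zetaG hRH (by linarith [hs.1])).mul
      ((differentiableAt_mellin_of_eq_zero ha0 hhc hhz _).comp s (by fun_prop)))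
    (fun s hs => bound s _ hs (by
      rw [sub_re, ofReal_re]
      exact ⟨by linarith [hs.2], by linarith [hs.1]⟩) (by simp))
  have hE1 := integral_zetaG_mul_mellin (h := h) (σ := σ₁) (by linarith)
    (mellinConvergent_of_eq_zero ha0 hhc hhz _) (hvert σ₁ ⟨by linarith, by linarith⟩) hhc
    (N := N) (fun n hn => hhz _ fun h => by
      have : (N : ℝ) < n := by exact_mod_cast hn
      linarith [h.2])
  have hv2 : VerticalIntegrable (mellin h') σ₁ := by
    have := (hvert η ⟨le_rfl, by linarith⟩).comp_neg
    refine this.congr (Eventually.of_forall fun t => ?_)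
    simp only [hm', hσ, hσ₁]
    congr 1
    push_cast
    ring
  have hz1 : ∀ y : ℝ, 1 ≤ y → h' y = 0 := by
    intro y hy
    simp only [hh']
    rw [hhz, smul_zero]
    intro h3
    have := inv_le_one_of_one_le₀ hy
    linarith [h3.1]
  have hE2 := integral_zetaG_mul_mellin (h := h') (σ := σ₁) (by linarith)
    (mellinConvergent_of_eq_zero (by positivity) hh'c (reflect_eq_zero ha0 hhz _) _) hv2 hh'c
    (N := 0) (fun n hn => hz1 n (by exact_mod_cast hn))
  have hE2' : ∫ t : ℝ, zetaG ((σ : ℂ) + t * I) * mellin h (((2 * σ : ℝ) : ℂ) - ((σ : ℂ) + t * I)) = 0 := by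
    rw [hI2.2]
    simp_rw [hm'] at hE2
    have h0 : ∫ y in Set.Ioi (1 : ℝ), h' y = 0 :=
      MeasureTheory.setIntegral_eq_zero_of_forall_eq_zero fun y hy => hz1 y (le_of_lt hy)
    rw [hE2, h0]
    simp
  have hconj : ∀ t : ℝ, ((2 * σ : ℝ) : ℂ) - ((σ : ℂ) + t * I) =
      (starRingEnd ℂ) ((σ : ℂ) + t * I) := by
    intro t
    simp only [map_add, map_mul, conj_ofReal, conj_I]
    push_cast; ring
  have hE3 : ∫ t : ℝ, (starRingEnd ℂ) (zetaG ((σ : ℂ) + t * I)) * mellin h ((σ : ℂ) + t * I) = 0 := by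
    have := congrArg (starRingEnd ℂ) hE2'
    rw [← integral_conj, map_zero] at this
    rw [← this]
    refine MeasureTheory.integral_congr_ae (Eventually.of_forall fun t => ?_)
    simp only [hconj, map_mul, hh, mellin_ofReal_conj, conj_conj]
  have hint1 := hI1.1 σ ⟨le_rfl, by linarith⟩
  have hint3 : MeasureTheory.Integrable fun t : ℝ =>
      (starRingEnd ℂ) (zetaG ((σ : ℂ) + t * I)) * mellin h ((σ : ℂ) + t * I) := by
    have := Complex.conjCLE.toContinuousLinearMap.integrable_comp (hI2.1 σ ⟨le_rfl, by linarith⟩)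
    refine this.congr (Eventually.of_forall fun t => ?_)
    simp only [ContinuousLinearEquiv.coe_coe, conjCLE_apply, map_mul, hconj, hh,
      mellin_ofReal_conj, conj_conj]
  have hsum := MeasureTheory.integral_add hint1 hint3
  rw [hE3, add_zero, hI1.2, hE1] at hsum
  have hre : ∀ t : ℝ, (zetaMu η t : ℂ) * mellin h ((σ : ℂ) + t * I) = (1 / 2 : ℂ) *
      (zetaG ((σ : ℂ) + t * I) * mellin h ((σ : ℂ) + t * I) +
        (starRingEnd ℂ) (zetaG ((σ : ℂ) + t * I)) * mellin h ((σ : ℂ) + t * I)) := by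
    intro t
    rw [← add_mul, add_conj, zetaMu, ← mul_assoc, ← hσ, ofReal_mul, ← mul_assoc]
    norm_num
  simp_rw [hre]
  rw [MeasureTheory.integral_const_mul, hsum]
  have : ∫ y in Set.Ioi (1 : ℝ), h y = ((∫ y in Set.Ioi (1 : ℝ), k y : ℝ) : ℂ) := integral_ofReal
  rw [this]
  push_cast
  ring

/-- The trapezoidal weight equal to `1` on `[m + 1/2, n + 1/2]` and supported in
`[m + 1/4, n + 3/4]`. -/
noncomputable def trap (m n : ℕ) (y : ℝ) : ℝ :=
  4 * (max ((n + 3 / 4 : ℝ) - y) 0 - max ((n + 1 / 2 : ℝ) - y) 0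
    - max ((m + 1 / 2 : ℝ) - y) 0 + max ((m + 1 / 4 : ℝ) - y) 0)

lemma continuous_trap (m n : ℕ) : Continuous (trap m n) := by
  unfold trap; fun_prop

lemma trap_eq_zero {m n : ℕ} (hmn : m ≤ n) (y : ℝ)
    (hy : y ∉ Set.Icc (m + 1 / 4 : ℝ) (n + 3 / 4)) : trap m n y = 0 := by
  have h : (m : ℝ) ≤ n := by exact_mod_cast hmn
  rw [Set.mem_Icc, not_and_or, not_le, not_le] at hy
  unfold trap
  rcases hy with hy | hy
  · rw [max_eq_left (by linarith), max_eq_left (by linarith), max_eq_left (by linarith),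
      max_eq_left (by linarith)]; ring
  · rw [max_eq_right (by linarith), max_eq_right (by linarith), max_eq_right (by linarith),
      max_eq_right (by linarith)]; ring

lemma trap_eq_one {m n : ℕ} (y : ℝ) (hy : y ∈ Set.Icc (m + 1 / 2 : ℝ) (n + 1 / 2)) :
    trap m n y = 1 := by
  obtain ⟨h1, h2⟩ := hy
  unfold trap
  rw [max_eq_left (by linarith), max_eq_left (by linarith), max_eq_right (by linarith),
      max_eq_right (by linarith)]; ring

lemma trap_mem_Icc {m n : ℕ} (hmn : m ≤ n) (y : ℝ) : trap m n y ∈ Set.Icc (0 : ℝ) 1 := by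
  have h : (m : ℝ) ≤ n := by exact_mod_cast hmn
  unfold trap
  constructor <;>
  · rcases max_cases ((n + 3 / 4 : ℝ) - y) 0 with h1 | h1 <;>
    rcases max_cases ((n + 1 / 2 : ℝ) - y) 0 with h2 | h2 <;>
    rcases max_cases ((m + 1 / 2 : ℝ) - y) 0 with h3 | h3 <;>
    rcases max_cases ((m + 1 / 4 : ℝ) - y) 0 with h4 | h4 <;>
    rw [h1.1, h2.1, h3.1, h4.1] <;> linarith [h1.2, h2.2, h3.2, h4.2]

lemma sum_vonMangoldt_mul_trap {m n N : ℕ} (hmn : m ≤ n) (hN : n ≤ N) :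
    ∑ j ∈ range (N + 1), ArithmeticFunction.vonMangoldt j * trap m n j =
      Chebyshev.psi n - Chebyshev.psi m := by
  have hpsi : ∀ k : ℕ, Chebyshev.psi k =
      ∑ j ∈ range (k + 1), ArithmeticFunction.vonMangoldt j := by
    intro k
    rw [Chebyshev.psi_eq_sum_Icc, Nat.floor_natCast]
    congr 1
    ext j; simp
  rw [hpsi, hpsi]
  have h1 : ∑ j ∈ range (n + 1), ArithmeticFunction.vonMangoldt j -
      ∑ j ∈ range (m + 1), ArithmeticFunction.vonMangoldt j =
      ∑ j ∈ Ico (m + 1) (n + 1), ArithmeticFunction.vonMangoldt j := by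
    rw [Finset.sum_Ico_eq_sub _ (by omega)]
  rw [h1]
  have h2 : ∑ j ∈ Ico (m + 1) (n + 1), ArithmeticFunction.vonMangoldt j =
      ∑ j ∈ Ico (m + 1) (n + 1), ArithmeticFunction.vonMangoldt j * trap m n j := by
    refine Finset.sum_congr rfl fun j hj => ?_
    rw [Finset.mem_Ico] at hj
    rw [trap_eq_one, mul_one]
    have h2 : (m : ℝ) + 1 ≤ j := by exact_mod_cast hj.1
    have h3 : (j : ℝ) ≤ n := by exact_mod_cast (by omega : j ≤ n)
    constructor <;> linarith
  rw [h2]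
  symm
  apply Finset.sum_subset
  · intro j hj
    rw [Finset.mem_Ico] at hj
    rw [Finset.mem_range]; omega
  · intro j _ hj
    rw [trap_eq_zero hmn, mul_zero]
    rw [Finset.mem_Ico, not_and_or, not_le, not_lt] at hj
    rintro ⟨h2, h3⟩
    rcases hj with h | h
    · have : (j : ℝ) ≤ m := by exact_mod_cast (by omega : j ≤ m)
      linarith
    · have : (n : ℝ) + 1 ≤ j := by exact_mod_cast h
      linarith

lemma HasMellin.congr_Ioi {f g : ℝ → ℂ} {s c : ℂ} (hf : HasMellin f s c)
    (h : ∀ y : ℝ, 0 < y → g y = f y) : HasMellin g s c := by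
  have h1 : ∀ y ∈ Set.Ioi (0 : ℝ), (y : ℂ) ^ (s - 1) • f y = (y : ℂ) ^ (s - 1) • g y :=
    fun y hy => by rw [h y hy]
  refine ⟨MeasureTheory.IntegrableOn.congr_fun hf.1 h1 measurableSet_Ioi, ?_⟩
  rw [← hf.2]
  exact (MeasureTheory.setIntegral_congr_fun measurableSet_Ioi h1).symm

lemma hasMellin_max_sub {x : ℝ} (hx : 0 < x) {s : ℂ} (hs : 0 < s.re) :
    HasMellin (fun y : ℝ => ((max (x - y) 0 : ℝ) : ℂ)) s ((x : ℂ) ^ (s + 1) / (s * (s + 1))) := by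
  have hs0 : s ≠ 0 := by rintro rfl; simp at hs
  have hs1 : s + 1 ≠ 0 := by
    intro h; have := congrArg Complex.re h; simp at this; linarith
  have hx0 : (x : ℂ) ≠ 0 := by exact_mod_cast hx.ne'
  have h1 := hasMellin_one_Ioc hs
  have h2 := hasMellin_cpow_Ioc 1 (s := s) (by simp; linarith)
  have h3 := hasMellin_sub h1.1 h2.1
  rw [h1.2, h2.2] at h3
  have h4 : HasMellin (fun y : ℝ => ((max (1 - y) 0 : ℝ) : ℂ)) s (1 / s - 1 / (s + 1)) := by
    refine h3.congr_Ioi fun y hy => ?_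
    by_cases hy1 : y ≤ 1
    · have hmem : y ∈ Set.Ioc (0 : ℝ) 1 := ⟨hy, hy1⟩
      rw [Set.indicator_of_mem hmem, Set.indicator_of_mem hmem, max_eq_left (by linarith)]
      simp
    · have hmem : y ∉ Set.Ioc (0 : ℝ) 1 := fun h => hy1 h.2
      rw [Set.indicator_of_notMem hmem, Set.indicator_of_notMem hmem, max_eq_right (by linarith)]
      simp
  have hxi : 0 < x⁻¹ := inv_pos.2 hx
  have h5 : HasMellin (fun y : ℝ => ((max (1 - x⁻¹ * y) 0 : ℝ) : ℂ)) s
      (((x⁻¹ : ℝ) : ℂ) ^ (-s) • (1 / s - 1 / (s + 1))) := by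
    refine ⟨(MellinConvergent.comp_mul_left (f := fun y : ℝ => ((max (1 - y) 0 : ℝ) : ℂ)) hxi).2 h4.1,
      ?_⟩
    rw [mellin_comp_mul_left (fun y : ℝ => ((max (1 - y) 0 : ℝ) : ℂ)) s hxi, h4.2]
  have h6 := hasMellin_const_smul h5.1 (x : ℂ)
  rw [h5.2] at h6
  have h7 : (x : ℂ) • (((x⁻¹ : ℝ) : ℂ) ^ (-s) • (1 / s - 1 / (s + 1))) =
      (x : ℂ) ^ (s + 1) / (s * (s + 1)) := by
    have : ((x⁻¹ : ℝ) : ℂ) ^ (-s) = (x : ℂ) ^ s := by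
      rw [Complex.ofReal_inv, Complex.inv_cpow, Complex.cpow_neg, inv_inv]
      rw [Complex.arg_ofReal_of_nonneg hx.le]; exact Real.pi_pos.ne
    rw [this, Complex.cpow_add _ _ hx0, Complex.cpow_one, smul_eq_mul, smul_eq_mul]
    field_simp
    ring
  rw [h7] at h6
  refine h6.congr_Ioi fun y hy => ?_
  rw [smul_eq_mul, ← Complex.ofReal_mul]
  congr 1
  rw [mul_max_of_nonneg _ _ hx.le]
  congr 1
  · field_simp
  · simp

lemma mellin_trap (m n : ℕ) {s : ℂ} (hs : 0 < s.re) :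
    mellin (fun y => (trap m n y : ℂ)) s =
      4 * (((n + 3 / 4 : ℝ) : ℂ) ^ (s + 1) - ((n + 1 / 2 : ℝ) : ℂ) ^ (s + 1)
        - ((m + 1 / 2 : ℝ) : ℂ) ^ (s + 1) + ((m + 1 / 4 : ℝ) : ℂ) ^ (s + 1)) / (s * (s + 1)) := by
  have h1 := hasMellin_max_sub (x := n + 3 / 4) (by positivity) hs
  have h2 := hasMellin_max_sub (x := n + 1 / 2) (by positivity) hs
  have h3 := hasMellin_max_sub (x := m + 1 / 2) (by positivity) hs
  have h4 := hasMellin_max_sub (x := m + 1 / 4) (by positivity) hs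
  have h12 := hasMellin_sub h1.1 h2.1
  have h123 := hasMellin_sub h12.1 h3.1
  have h1234 := hasMellin_add h123.1 h4.1
  have h := hasMellin_const_smul h1234.1 (4 : ℂ)
  rw [h1234.2, h123.2, h12.2, h1.2, h2.2, h3.2, h4.2] at h
  have h' := h.congr_Ioi (g := fun y => (trap m n y : ℂ)) fun y _ => by
    unfold trap; push_cast; rw [smul_eq_mul]
  rw [h'.2, smul_eq_mul]
  ring

lemma norm_mellin_trap_le {m n : ℕ} (hmn : m ≤ n) {s : ℂ} (hs : 0 < s.re) :
    ‖mellin (fun y => (trap m n y : ℂ)) s‖ ≤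
      16 * (n + 1 : ℝ) ^ (s.re + 1) / (‖s‖ * ‖s + 1‖) := by
  have h : (m : ℝ) ≤ n := by exact_mod_cast hmn
  rw [mellin_trap m n hs, norm_div, norm_mul, norm_mul]
  refine div_le_div_of_nonneg_right ?_ (by positivity)
  have key : ∀ x : ℝ, 0 < x → x ≤ n + 1 → ‖(x : ℂ) ^ (s + 1)‖ ≤ (n + 1 : ℝ) ^ (s.re + 1) := by
    intro x hx hxn
    rw [Complex.norm_cpow_eq_rpow_re_of_pos hx, Complex.add_re, Complex.one_re]
    exact Real.rpow_le_rpow hx.le hxn (by linarith)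
  have k1 := key (n + 3 / 4) (by positivity) (by linarith)
  have k2 := key (n + 1 / 2) (by positivity) (by linarith)
  have k3 := key (m + 1 / 2) (by positivity) (by linarith)
  have k4 := key (m + 1 / 4) (by positivity) (by linarith)
  have := norm_add_le (((n + 3 / 4 : ℝ) : ℂ) ^ (s + 1) - ((n + 1 / 2 : ℝ) : ℂ) ^ (s + 1)
        - ((m + 1 / 2 : ℝ) : ℂ) ^ (s + 1)) (((m + 1 / 4 : ℝ) : ℂ) ^ (s + 1))
  have h2 := norm_sub_le (((n + 3 / 4 : ℝ) : ℂ) ^ (s + 1) - ((n + 1 / 2 : ℝ) : ℂ) ^ (s + 1))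
    (((m + 1 / 2 : ℝ) : ℂ) ^ (s + 1))
  have h3 := norm_sub_le (((n + 3 / 4 : ℝ) : ℂ) ^ (s + 1)) (((n + 1 / 2 : ℝ) : ℂ) ^ (s + 1))
  have h4 : ‖(4 : ℂ)‖ = 4 := by simp
  rw [h4]
  linarith

lemma integral_trap {m n : ℕ} (hm : 1 ≤ m) (hmn : m ≤ n) :
    ∫ y in Set.Ioi (1 : ℝ), trap m n y = n - m + 1 / 4 := by
  have hm' : (1 : ℝ) ≤ m := by exact_mod_cast hm
  have h1 := mellin_trap m n (s := 1) (by simp)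
  have h2 : mellin (fun y => (trap m n y : ℂ)) 1 = ((∫ y in Set.Ioi (0 : ℝ), trap m n y : ℝ) : ℂ) := by
    rw [mellin]
    simp only [sub_self, Complex.cpow_zero, one_smul]
    exact integral_ofReal
  have h3 : ∫ y in Set.Ioi (1 : ℝ), trap m n y = ∫ y in Set.Ioi (0 : ℝ), trap m n y := by
    refine (MeasureTheory.setIntegral_eq_of_subset_of_forall_sdiff_eq_zero measurableSet_Ioi
      (Set.Ioi_subset_Ioi zero_le_one) fun y hy => trap_eq_zero hmn y fun h => ?_).symm
    have : y ≤ 1 := not_lt.1 hy.2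
    linarith [h.1]
  rw [h3]
  have h4 : (((∫ y in Set.Ioi (0 : ℝ), trap m n y : ℝ) : ℂ)) = ((n - m + 1 / 4 : ℝ) : ℂ) := by
    rw [← h2, h1]
    norm_num
    ring
  exact_mod_cast h4

open Complex in
/-- Representation of the Mellin transform adapted to large frequencies. -/
lemma mellin_trap_eq_integral (m n : ℕ) {s : ℂ} (hs : 0 < s.re) :
    mellin (fun y => (trap m n y : ℂ)) s =
      4 / s * ((∫ y in (n + 1 / 2 : ℝ)..(n + 3 / 4), (y : ℂ) ^ s) -
        ∫ y in (m + 1 / 4 : ℝ)..(m + 1 / 2), (y : ℂ) ^ s) := by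
  have hs0 : s ≠ 0 := by rintro rfl; simp at hs
  have hs1 : s + 1 ≠ 0 := by
    intro h; have := congrArg Complex.re h; simp at this; linarith
  rw [mellin_trap m n hs, integral_cpow (Or.inl (by linarith)),
    integral_cpow (Or.inl (by linarith))]
  field_simp
  ring

open Complex in
/-- Explicit formula for primes in `(m, n]`. -/
theorem psi_sub_psi_eq (hRH : RiemannHypothesis) {m n : ℕ} (hm : 1 ≤ m) (hmn : m ≤ n) {η : ℝ}
    (hη : 0 < η) (hη1 : η ≤ 1 / 2) :
    ∫ t : ℝ, (zetaMu η t : ℂ) *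
        mellin (fun y => (trap m n y : ℂ)) (((1 / 2 + η : ℝ) : ℂ) + t * I) =
      Real.pi * ((Chebyshev.psi n - Chebyshev.psi m - (n - m + 1 / 4) : ℝ) : ℂ) := by
  have hm' : (1 : ℝ) ≤ m := by exact_mod_cast hm
  rw [integral_zetaMu_mul_mellin hRH (k := trap m n) (a := m + 1 / 4) (b := n + 3 / 4)
    (B := 16 * (n + 1 : ℝ) ^ (3 : ℝ) * 2 / η) (by linarith) (continuous_trap m n)
    (trap_eq_zero hmn) hη hη1 ?_ (N := n + 1) (by push_cast; linarith),
    sum_vonMangoldt_mul_trap hmn (by omega), integral_trap hm hmn]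
  intro s hs
  have hs0 : 0 < s.re := lt_of_lt_of_le hη hs.1
  refine (norm_mellin_trap_le hmn hs0).trans ?_
  have h1 : (n + 1 : ℝ) ^ (s.re + 1) ≤ (n + 1 : ℝ) ^ (3 : ℝ) :=
    Real.rpow_le_rpow_of_exponent_le (by linarith [(Nat.cast_nonneg n : (0 : ℝ) ≤ n)])
      (by linarith [hs.2])
  have h2 : η * (1 + s.im ^ 2) / 2 ≤ ‖s‖ * ‖s + 1‖ := by
    have e1 : η ≤ ‖s‖ := hs.1.trans (re_le_norm s)
    have e2 : |s.im| ≤ ‖s‖ := abs_im_le_norm s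
    have e3 : 1 ≤ ‖s + 1‖ := by
      refine le_trans ?_ (re_le_norm _); simp; linarith
    have e4 : |s.im| ≤ ‖s + 1‖ := by
      simpa using abs_im_le_norm (s + 1)
    have e5 : |s.im| ^ 2 = s.im ^ 2 := sq_abs _
    have e6 : η * 1 ≤ ‖s‖ * ‖s + 1‖ := by gcongr
    have e7 : |s.im| * |s.im| ≤ ‖s‖ * ‖s + 1‖ := by gcongr
    nlinarith [sq_nonneg s.im]
  calc _ ≤ 16 * (n + 1 : ℝ) ^ (3 : ℝ) / (η * (1 + s.im ^ 2) / 2) := by gcongr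
    _ = _ := by field_simp

lemma ell_add_one_le (T : ℝ) (hT : 0 ≤ T) : ell (T + 1) ≤ 2 * ell T := by
  unfold ell
  rw [abs_of_nonneg hT, abs_of_nonneg (by linarith : 0 ≤ T + 1), ← Real.log_rpow (by linarith)]
  apply Real.log_le_log (by linarith)
  norm_num
  nlinarith

lemma ell_mono {s t : ℝ} (h : |s| ≤ |t|) : ell s ≤ ell t := by
  unfold ell
  apply Real.log_le_log (by positivity); linarith

lemma lintegral_inv_sq_add_sq {T : ℝ} (hT : 0 < T) :
    ∫⁻ t : ℝ, ENNReal.ofReal (1 / (T ^ 2 + t ^ 2)) = ENNReal.ofReal (Real.pi / T) := by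
  have h : (fun t : ℝ => 1 / (T ^ 2 + t ^ 2)) = fun t => (T ^ 2)⁻¹ * (1 + (t / T) ^ 2)⁻¹ := by
    ext t; field_simp
  have hi : MeasureTheory.Integrable fun t : ℝ => (1 + (t / T) ^ 2)⁻¹ :=
    integrable_inv_one_add_sq.comp_div hT.ne'
  rw [← MeasureTheory.ofReal_integral_eq_lintegral_ofReal]
  · rw [h, MeasureTheory.integral_const_mul,
      MeasureTheory.Measure.integral_comp_div (fun x : ℝ => (1 + x ^ 2)⁻¹),
      integral_univ_inv_one_add_sq, abs_of_pos hT, smul_eq_mul]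
    congr 1; field_simp
  · rw [h]; exact hi.const_mul _
  · exact Eventually.of_forall fun t => by positivity

/-- Weighted bound for the truncated quadratic weight. -/
lemma exists_lintegral_zetaMu_ell_le (hRH : RiemannHypothesis) :
    ∃ C : ℝ, 0 < C ∧ ∀ η T₀ T₁ : ℝ, 0 < η → η ≤ 1 → 1 ≤ T₀ → 1 ≤ T₁ →
      ∫⁻ t, ENNReal.ofReal |zetaMu η t| * (Set.Icc (-T₁) T₁).indicator
        (fun t => ENNReal.ofReal (ell t / (T₀ ^ 2 + t ^ 2))) t ≤
        ENNReal.ofReal (C * ell T₁ ^ 2 / T₀) := by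
  obtain ⟨C, hC, hwin⟩ := exists_window_integral_le hRH
  refine ⟨4 * C * Real.pi, by positivity, fun η T₀ T₁ hη hη1 hT₀ hT₁ => ?_⟩
  have hℓ := one_le_ell T₁
  calc _ ≤ ∫⁻ T, (Set.Icc (-(T₁ + 1)) (T₁ + 1)).indicator
          (fun T => ENNReal.ofReal (2 * ell T₁ / (T₀ ^ 2 + T ^ 2))) T *
        ∫⁻ t in Set.Icc (T - 1 / 2) (T + 1 / 2), ENNReal.ofReal |zetaMu η t| := by
        refine lintegral_mul_le_of_window
          (continuous_zetaMu hRH hη).abs.measurable.ennreal_ofReal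
          (Measurable.indicator (by fun_prop) measurableSet_Icc) ?_
        intro t T htT
        have h1 := abs_le.1 htT
        by_cases ht : t ∈ Set.Icc (-T₁) T₁
        · have hT : T ∈ Set.Icc (-(T₁ + 1)) (T₁ + 1) :=
            ⟨by linarith [ht.1], by linarith [ht.2]⟩
          rw [Set.indicator_of_mem ht, Set.indicator_of_mem hT]
          apply ENNReal.ofReal_le_ofReal
          have h2 : ell t ≤ ell T₁ := ell_mono (by
            rw [abs_of_pos (by linarith : 0 < T₁)]; exact abs_le.2 ht)
          rw [div_le_div_iff₀ (by positivity) (by positivity)]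
          have h3 : T₀ ^ 2 + T ^ 2 ≤ 2 * (T₀ ^ 2 + t ^ 2) := by
            nlinarith [sq_nonneg (t - (T - t))]
          have h4 := one_le_ell t
          calc ell t * (T₀ ^ 2 + T ^ 2) ≤ ell T₁ * (2 * (T₀ ^ 2 + t ^ 2)) := by gcongr
            _ = _ := by ring
        · rw [Set.indicator_of_notMem ht]; exact zero_le
    _ ≤ ∫⁻ T, ENNReal.ofReal (4 * C * ell T₁ ^ 2) * ENNReal.ofReal (1 / (T₀ ^ 2 + T ^ 2)) := by
        refine MeasureTheory.lintegral_mono fun T => ?_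
        by_cases hT : T ∈ Set.Icc (-(T₁ + 1)) (T₁ + 1)
        · simp only [Set.indicator_of_mem hT]
          calc _ ≤ ENNReal.ofReal (2 * ell T₁ / (T₀ ^ 2 + T ^ 2)) *
                ENNReal.ofReal (C * (2 * ell T₁)) := by
                gcongr
                refine (hwin η T hη hη1).trans (ENNReal.ofReal_le_ofReal ?_)
                gcongr
                refine (ell_mono ?_).trans (ell_add_one_le T₁ (by linarith))
                rw [abs_of_pos (by linarith : 0 < T₁ + 1)]; exact abs_le.2 hT
            _ = _ := by
                rw [← ENNReal.ofReal_mul (by positivity), ← ENNReal.ofReal_mul (by positivity)]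
                congr 1; ring
        · simp only [Set.indicator_of_notMem hT, zero_mul]; exact zero_le
    _ = _ := by
        rw [MeasureTheory.lintegral_const_mul _ (by fun_prop),
          lintegral_inv_sq_add_sq (by linarith), ← ENNReal.ofReal_mul (by positivity)]
        congr 1; ring

/-- Bound for the tail of the quadratic weight. -/
lemma exists_lintegral_zetaMu_tail_le (hRH : RiemannHypothesis) :
    ∃ C : ℝ, 0 < C ∧ ∀ η T₁ : ℝ, 0 < η → η ≤ 1 → 1 ≤ T₁ →
      ∫⁻ t, ENNReal.ofReal |zetaMu η t| * ENNReal.ofReal (1 / (T₁ ^ 2 + t ^ 2)) ≤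
        ENNReal.ofReal (C * T₁ ^ (-(1 / 4 : ℝ))) := by
  obtain ⟨C, hC, hwin⟩ := exists_window_integral_le hRH
  have hint : MeasureTheory.Integrable (fun u : ℝ => (1 + ‖u‖) ^ (-(5 / 4 : ℝ))) :=
    integrable_one_add_norm (by simp; norm_num)
  set J := ∫ u : ℝ, (1 + ‖u‖) ^ (-(5 / 4 : ℝ)) with hJ
  have hJ0 : 0 ≤ J := MeasureTheory.integral_nonneg fun u => by positivity
  have hℓ := one_le_ell 0
  refine ⟨24 * C * ell 0 * (J + 1), by positivity, fun η T₁ hη hη1 hT₁ => ?_⟩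
  calc _ ≤ ∫⁻ T, ENNReal.ofReal (2 / (T₁ ^ 2 + T ^ 2)) *
        ∫⁻ t in Set.Icc (T - 1 / 2) (T + 1 / 2), ENNReal.ofReal |zetaMu η t| := by
        refine lintegral_mul_le_of_window
          (continuous_zetaMu hRH hη).abs.measurable.ennreal_ofReal (by fun_prop) ?_
        intro t T htT
        apply ENNReal.ofReal_le_ofReal
        rw [div_le_div_iff₀ (by positivity) (by positivity)]
        have h1 := abs_le.1 htT
        nlinarith [sq_nonneg (t - (T - t))]
    _ ≤ ∫⁻ T, ENNReal.ofReal (24 * C * ell 0 * T₁ ^ (-(1 / 4 : ℝ)) *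
          (1 + ‖T‖) ^ (-(5 / 4 : ℝ))) := by
        refine MeasureTheory.lintegral_mono fun T => ?_
        calc _ ≤ ENNReal.ofReal (2 / (T₁ ^ 2 + T ^ 2)) * ENNReal.ofReal (C * ell T) := by
              gcongr; exact hwin η T hη hη1
          _ = ENNReal.ofReal (2 / (T₁ ^ 2 + T ^ 2) * (C * ell T)) := by
              exact (ENNReal.ofReal_mul (by positivity)).symm
          _ ≤ _ := by
              apply ENNReal.ofReal_le_ofReal
              have h1 := ell_le_mul_sqrt 0 T
              rw [sub_zero] at h1
              rw [Real.norm_eq_abs]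
              set u := |T| with hu
              have hu0 : 0 ≤ u := abs_nonneg _
              have hT : T ^ 2 = u ^ 2 := by rw [hu, sq_abs]
              have h2 : 2 / (T₁ ^ 2 + T ^ 2) ≤
                  8 * (T₁ ^ (-(1 / 4 : ℝ)) * (1 + u) ^ (-(7 / 4 : ℝ))) := by
                set m := max T₁ u
                have hm : 1 ≤ m := hT₁.trans (le_max_left _ _)
                have e1 : m ^ (-(1 / 4 : ℝ)) ≤ T₁ ^ (-(1 / 4 : ℝ)) :=
                  Real.rpow_le_rpow_of_nonpos (by linarith) (le_max_left _ _) (by norm_num)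
                have e2 : (2 * m) ^ (-(7 / 4 : ℝ)) ≤ (1 + u) ^ (-(7 / 4 : ℝ)) :=
                  Real.rpow_le_rpow_of_nonpos (by linarith)
                    (by linarith [le_max_right T₁ u]) (by norm_num)
                have e3 : (1 / 4 : ℝ) * m ^ (-(7 / 4 : ℝ)) ≤ (2 * m) ^ (-(7 / 4 : ℝ)) := by
                  rw [Real.mul_rpow (by norm_num) (by linarith)]
                  gcongr
                  calc (1 / 4 : ℝ) = 2 ^ (-2 : ℝ) := by norm_num [Real.rpow_neg]
                    _ ≤ _ := Real.rpow_le_rpow_of_exponent_le (by norm_num) (by norm_num)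
                have e4 : m ^ (-(1 / 4 : ℝ)) * m ^ (-(7 / 4 : ℝ)) = 1 / m ^ 2 := by
                  rw [← Real.rpow_add (by linarith), show (-(1 / 4) + -(7 / 4) : ℝ) = -2 by norm_num,
                    Real.rpow_neg (by linarith), Real.rpow_two, one_div]
                have e5 : m ^ 2 ≤ T₁ ^ 2 + u ^ 2 := by
                  rcases max_cases T₁ u with h | h
                  · rw [show m = T₁ from h.1]; nlinarith
                  · rw [show m = u from h.1]; nlinarith
                calc 2 / (T₁ ^ 2 + T ^ 2) ≤ 2 / m ^ 2 := by rw [hT]; gcongr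
                  _ = 8 * (m ^ (-(1 / 4 : ℝ)) * ((1 / 4 : ℝ) * m ^ (-(7 / 4 : ℝ)))) := by
                    rw [mul_left_comm (m ^ (-(1 / 4 : ℝ))), e4]; ring
                  _ ≤ _ := by gcongr; exact e3.trans e2
              calc _ ≤ 8 * (T₁ ^ (-(1 / 4 : ℝ)) * (1 + u) ^ (-(7 / 4 : ℝ))) *
                    (C * (3 * ell 0 * (1 + u) ^ (1 / 2 : ℝ))) := by
                    have := one_le_ell T
                    gcongr
                _ = 24 * C * ell 0 * T₁ ^ (-(1 / 4 : ℝ)) *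
                    ((1 + u) ^ (-(7 / 4 : ℝ)) * (1 + u) ^ (1 / 2 : ℝ)) := by ring
                _ = _ := by
                    rw [← Real.rpow_add (by positivity)]; norm_num
    _ = ENNReal.ofReal (24 * C * ell 0 * T₁ ^ (-(1 / 4 : ℝ)) * J) := by
        rw [← MeasureTheory.ofReal_integral_eq_lintegral_ofReal]
        · rw [MeasureTheory.integral_const_mul]
        · exact hint.const_mul _
        · exact Eventually.of_forall fun T => by positivity
    _ ≤ _ := by
        apply ENNReal.ofReal_le_ofReal
        have : 0 < 24 * C * ell 0 * T₁ ^ (-(1 / 4 : ℝ)) := by positivity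
        nlinarith

lemma integral_inv_one_add_abs {R : ℝ} (hR : 0 ≤ R) :
    ∫ t in (-R)..R, (1 + |t|)⁻¹ = 2 * Real.log (1 + R) := by
  have hc : Continuous fun t : ℝ => (1 + |t|)⁻¹ :=
    Continuous.inv₀ (by fun_prop) fun t => by positivity
  have h1 : ∫ t in (0 : ℝ)..R, (1 + |t|)⁻¹ = Real.log (1 + R) := by
    have e : ∫ t in (0 : ℝ)..R, (1 + |t|)⁻¹ = ∫ t in (0 : ℝ)..R, (1 + t)⁻¹ := by
      refine intervalIntegral.integral_congr fun t ht => ?_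
      rw [Set.uIcc_of_le hR] at ht
      simp only [abs_of_nonneg ht.1]
    rw [e, intervalIntegral.integral_comp_add_left (fun t : ℝ => t⁻¹),
      integral_inv_of_pos (by norm_num) (by linarith)]
    simp
  have h2 : ∫ t in (-R)..0, (1 + |t|)⁻¹ = ∫ t in (0 : ℝ)..R, (1 + |t|)⁻¹ := by
    have := intervalIntegral.integral_comp_neg (a := 0) (b := R) (fun t : ℝ => (1 + |t|)⁻¹)
    simpa using this.symm
  rw [← intervalIntegral.integral_add_adjacent_intervals (b := 0)
    (hc.intervalIntegrable _ _) (hc.intervalIntegrable _ _), h2, h1]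
  ring

lemma exists_lintegral_zetaMu_inv_le (hRH : RiemannHypothesis) :
    ∃ C : ℝ, 0 < C ∧ ∀ η T₁ : ℝ, 0 < η → η ≤ 1 → 1 ≤ T₁ →
      ∫⁻ t, ENNReal.ofReal |zetaMu η t| * (Set.Icc (-T₁) T₁).indicator
        (fun t => ENNReal.ofReal (1 + |t|)⁻¹) t ≤ ENNReal.ofReal (C * ell T₁ ^ 2) := by
  obtain ⟨C, hC, hwin⟩ := exists_window_integral_le hRH
  refine ⟨16 * C, by positivity, fun η T₁ hη hη1 hT₁ => ?_⟩
  have hℓ := one_le_ell T₁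
  have hc : Continuous fun t : ℝ => (1 + |t|)⁻¹ :=
    Continuous.inv₀ (by fun_prop) fun t => by positivity
  calc _ ≤ ∫⁻ T, (Set.Icc (-(T₁ + 1)) (T₁ + 1)).indicator
          (fun T => ENNReal.ofReal (2 * (1 + |T|)⁻¹)) T *
        ∫⁻ t in Set.Icc (T - 1 / 2) (T + 1 / 2), ENNReal.ofReal |zetaMu η t| := by
        refine lintegral_mul_le_of_window
          (continuous_zetaMu hRH hη).abs.measurable.ennreal_ofReal
          (Measurable.indicator (by fun_prop) measurableSet_Icc) ?_
        intro t T htT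
        have h1 := abs_le.1 htT
        by_cases ht : t ∈ Set.Icc (-T₁) T₁
        · have hT : T ∈ Set.Icc (-(T₁ + 1)) (T₁ + 1) :=
            ⟨by linarith [ht.1], by linarith [ht.2]⟩
          rw [Set.indicator_of_mem ht, Set.indicator_of_mem hT]
          apply ENNReal.ofReal_le_ofReal
          rw [← div_eq_mul_inv, inv_eq_one_div, div_le_div_iff₀ (by positivity) (by positivity)]
          have := abs_sub_abs_le_abs_sub T t
          rw [abs_sub_comm] at this
          linarith [abs_nonneg t]
        · rw [Set.indicator_of_notMem ht]; exact zero_le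
    _ ≤ ∫⁻ T, (Set.Icc (-(T₁ + 1)) (T₁ + 1)).indicator
          (fun T => ENNReal.ofReal (4 * C * ell T₁ * (1 + |T|)⁻¹)) T := by
        refine MeasureTheory.lintegral_mono fun T => ?_
        by_cases hT : T ∈ Set.Icc (-(T₁ + 1)) (T₁ + 1)
        · simp only [Set.indicator_of_mem hT]
          calc _ ≤ ENNReal.ofReal (2 * (1 + |T|)⁻¹) *
                ENNReal.ofReal (C * (2 * ell T₁)) := by
                gcongr
                refine (hwin η T hη hη1).trans (ENNReal.ofReal_le_ofReal ?_)
                gcongr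
                refine (ell_mono ?_).trans (ell_add_one_le T₁ (by linarith))
                rw [abs_of_pos (by linarith : 0 < T₁ + 1)]; exact abs_le.2 hT
            _ = _ := by
                rw [← ENNReal.ofReal_mul (by positivity)]
                congr 1; ring
        · simp only [Set.indicator_of_notMem hT, zero_mul]; exact zero_le
    _ = ENNReal.ofReal (4 * C * ell T₁ * (2 * Real.log (1 + (T₁ + 1)))) := by
        rw [MeasureTheory.lintegral_indicator measurableSet_Icc,
          ← MeasureTheory.ofReal_integral_eq_lintegral_ofReal]
        · rw [MeasureTheory.integral_const_mul, MeasureTheory.integral_Icc_eq_integral_Ioc,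
            ← intervalIntegral.integral_of_le (by linarith),
            integral_inv_one_add_abs (by linarith)]
        · exact (hc.const_mul _).continuousOn.integrableOn_compact isCompact_Icc
        · exact Eventually.of_forall fun T => by positivity
    _ ≤ _ := by
        apply ENNReal.ofReal_le_ofReal
        have : Real.log (1 + (T₁ + 1)) ≤ ell T₁ := by
          unfold ell
          apply Real.log_le_log (by linarith)
          linarith [le_abs_self T₁]
        nlinarith [mul_pos hC (by linarith : 0 < ell T₁)]

open Complex in
lemma integral_gaussian_mul_cexp (x : ℝ) :
    ∃ g : ℝ, 0 ≤ g ∧ g ≤ 8 * (1 / (1 + x ^ 2)) ∧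
      ∫ u : ℝ, ((Real.exp (-u ^ 2) : ℝ) : ℂ) * cexp (I * x * u) = (g : ℂ) := by
  refine ⟨Real.sqrt Real.pi * Real.exp (-x ^ 2 / 4), by positivity, ?_, ?_⟩
  · have h1 : Real.sqrt Real.pi ≤ 2 := by
      rw [Real.sqrt_le_left (by norm_num)]; linarith [Real.pi_le_four]
    have h2 : Real.exp (-x ^ 2 / 4) ≤ 4 * (1 / (1 + x ^ 2)) := by
      have := Real.add_one_le_exp (x ^ 2 / 4)
      rw [neg_div, Real.exp_neg, mul_one_div, inv_eq_one_div,
        div_le_div_iff₀ (Real.exp_pos _) (by positivity)]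
      linarith
    calc _ ≤ 2 * (4 * (1 / (1 + x ^ 2))) := by gcongr
      _ = _ := by ring
  · have h := fourierIntegral_gaussian (b := 1) (by simp) (x : ℂ)
    have e : ∀ u : ℝ, ((Real.exp (-u ^ 2) : ℝ) : ℂ) * cexp (I * x * u) =
        cexp (I * x * u) * cexp (-1 * (u : ℂ) ^ 2) := by
      intro u; rw [mul_comm]; congr 1; push_cast; congr 1; ring
    simp_rw [e]
    rw [h]
    push_cast
    rw [div_one, Real.sqrt_eq_rpow, ofReal_cpow Real.pi_pos.le]
    push_cast
    congr 2; ring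

open Complex in
lemma lintegral_gaussian_mul_sq_le {φ : ℝ → ℂ} (hφ : MeasureTheory.Integrable φ) :
    ∫⁻ u : ℝ, ENNReal.ofReal (Real.exp (-u ^ 2)) * ‖∫ t : ℝ, φ t * cexp (I * t * u)‖ₑ ^ 2 ≤
      ENNReal.ofReal 8 * ∫⁻ t : ℝ, ∫⁻ t' : ℝ, ‖φ t‖ₑ * ‖φ t'‖ₑ *
        ENNReal.ofReal (1 / (1 + (t - t') ^ 2)) := by
  set p : ℝ → ℂ := fun u => ∫ t : ℝ, φ t * cexp (I * t * u) with hp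
  set ψ : ℝ → ℂ := fun t => (starRingEnd ℂ) (φ t) with hψ
  have hψi : MeasureTheory.Integrable ψ := by
    have := conjCLE.toContinuousLinearMap.integrable_comp hφ
    exact this
  have hnψ : ∀ t, ‖ψ t‖ = ‖φ t‖ := fun t => by simp [hψ]
  set F : ℝ → ℝ × ℝ → ℂ := fun u q =>
    (((Real.exp (-u ^ 2) : ℝ) : ℂ) * cexp (I * (q.1 - q.2 : ℝ) * u)) * (φ q.1 * ψ q.2) with hF
  have hgauss : MeasureTheory.Integrable fun u : ℝ => Real.exp (-u ^ 2) := by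
    simpa using integrable_exp_neg_mul_sq (b := 1) one_pos
  have hFi : MeasureTheory.Integrable (Function.uncurry F) := by
    have h00 : MeasureTheory.Integrable (fun z : ℝ × ℝ => φ z.1 * ψ z.2)
        MeasureTheory.volume := hφ.mul_prod hψi
    have h0 : MeasureTheory.Integrable (fun z : ℝ × ℝ × ℝ =>
        ((Real.exp (-z.1 ^ 2) : ℝ) : ℂ) * (φ z.2.1 * ψ z.2.2)) MeasureTheory.volume :=
      hgauss.ofReal.mul_prod h00
    refine h0.mono ?_ (Eventually.of_forall fun q => ?_)
    · refine MeasureTheory.AEStronglyMeasurable.mul ?_ ?_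
      · have : Continuous fun q : ℝ × ℝ × ℝ =>
            (((Real.exp (-q.1 ^ 2) : ℝ) : ℂ) * cexp (I * (q.2.1 - q.2.2 : ℝ) * q.1)) := by
          fun_prop
        exact this.aestronglyMeasurable
      · exact h00.aestronglyMeasurable.comp_snd
    · simp only [Function.uncurry, hF, norm_mul, norm_real]
      have : ‖cexp (I * (q.2.1 - q.2.2 : ℝ) * q.1)‖ = 1 := by
        rw [norm_exp]; simp
      rw [this, mul_one]
  have hpp : ∀ u : ℝ, ∫ q, F u q = ((Real.exp (-u ^ 2) * ‖p u‖ ^ 2 : ℝ) : ℂ) := by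
    intro u
    have h1 : ∀ q : ℝ × ℝ, F u q = ((Real.exp (-u ^ 2) : ℝ) : ℂ) *
        ((φ q.1 * cexp (I * q.1 * u)) * (starRingEnd ℂ) (φ q.2 * cexp (I * q.2 * u))) := by
      intro q
      simp only [hF, hψ, map_mul, ← exp_conj, conj_I, conj_ofReal]
      have : cexp (I * (q.1 - q.2 : ℝ) * u) = cexp (I * q.1 * u) * cexp (-I * q.2 * u) := by
        rw [← exp_add]; congr 1; push_cast; ring
      rw [this]; ring
    simp_rw [h1]
    rw [MeasureTheory.integral_const_mul]
    have h2 := MeasureTheory.integral_prod_mul (μ := MeasureTheory.volume)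
      (ν := MeasureTheory.volume) (fun t : ℝ => φ t * cexp (I * t * u))
      (fun t : ℝ => (starRingEnd ℂ) (φ t * cexp (I * t * u)))
    rw [← MeasureTheory.Measure.volume_eq_prod] at h2
    rw [h2, integral_conj, mul_conj, normSq_eq_norm_sq]
    push_cast
    rfl
  have hgi : MeasureTheory.Integrable fun u : ℝ => Real.exp (-u ^ 2) * ‖p u‖ ^ 2 := by
    have h1 : MeasureTheory.Integrable fun u : ℝ => ∫ q, F u q := hFi.integral_prod_left
    simp_rw [hpp] at h1
    have h2 := h1.re
    simp only [RCLike.re_to_complex, ofReal_re] at h2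
    exact h2
  have hswap : ∫ u : ℝ, ∫ q, F u q = ∫ q : ℝ × ℝ, ∫ u : ℝ, F u q :=
    MeasureTheory.integral_integral_swap hFi
  have hlhs : ∫⁻ u : ℝ, ENNReal.ofReal (Real.exp (-u ^ 2)) * ‖p u‖ₑ ^ 2 =
      ‖∫ u : ℝ, ∫ q, F u q‖ₑ := by
    simp_rw [hpp]
    have h1 : ∫ u : ℝ, ((Real.exp (-u ^ 2) * ‖p u‖ ^ 2 : ℝ) : ℂ) =
        ((∫ u : ℝ, Real.exp (-u ^ 2) * ‖p u‖ ^ 2 : ℝ) : ℂ) := integral_ofReal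
    rw [h1, ← ofReal_norm, norm_real, Real.norm_of_nonneg
      (MeasureTheory.integral_nonneg fun u => by positivity),
      MeasureTheory.ofReal_integral_eq_lintegral_ofReal hgi
        (Eventually.of_forall fun u => by positivity)]
    refine MeasureTheory.lintegral_congr fun u => ?_
    rw [ENNReal.ofReal_mul (by positivity), ← ofReal_norm, ENNReal.ofReal_pow (norm_nonneg _)]
  calc _ = ‖∫ q : ℝ × ℝ, ∫ u : ℝ, F u q‖ₑ := by rw [← hswap]; exact hlhs
    _ ≤ ∫⁻ q : ℝ × ℝ, ‖∫ u : ℝ, F u q‖ₑ := MeasureTheory.enorm_integral_le_lintegral_enorm _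
    _ ≤ ∫⁻ q : ℝ × ℝ, ENNReal.ofReal 8 * (‖φ q.1‖ₑ * ‖φ q.2‖ₑ *
        ENNReal.ofReal (1 / (1 + (q.1 - q.2) ^ 2))) := by
        refine MeasureTheory.lintegral_mono fun q => ?_
        obtain ⟨g, hg0, hg, he⟩ := integral_gaussian_mul_cexp (q.1 - q.2)
        simp only [hF]
        rw [MeasureTheory.integral_mul_const, he, enorm_mul, enorm_mul, ← ofReal_norm (g : ℂ),
          norm_real, Real.norm_of_nonneg hg0, ← ofReal_norm (ψ q.2), hnψ, ofReal_norm]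
        calc _ ≤ ENNReal.ofReal (8 * (1 / (1 + (q.1 - q.2) ^ 2))) * (‖φ q.1‖ₑ * ‖φ q.2‖ₑ) := by
              gcongr
          _ = _ := by rw [ENNReal.ofReal_mul (by norm_num)]; ring
    _ = ENNReal.ofReal 8 * ∫⁻ q : ℝ × ℝ, (‖φ q.1‖ₑ * ‖φ q.2‖ₑ *
        ENNReal.ofReal (1 / (1 + (q.1 - q.2) ^ 2))) := by
        rw [MeasureTheory.lintegral_const_mul' _ _ (by simp)]
    _ = _ := by
        rw [MeasureTheory.Measure.volume_eq_prod, MeasureTheory.lintegral_prod]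
        have h1 : Measurable fun q : ℝ × ℝ => ENNReal.ofReal (1 / (1 + (q.1 - q.2) ^ 2)) := by
          fun_prop
        refine AEMeasurable.mul (AEMeasurable.mul ?_ ?_) h1.aemeasurable
        · exact hφ.aestronglyMeasurable.enorm.comp_fst
        · exact hφ.aestronglyMeasurable.enorm.comp_snd

/-- Schur-type mean square bound for `zetaMu`. -/
lemma exists_lintegral_zetaMu_mean_square_le (hRH : RiemannHypothesis) :
    ∃ C : ℝ, 0 < C ∧ ∀ (η : ℝ) (c : ℝ → ℂ), 0 < η → η ≤ 1 → Measurable c →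
      MeasureTheory.Integrable (fun t => (zetaMu η t : ℂ) * c t) →
      ∫⁻ u : ℝ, ENNReal.ofReal (Real.exp (-u ^ 2)) *
          ‖∫ t : ℝ, ((zetaMu η t : ℂ) * c t) * Complex.exp (Complex.I * t * u)‖ₑ ^ 2 ≤
        ENNReal.ofReal C * ∫⁻ t, ENNReal.ofReal |zetaMu η t| *
          (‖c t‖ₑ ^ 2 * ENNReal.ofReal (ell t)) := by
  obtain ⟨C, hC, hsch⟩ := exists_lintegral_zetaMu_cauchy_le hRH
  refine ⟨8 * C, by positivity, fun η c hη hη1 hc hi => ?_⟩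
  refine (lintegral_gaussian_mul_sq_le hi).trans ?_
  rw [ENNReal.ofReal_mul (by norm_num), mul_assoc]
  gcongr
  set μ : ℝ → ENNReal := fun t => ENNReal.ofReal |zetaMu η t| with hμ
  have hμm : Measurable μ := (continuous_zetaMu hRH hη).abs.measurable.ennreal_ofReal
  have hem : ∀ t, ‖(zetaMu η t : ℂ) * c t‖ₑ = μ t * ‖c t‖ₑ := by
    intro t
    rw [enorm_mul, ← ofReal_norm, Complex.norm_real, Real.norm_eq_abs]
  set A : ENNReal := ∫⁻ t, ∫⁻ t', μ t * ‖c t‖ₑ ^ 2 * (μ t' * ENNReal.ofReal (1 / (1 + (t - t') ^ 2)))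
    with hA
  have hcm : Measurable fun t => ‖c t‖ₑ := hc.enorm
  have hamgm : ∀ x y : ENNReal, 2 * (x * y) ≤ x ^ 2 + y ^ 2 := by
    intro x y
    rcases eq_or_ne x ⊤ with rfl | hx
    · simp
    rcases eq_or_ne y ⊤ with rfl | hy
    · simp
    lift x to NNReal using hx
    lift y to NNReal using hy
    norm_cast
    have := two_mul_le_add_sq x y
    rwa [mul_assoc] at this
  have h2 : 2 * ∫⁻ t : ℝ, ∫⁻ t' : ℝ, ‖(zetaMu η t : ℂ) * c t‖ₑ * ‖(zetaMu η t' : ℂ) * c t'‖ₑ *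
        ENNReal.ofReal (1 / (1 + (t - t') ^ 2)) ≤ 2 * A := by
    rw [← MeasureTheory.lintegral_const_mul' _ _ (by simp)]
    calc _ = ∫⁻ t : ℝ, ∫⁻ t' : ℝ, 2 * (‖(zetaMu η t : ℂ) * c t‖ₑ * ‖(zetaMu η t' : ℂ) * c t'‖ₑ *
        ENNReal.ofReal (1 / (1 + (t - t') ^ 2))) := by
          refine MeasureTheory.lintegral_congr fun t => ?_
          rw [← MeasureTheory.lintegral_const_mul' _ _ (by simp)]
      _ ≤ ∫⁻ t : ℝ, ∫⁻ t' : ℝ,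
          (μ t * ‖c t‖ₑ ^ 2 * (μ t' * ENNReal.ofReal (1 / (1 + (t - t') ^ 2))) +
          μ t' * ‖c t'‖ₑ ^ 2 * (μ t * ENNReal.ofReal (1 / (1 + (t' - t) ^ 2)))) := by
          refine MeasureTheory.lintegral_mono fun t => MeasureTheory.lintegral_mono fun t' => ?_
          have e1 : (t' - t) ^ 2 = (t - t') ^ 2 := by ring
          rw [hem, hem, e1]
          calc _ = (μ t * μ t' * ENNReal.ofReal (1 / (1 + (t - t') ^ 2))) *
                (2 * (‖c t‖ₑ * ‖c t'‖ₑ)) := by ring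
            _ ≤ (μ t * μ t' * ENNReal.ofReal (1 / (1 + (t - t') ^ 2))) *
                (‖c t‖ₑ ^ 2 + ‖c t'‖ₑ ^ 2) := by gcongr; exact hamgm _ _
            _ = _ := by ring
      _ = A + A := by
          have m1 : Measurable fun q : ℝ × ℝ => μ q.1 * ‖c q.1‖ₑ ^ 2 *
              (μ q.2 * ENNReal.ofReal (1 / (1 + (q.1 - q.2) ^ 2))) := by
            have e1 : Measurable fun q : ℝ × ℝ => μ q.1 := hμm.comp measurable_fst
            have e2 : Measurable fun q : ℝ × ℝ => μ q.2 := hμm.comp measurable_snd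
            have e3 : Measurable fun q : ℝ × ℝ => ‖c q.1‖ₑ := hcm.comp measurable_fst
            have e4 : Measurable fun q : ℝ × ℝ =>
              ENNReal.ofReal (1 / (1 + (q.1 - q.2) ^ 2)) := by fun_prop
            exact (e1.mul (e3.pow_const 2)).mul (e2.mul e4)
          have e5 : ∀ t : ℝ, ∫⁻ t' : ℝ,
              (μ t * ‖c t‖ₑ ^ 2 * (μ t' * ENNReal.ofReal (1 / (1 + (t - t') ^ 2))) +
              μ t' * ‖c t'‖ₑ ^ 2 * (μ t * ENNReal.ofReal (1 / (1 + (t' - t) ^ 2)))) =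
              (∫⁻ t', μ t * ‖c t‖ₑ ^ 2 * (μ t' * ENNReal.ofReal (1 / (1 + (t - t') ^ 2)))) +
              ∫⁻ t', μ t' * ‖c t'‖ₑ ^ 2 * (μ t * ENNReal.ofReal (1 / (1 + (t' - t) ^ 2))) := by
            intro t
            exact MeasureTheory.lintegral_add_left (m1.comp (measurable_const.prodMk measurable_id)) _
          simp_rw [e5]
          have e6 : ∫⁻ t, ∫⁻ t', μ t' * ‖c t'‖ₑ ^ 2 *
              (μ t * ENNReal.ofReal (1 / (1 + (t' - t) ^ 2))) = A :=
            MeasureTheory.lintegral_lintegral_swap (m1.comp measurable_swap).aemeasurable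
          rw [MeasureTheory.lintegral_add_left m1.lintegral_prod_right', e6]
      _ = 2 * A := (two_mul A).symm
  have h3 := (ENNReal.mul_le_mul_iff_right (by norm_num) (by norm_num)).1 h2
  refine h3.trans ?_
  rw [← MeasureTheory.lintegral_const_mul' _ _ (by simp)]
  refine MeasureTheory.lintegral_mono fun t => ?_
  rw [MeasureTheory.lintegral_const_mul _ (by fun_prop)]
  calc _ ≤ μ t * ‖c t‖ₑ ^ 2 * ENNReal.ofReal (C * ell t) := by
        gcongr; exact hsch η t hη hη1
    _ = _ := by rw [ENNReal.ofReal_mul hC.le]; ring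

/-- The Fourier-type transform `∫ μ(t) c(t) e^{itu} dt` of a cut-off `c` against `zetaMu`. -/
noncomputable def zetaP (η : ℝ) (c : ℝ → ℂ) (u : ℝ) : ℂ :=
  ∫ t : ℝ, ((zetaMu η t : ℂ) * c t) * Complex.exp (Complex.I * t * u)

lemma measurable_zetaP (hRH : RiemannHypothesis) {η : ℝ} (hη : 0 < η) {c : ℝ → ℂ}
    (hc : Measurable c) : Measurable (zetaP η c) := by
  have h1 : Measurable fun q : ℝ × ℝ =>
      ((zetaMu η q.2 : ℂ) * c q.2) * Complex.exp (Complex.I * q.2 * q.1) := by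
    have e1 : Measurable fun q : ℝ × ℝ => (zetaMu η q.2 : ℂ) :=
      Complex.measurable_ofReal.comp ((continuous_zetaMu hRH hη).measurable.comp measurable_snd)
    have e2 : Measurable fun q : ℝ × ℝ => c q.2 := hc.comp measurable_snd
    have e3 : Measurable fun q : ℝ × ℝ => Complex.exp (Complex.I * q.2 * q.1) := by fun_prop
    exact (e1.mul e2).mul e3
  exact (h1.stronglyMeasurable.integral_prod_right').measurable

lemma exists_lintegral_zetaP_sq_le (hRH : RiemannHypothesis) :
    ∃ C : ℝ, 0 < C ∧ ∀ (η : ℝ) (c : ℝ → ℂ) (M : ℝ), 0 < η → η ≤ 1 → 0 < M → Measurable c →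
      MeasureTheory.Integrable (fun t => (zetaMu η t : ℂ) * c t) →
      ∫⁻ y in Set.Icc M (5 * M), ‖zetaP η c (Real.log y)‖ₑ ^ 2 ≤
        ENNReal.ofReal (C * M) * ∫⁻ t, ENNReal.ofReal |zetaMu η t| *
          (‖c t‖ₑ ^ 2 * ENNReal.ofReal (ell t)) := by
  obtain ⟨C, hC, h⟩ := exists_lintegral_zetaMu_mean_square_le hRH
  refine ⟨15 * C, by positivity, fun η c M hη hη1 hM hc hi => ?_⟩
  set u₀ : ℝ := Real.log M + 1 with hu₀
  have himg : Set.Icc M (5 * M) = Real.exp '' Set.Icc (Real.log M) (Real.log (5 * M)) := by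
    ext y
    simp only [Set.mem_Icc, Set.mem_image]
    constructor
    · rintro ⟨h1, h2⟩
      have hy : 0 < y := hM.trans_le h1
      exact ⟨Real.log y, ⟨Real.log_le_log hM h1, Real.log_le_log hy h2⟩, Real.exp_log hy⟩
    · rintro ⟨u, ⟨h1, h2⟩, rfl⟩
      exact ⟨(Real.log_le_iff_le_exp hM).1 h1, (Real.le_log_iff_exp_le (by positivity)).1 h2⟩
  rw [himg, MeasureTheory.lintegral_image_eq_lintegral_abs_deriv_mul measurableSet_Icc
    (fun x _ => (Real.hasDerivAt_exp x).hasDerivWithinAt) Real.exp_injective.injOn]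
  simp only [Real.log_exp]
  have hlog5 : Real.log 5 ≤ 2 := by
    rw [Real.log_le_iff_le_exp (by norm_num)]
    have := Real.add_one_le_exp (1 : ℝ)
    have h2 : Real.exp 2 = Real.exp 1 * Real.exp 1 := by rw [← Real.exp_add]; norm_num
    have := Real.exp_one_gt_d9
    nlinarith
  have hpt : ∀ u ∈ Set.Icc (Real.log M) (Real.log (5 * M)),
      |Real.exp u| ≤ 15 * M * Real.exp (-(u - u₀) ^ 2) := by
    intro u hu
    rw [Real.log_mul (by norm_num) hM.ne'] at hu
    have h1 : Real.exp u ≤ 5 * M := by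
      rw [← Real.le_log_iff_exp_le (by positivity), Real.log_mul (by norm_num) hM.ne']
      exact hu.2
    have h2 : (u - u₀) ^ 2 ≤ 1 := by
      rw [sq_le_one_iff_abs_le_one, abs_le]
      constructor <;> linarith [hu.1, hu.2]
    have h3 : Real.exp (-1) ≤ Real.exp (-(u - u₀) ^ 2) := Real.exp_le_exp.2 (by linarith)
    have h4 : (1 : ℝ) ≤ 3 * Real.exp (-1) := by
      rw [Real.exp_neg, ← div_eq_mul_inv, le_div_iff₀ (Real.exp_pos _)]
      linarith [Real.exp_one_lt_d9]
    rw [abs_of_pos (Real.exp_pos _)]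
    nlinarith
  have htrans : ∀ v : ℝ, zetaP η c (v + u₀) = ∫ t : ℝ, ((zetaMu η t : ℂ) *
      (c t * Complex.exp (Complex.I * t * u₀))) * Complex.exp (Complex.I * t * v) := by
    intro v
    unfold zetaP
    refine MeasureTheory.integral_congr_ae (Eventually.of_forall fun t => ?_)
    have : Complex.exp (Complex.I * t * (v + u₀ : ℝ)) =
        Complex.exp (Complex.I * t * v) * Complex.exp (Complex.I * t * u₀) := by
      rw [← Complex.exp_add]; congr 1; push_cast; ring
    simp only [this]; ring
  have hexp : ∀ t : ℝ, ‖Complex.exp (Complex.I * t * u₀)‖ = 1 := by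
    intro t
    rw [Complex.norm_exp]; simp
  have hcm : Measurable fun t : ℝ => c t * Complex.exp (Complex.I * t * u₀) :=
    hc.mul (by fun_prop)
  have hci : MeasureTheory.Integrable fun t : ℝ => (zetaMu η t : ℂ) *
      (c t * Complex.exp (Complex.I * t * u₀)) := by
    refine hi.mono (((Complex.measurable_ofReal.comp
      (continuous_zetaMu hRH hη).measurable).mul hcm).aestronglyMeasurable)
      (Eventually.of_forall fun t => ?_)
    rw [norm_mul, norm_mul, norm_mul, hexp, mul_one]
  have hmain := h η _ hη hη1 hcm hci
  calc _ ≤ ∫⁻ u in Set.Icc (Real.log M) (Real.log (5 * M)),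
        ENNReal.ofReal (15 * M) * (ENNReal.ofReal (Real.exp (-(u - u₀) ^ 2)) *
          ‖zetaP η c u‖ₑ ^ 2) := by
        refine MeasureTheory.setLIntegral_mono' measurableSet_Icc fun u hu => ?_
        rw [← mul_assoc, ← ENNReal.ofReal_mul (by positivity)]
        gcongr
        exact hpt u hu
    _ ≤ ∫⁻ u, ENNReal.ofReal (15 * M) * (ENNReal.ofReal (Real.exp (-(u - u₀) ^ 2)) *
          ‖zetaP η c u‖ₑ ^ 2) := MeasureTheory.setLIntegral_le_lintegral _ _
    _ = ENNReal.ofReal (15 * M) * ∫⁻ u, (ENNReal.ofReal (Real.exp (-(u - u₀) ^ 2)) *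
          ‖zetaP η c u‖ₑ ^ 2) := by
        rw [MeasureTheory.lintegral_const_mul' _ _ ENNReal.ofReal_ne_top]
    _ = ENNReal.ofReal (15 * M) * ∫⁻ v, (ENNReal.ofReal (Real.exp (-v ^ 2)) *
          ‖zetaP η c (v + u₀)‖ₑ ^ 2) := by
        congr 1
        rw [← MeasureTheory.lintegral_add_right_eq_self _ u₀]
        simp
    _ ≤ ENNReal.ofReal (15 * M) * (ENNReal.ofReal C * ∫⁻ t, ENNReal.ofReal |zetaMu η t| *
          (‖c t‖ₑ ^ 2 * ENNReal.ofReal (ell t))) := by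
        gcongr
        simp_rw [htrans]
        refine hmain.trans (le_of_eq ?_)
        simp_rw [enorm_mul, ← ofReal_norm (Complex.exp _), hexp]
        simp
    _ = _ := by
        rw [← mul_assoc, ← ENNReal.ofReal_mul (by positivity)]
        congr 2; ring

lemma sq_setLIntegral_le {f : ℝ → ENNReal} (hf : Measurable f) (s : Set ℝ) :
    (∫⁻ y in s, f y) ^ 2 ≤ MeasureTheory.volume s * ∫⁻ y in s, f y ^ 2 := by
  have h := ENNReal.lintegral_mul_le_Lp_mul_Lq (MeasureTheory.volume.restrict s)
    Real.HolderConjugate.two_two (f := f) (g := fun _ => 1) hf.aemeasurable aemeasurable_const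
  simp only [Pi.mul_apply, mul_one, ENNReal.rpow_two, one_pow, MeasureTheory.lintegral_one,
    MeasureTheory.Measure.restrict_apply_univ] at h
  calc _ ≤ ((∫⁻ y in s, f y ^ 2) ^ (1 / (2 : ℝ)) *
        (MeasureTheory.volume s) ^ (1 / (2 : ℝ))) ^ 2 := by gcongr
    _ = _ := by
        rw [mul_pow, ← ENNReal.rpow_natCast, ← ENNReal.rpow_natCast, ← ENNReal.rpow_mul,
          ← ENNReal.rpow_mul]
        norm_num
        rw [mul_comm]

open Complex in
lemma enorm_integral_zetaMu_mul_le {η : ℝ} {c : ℝ → ℂ}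
    (hi : MeasureTheory.Integrable (fun t => (zetaMu η t : ℂ) * c t))
    {k : ℝ → ℂ} (hk : Continuous k) (hk1 : ∀ y, ‖k y‖ ≤ 1) {a b : ℝ} (ha : 0 < a) (hab : a ≤ b)
    (e : ℝ) :
    MeasureTheory.Integrable (fun t : ℝ =>
      (zetaMu η t : ℂ) * c t * ∫ y in a..b, k y * (y : ℂ) ^ ((e : ℂ) + t * I)) ∧
    ‖∫ t : ℝ, (zetaMu η t : ℂ) * c t * ∫ y in a..b, k y * (y : ℂ) ^ ((e : ℂ) + t * I)‖ₑ ≤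
      ∫⁻ y in Set.Ioc a b, ENNReal.ofReal (y ^ e) * ‖zetaP η c (Real.log y)‖ₑ := by
  have hpow : ∀ y ∈ Set.Ioc a b, ∀ t : ℝ, (y : ℂ) ^ ((e : ℂ) + t * I) =
      ((y ^ e : ℝ) : ℂ) * cexp (I * t * (Real.log y : ℝ)) := by
    intro y hy t
    have hy0 : 0 < y := ha.trans hy.1
    rw [cpow_add _ _ (by exact_mod_cast hy0.ne'), ofReal_cpow hy0.le]
    congr 1
    rw [cpow_def_of_ne_zero (by exact_mod_cast hy0.ne'), ← ofReal_log hy0.le]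
    congr 1; ring
  set F : ℝ → ℝ → ℂ := fun t y => ((zetaMu η t : ℂ) * c t) *
    ((k y * ((y ^ e : ℝ) : ℂ)) * cexp (I * t * (Real.log y : ℝ))) with hF
  have hcont : ContinuousOn (fun y : ℝ => k y * ((y ^ e : ℝ) : ℂ)) (Set.Icc a b) := by
    refine hk.continuousOn.mul (continuous_ofReal.comp_continuousOn ?_)
    exact continuousOn_id.rpow_const fun y hy => Or.inl (ha.trans_le hy.1).ne'
  have hki : MeasureTheory.IntegrableOn (fun y : ℝ => k y * ((y ^ e : ℝ) : ℂ)) (Set.Ioc a b) :=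
    (hcont.integrableOn_Icc).mono_set Set.Ioc_subset_Icc_self
  have hFi : MeasureTheory.Integrable (Function.uncurry F)
      (MeasureTheory.volume.prod (MeasureTheory.volume.restrict (Set.Ioc a b))) := by
    have h0 : MeasureTheory.Integrable (fun z : ℝ × ℝ => ((zetaMu η z.1 : ℂ) * c z.1) *
        (k z.2 * ((z.2 ^ e : ℝ) : ℂ)))
        (MeasureTheory.volume.prod (MeasureTheory.volume.restrict (Set.Ioc a b))) :=
      hi.mul_prod hki
    have h1 : Measurable fun z : ℝ × ℝ => cexp (I * z.1 * (Real.log z.2 : ℝ)) := by fun_prop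
    refine (h0.mono (h0.aestronglyMeasurable.mul h1.aestronglyMeasurable)
      (Eventually.of_forall fun z => ?_)).congr (Eventually.of_forall fun z => ?_)
    · have : ‖cexp (I * z.1 * (Real.log z.2 : ℝ))‖ = 1 := by rw [norm_exp]; simp
      rw [Pi.mul_apply, norm_mul _ (cexp _), this, mul_one]
    · simp only [Function.uncurry, hF, Pi.mul_apply]; ring
  have h1 : (fun t : ℝ => (zetaMu η t : ℂ) * c t *
      ∫ y in a..b, k y * (y : ℂ) ^ ((e : ℂ) + t * I)) =
      fun t : ℝ => ∫ y in Set.Ioc a b, F t y := by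
    funext t
    rw [intervalIntegral.integral_of_le hab, ← MeasureTheory.integral_const_mul]
    refine MeasureTheory.setIntegral_congr_fun measurableSet_Ioc fun y hy => ?_
    simp only [hF]
    rw [hpow y hy t]; ring
  rw [h1]
  refine ⟨hFi.integral_prod_left, ?_⟩
  rw [MeasureTheory.integral_integral_swap hFi]
  refine (MeasureTheory.enorm_integral_le_lintegral_enorm _).trans ?_
  refine MeasureTheory.setLIntegral_mono' measurableSet_Ioc fun y hy => ?_
  have h2 : ∫ t, F t y = (k y * ((y ^ e : ℝ) : ℂ)) * zetaP η c (Real.log y) := by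
    unfold zetaP
    rw [← MeasureTheory.integral_const_mul]
    refine MeasureTheory.integral_congr_ae (Eventually.of_forall fun t => ?_)
    simp only [hF]; ring
  rw [h2, enorm_mul]
  gcongr
  have hy0 : 0 < y := ha.trans hy.1
  rw [← ofReal_norm, norm_mul, norm_real, Real.norm_of_nonneg (by positivity)]
  refine ENNReal.ofReal_le_ofReal ?_
  have : 0 ≤ y ^ e := by positivity
  nlinarith [hk1 y]

/-- Sums of integrals over overlapping short intervals. -/
lemma sum_setLIntegral_shift_le (f : ℝ → ENNReal) (M H : ℕ) (hHM : H ≤ M) (j : ℕ)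
    (hj : j ≤ H) :
    ∑ m ∈ Ioc M (2 * M), ∫⁻ y in Set.Ioc ((m + j : ℕ) : ℝ) ((m + j : ℕ) + 1 : ℝ), f y ≤
      ∫⁻ y in Set.Icc (M : ℝ) (5 * M), f y := by
  rw [← MeasureTheory.lintegral_biUnion_finset _ (fun _ _ => measurableSet_Ioc)]
  · refine MeasureTheory.lintegral_mono_set ?_
    intro y hy
    simp only [Set.mem_iUnion, Finset.mem_Ioc, Set.mem_Ioc, exists_prop] at hy
    obtain ⟨m, ⟨h1, h2⟩, h3, h4⟩ := hy
    have h5 : (M : ℝ) ≤ (m + j : ℕ) := by exact_mod_cast (by omega)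
    have h6 : ((m + j : ℕ) + 1 : ℝ) ≤ 5 * M := by exact_mod_cast (by omega)
    exact ⟨by linarith, by linarith⟩
  · intro m _ m' _ hmm
    refine Set.disjoint_left.2 fun y hy hy' => hmm ?_
    simp only [Set.mem_Ioc] at hy hy'
    have h1 : ((m + j : ℕ) : ℝ) < (m' + j : ℕ) + 1 := by linarith [hy.1, hy'.2]
    have h2 : ((m' + j : ℕ) : ℝ) < (m + j : ℕ) + 1 := by linarith [hy.2, hy'.1]
    have h3 : m + j < m' + j + 1 := by exact_mod_cast h1
    have h4 : m' + j < m + j + 1 := by exact_mod_cast h2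
    omega

lemma sum_setLIntegral_Ioc_le (f : ℝ → ENNReal) (M H : ℕ) (hHM : H ≤ M) :
    ∑ m ∈ Ioc M (2 * M), ∫⁻ y in Set.Ioc (m : ℝ) (m + H + 1 : ℝ), f y ≤
      (H + 1 : ENNReal) * ∫⁻ y in Set.Icc (M : ℝ) (5 * M), f y := by
  have h1 : ∀ m : ℕ, ∫⁻ y in Set.Ioc (m : ℝ) (m + H + 1 : ℝ), f y ≤
      ∑ j ∈ range (H + 1), ∫⁻ y in Set.Ioc ((m + j : ℕ) : ℝ) ((m + j : ℕ) + 1 : ℝ), f y := by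
    intro m
    induction H with
    | zero => simp
    | succ K ih =>
      rw [sum_range_succ]
      have : Set.Ioc (m : ℝ) (m + (K + 1 : ℕ) + 1 : ℝ) = Set.Ioc (m : ℝ) (m + K + 1 : ℝ) ∪
          Set.Ioc ((m + (K + 1) : ℕ) : ℝ) ((m + (K + 1) : ℕ) + 1 : ℝ) := by
        rw [← Set.Ioc_union_Ioc_eq_Ioc (b := (m + K + 1 : ℝ))] <;> push_cast
        · ring_nf
        · linarith
        · have : (0 : ℝ) ≤ K := by positivity
          linarith
      rw [this]
      exact (MeasureTheory.lintegral_union_le _ _ _).trans (by gcongr; exact ih (by omega))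
  calc _ ≤ ∑ m ∈ Ioc M (2 * M), ∑ j ∈ range (H + 1),
        ∫⁻ y in Set.Ioc ((m + j : ℕ) : ℝ) ((m + j : ℕ) + 1 : ℝ), f y :=
        sum_le_sum fun m _ => h1 m
    _ = ∑ j ∈ range (H + 1), ∑ m ∈ Ioc M (2 * M),
        ∫⁻ y in Set.Ioc ((m + j : ℕ) : ℝ) ((m + j : ℕ) + 1 : ℝ), f y := sum_comm
    _ ≤ ∑ j ∈ range (H + 1), ∫⁻ y in Set.Icc (M : ℝ) (5 * M), f y :=
        sum_le_sum fun j hj => sum_setLIntegral_shift_le f M H hHM j (by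
          rw [mem_range] at hj; omega)
    _ = _ := by simp

open Complex in
lemma mellin_trap_eq_intervalIntegral {m n : ℕ} (hmn : m ≤ n) (η t : ℝ) :
    mellin (fun y => (trap m n y : ℂ)) (((1 / 2 + η : ℝ) : ℂ) + t * I) =
      ∫ y in (m + 1 / 4 : ℝ)..(n + 3 / 4),
        (trap m n y : ℂ) * (y : ℂ) ^ (((η - 1 / 2 : ℝ) : ℂ) + t * I) := by
  have h : (m : ℝ) ≤ n := by exact_mod_cast hmn
  have hm0 : (0 : ℝ) ≤ m := by positivity
  unfold mellin
  rw [intervalIntegral.integral_of_le (by linarith), ← MeasureTheory.integral_Icc_eq_integral_Ioc]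
  have e : (((1 / 2 + η : ℝ) : ℂ) + t * I) - 1 = ((η - 1 / 2 : ℝ) : ℂ) + t * I := by
    push_cast; ring
  rw [e]
  rw [MeasureTheory.setIntegral_eq_of_subset_of_forall_sdiff_eq_zero
    (s := Set.Icc (m + 1 / 4 : ℝ) (n + 3 / 4)) (t := Set.Ioi 0) measurableSet_Ioi]
  · refine MeasureTheory.setIntegral_congr_fun measurableSet_Icc fun y _ => ?_
    simp only [smul_eq_mul]; ring
  · intro y hy
    exact Set.mem_Ioi.2 (by linarith [hy.1])
  · intro y hy
    simp only [trap_eq_zero hmn y hy.2, ofReal_zero, smul_zero]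

/-- The low-frequency cut-off. -/
noncomputable def cutLow (T₀ : ℝ) (t : ℝ) : ℂ := (Set.Icc (-T₀) T₀).indicator (fun _ => 1) t

/-- The high-frequency cut-off, weighted by `1 / s`. -/
noncomputable def cutHigh (η T₀ T₁ : ℝ) (t : ℝ) : ℂ :=
  (Set.Icc (-T₁) T₁ \ Set.Icc (-T₀) T₀).indicator
    (fun t => 1 / (((1 / 2 + η : ℝ) : ℂ) + t * Complex.I)) t

lemma measurable_cutLow (T₀ : ℝ) : Measurable (cutLow T₀) :=
  measurable_const.indicator measurableSet_Icc

lemma measurable_cutHigh (η T₀ T₁ : ℝ) : Measurable (cutHigh η T₀ T₁) := by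
  refine Measurable.indicator ?_ (measurableSet_Icc.diff measurableSet_Icc)
  fun_prop

lemma norm_half_add_ge {η : ℝ} (hη : 0 < η) (t : ℝ) :
    1 / 2 ≤ ‖((1 / 2 + η : ℝ) : ℂ) + t * Complex.I‖ ∧
    |t| ≤ ‖((1 / 2 + η : ℝ) : ℂ) + t * Complex.I‖ := by
  constructor
  · refine le_trans ?_ (Complex.abs_re_le_norm _)
    simp only [Complex.add_re, Complex.ofReal_re, Complex.mul_re, Complex.I_re, Complex.I_im,
      Complex.ofReal_im]
    rw [abs_of_pos] <;> linarith
  · refine le_trans (le_of_eq ?_) (Complex.abs_im_le_norm _)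
    simp

lemma norm_cutHigh_le {η : ℝ} (hη : 0 < η) (T₀ T₁ t : ℝ) : ‖cutHigh η T₀ T₁ t‖ ≤ 2 := by
  unfold cutHigh
  have h := (norm_half_add_ge hη t).1
  by_cases ht : t ∈ Set.Icc (-T₁) T₁ \ Set.Icc (-T₀) T₀
  · rw [Set.indicator_of_mem ht, norm_div, norm_one, div_le_iff₀] <;> linarith
  · rw [Set.indicator_of_notMem ht]; simp

lemma integrable_zetaMu_mul (hRH : RiemannHypothesis) {η : ℝ} (hη : 0 < η) {c : ℝ → ℂ}
    (hc : Measurable c) {B T : ℝ} (hB : ∀ t, ‖c t‖ ≤ B) (hT : ∀ t ∉ Set.Icc (-T) T, c t = 0) :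
    MeasureTheory.Integrable (fun t => (zetaMu η t : ℂ) * c t) := by
  have h1 : MeasureTheory.IntegrableOn (fun t => (zetaMu η t : ℂ)) (Set.Icc (-T) T) :=
    (Complex.continuous_ofReal.comp (continuous_zetaMu hRH hη)).integrableOn_Icc
  have h2 : MeasureTheory.IntegrableOn (fun t => (zetaMu η t : ℂ) * c t) (Set.Icc (-T) T) :=
    h1.mul_bdd hc.aestronglyMeasurable (Eventually.of_forall hB)
  refine (MeasureTheory.integrableOn_iff_integrable_of_support_subset ?_).1 h2
  intro t ht
  by_contra h
  exact ht (by simp [hT t h])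

lemma integrable_zetaMu_mul_cutLow (hRH : RiemannHypothesis) {η : ℝ} (hη : 0 < η) (T₀ : ℝ) :
    MeasureTheory.Integrable (fun t => (zetaMu η t : ℂ) * cutLow T₀ t) := by
  refine integrable_zetaMu_mul hRH hη (measurable_cutLow T₀) (B := 1) (T := T₀) (fun t => ?_)
    fun t ht => Set.indicator_of_notMem ht _
  unfold cutLow
  by_cases ht : t ∈ Set.Icc (-T₀) T₀
  · rw [Set.indicator_of_mem ht]; simp
  · rw [Set.indicator_of_notMem ht]; simp

lemma integrable_zetaMu_mul_cutHigh (hRH : RiemannHypothesis) {η : ℝ} (hη : 0 < η) (T₀ T₁ : ℝ) :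
    MeasureTheory.Integrable (fun t => (zetaMu η t : ℂ) * cutHigh η T₀ T₁ t) :=
  integrable_zetaMu_mul hRH hη (measurable_cutHigh η T₀ T₁) (norm_cutHigh_le hη T₀ T₁) (T := T₁)
    fun _ ht => Set.indicator_of_notMem (fun h => ht h.1) _

open Complex in
lemma enorm_integral_zetaMu_mul_mellin_trap_le (hRH : RiemannHypothesis) {η : ℝ} (hη : 0 < η)
    {m n : ℕ} (hmn : m ≤ n) {T₀ T₁ : ℝ} (hT : T₀ ≤ T₁) :
    ‖∫ t : ℝ, (zetaMu η t : ℂ) *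
        mellin (fun y => (trap m n y : ℂ)) (((1 / 2 + η : ℝ) : ℂ) + t * I)‖ₑ ≤
      ((∫⁻ y in Set.Ioc (m : ℝ) (n + 1), ENNReal.ofReal (y ^ (η - 1 / 2)) *
          ‖zetaP η (cutLow T₀) (Real.log y)‖ₑ) +
        4 * ((∫⁻ y in Set.Ioc (n : ℝ) (n + 1), ENNReal.ofReal (y ^ (1 / 2 + η)) *
          ‖zetaP η (cutHigh η T₀ T₁) (Real.log y)‖ₑ) +
        ∫⁻ y in Set.Ioc (m : ℝ) (m + 1), ENNReal.ofReal (y ^ (1 / 2 + η)) *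
          ‖zetaP η (cutHigh η T₀ T₁) (Real.log y)‖ₑ)) +
      ∫⁻ t in (Set.Icc (-T₁) T₁)ᶜ, ENNReal.ofReal |zetaMu η t| *
        ‖mellin (fun y => (trap m n y : ℂ)) (((1 / 2 + η : ℝ) : ℂ) + t * I)‖ₑ := by
  set K : ℝ → ℂ := fun t => mellin (fun y => (trap m n y : ℂ)) (((1 / 2 + η : ℝ) : ℂ) + t * I)
    with hK
  have h : (m : ℝ) ≤ n := by exact_mod_cast hmn
  have hm0 : (0 : ℝ) ≤ m := by positivity
  by_cases hi : MeasureTheory.Integrable fun t => (zetaMu η t : ℂ) * K t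
  swap
  · rw [MeasureTheory.integral_undef hi]; simp
  have hsplit : ∫ t, (zetaMu η t : ℂ) * K t =
      (∫ t in Set.Icc (-T₀) T₀, (zetaMu η t : ℂ) * K t) +
      (∫ t in Set.Icc (-T₁) T₁ \ Set.Icc (-T₀) T₀, (zetaMu η t : ℂ) * K t) +
      ∫ t in (Set.Icc (-T₁) T₁)ᶜ, (zetaMu η t : ℂ) * K t := by
    rw [← MeasureTheory.integral_add_compl (measurableSet_Icc (a := -T₁) (b := T₁)) hi,
      MeasureTheory.setIntegral_sdiff (s := Set.Icc (-T₁) T₁) (t := Set.Icc (-T₀) T₀)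
        measurableSet_Icc hi.integrableOn (Set.Icc_subset_Icc (by linarith) hT)]
    ring
  have hlow : ‖∫ t in Set.Icc (-T₀) T₀, (zetaMu η t : ℂ) * K t‖ₑ ≤
      ∫⁻ y in Set.Ioc (m : ℝ) (n + 1), ENNReal.ofReal (y ^ (η - 1 / 2)) *
          ‖zetaP η (cutLow T₀) (Real.log y)‖ₑ := by
    have h1 := (enorm_integral_zetaMu_mul_le (integrable_zetaMu_mul_cutLow hRH hη T₀)
      (k := fun y => (trap m n y : ℂ)) (continuous_ofReal.comp (continuous_trap m n))
      (fun y => by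
        rw [norm_real, Real.norm_of_nonneg (trap_mem_Icc hmn y).1]
        exact (trap_mem_Icc hmn y).2)
      (a := m + 1 / 4) (b := n + 3 / 4) (by linarith) (by linarith) (η - 1 / 2)).2
    rw [← MeasureTheory.integral_indicator measurableSet_Icc]
    refine le_trans (le_of_eq ?_) (h1.trans (MeasureTheory.lintegral_mono_set
      (Set.Ioc_subset_Ioc (by linarith) (by linarith))))
    congr 2
    funext t
    rw [← mellin_trap_eq_intervalIntegral hmn]
    unfold cutLow
    by_cases ht : t ∈ Set.Icc (-T₀) T₀
    · rw [Set.indicator_of_mem ht, Set.indicator_of_mem ht, mul_one]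
    · rw [Set.indicator_of_notMem ht, Set.indicator_of_notMem ht]; simp
  have hhigh : ‖∫ t in Set.Icc (-T₁) T₁ \ Set.Icc (-T₀) T₀, (zetaMu η t : ℂ) * K t‖ₑ ≤
      4 * ((∫⁻ y in Set.Ioc (n : ℝ) (n + 1), ENNReal.ofReal (y ^ (1 / 2 + η)) *
          ‖zetaP η (cutHigh η T₀ T₁) (Real.log y)‖ₑ) +
        ∫⁻ y in Set.Ioc (m : ℝ) (m + 1), ENNReal.ofReal (y ^ (1 / 2 + η)) *
          ‖zetaP η (cutHigh η T₀ T₁) (Real.log y)‖ₑ) := by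
    have hgen : ∀ (k : ℕ) (a b : ℝ), (k : ℝ) < a → a ≤ b → b ≤ k + 1 →
        MeasureTheory.Integrable (fun t : ℝ => (zetaMu η t : ℂ) * cutHigh η T₀ T₁ t *
          ∫ y in a..b, (y : ℂ) ^ (((1 / 2 + η : ℝ) : ℂ) + t * I)) ∧
        ‖∫ t : ℝ, (zetaMu η t : ℂ) * cutHigh η T₀ T₁ t *
          ∫ y in a..b, (y : ℂ) ^ (((1 / 2 + η : ℝ) : ℂ) + t * I)‖ₑ ≤
        ∫⁻ y in Set.Ioc (k : ℝ) (k + 1), ENNReal.ofReal (y ^ (1 / 2 + η)) *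
          ‖zetaP η (cutHigh η T₀ T₁) (Real.log y)‖ₑ := by
      intro k a b hka hab hb
      have hk0 : (0 : ℝ) ≤ k := by positivity
      have h1 := enorm_integral_zetaMu_mul_le (integrable_zetaMu_mul_cutHigh hRH hη T₀ T₁)
        (k := fun _ => 1) continuous_const (fun y => by simp) (hk0.trans_lt hka) hab (1 / 2 + η)
      simp only [one_mul] at h1
      exact ⟨h1.1, h1.2.trans (MeasureTheory.lintegral_mono_set (Set.Ioc_subset_Ioc hka.le hb))⟩
    obtain ⟨i1, b1⟩ := hgen n (n + 1 / 2) (n + 3 / 4) (by linarith) (by linarith) (by linarith)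
    obtain ⟨i2, b2⟩ := hgen m (m + 1 / 4) (m + 1 / 2) (by linarith) (by linarith) (by linarith)
    have he : ∫ t in Set.Icc (-T₁) T₁ \ Set.Icc (-T₀) T₀, (zetaMu η t : ℂ) * K t =
        4 * ((∫ t : ℝ, (zetaMu η t : ℂ) * cutHigh η T₀ T₁ t *
          ∫ y in (n + 1 / 2 : ℝ)..(n + 3 / 4), (y : ℂ) ^ (((1 / 2 + η : ℝ) : ℂ) + t * I)) -
        ∫ t : ℝ, (zetaMu η t : ℂ) * cutHigh η T₀ T₁ t *
          ∫ y in (m + 1 / 4 : ℝ)..(m + 1 / 2), (y : ℂ) ^ (((1 / 2 + η : ℝ) : ℂ) + t * I)) := by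
      rw [← MeasureTheory.integral_sub i1 i2, ← MeasureTheory.integral_const_mul,
        ← MeasureTheory.integral_indicator (measurableSet_Icc.diff measurableSet_Icc)]
      congr 1
      funext t
      by_cases ht : t ∈ Set.Icc (-T₁) T₁ \ Set.Icc (-T₀) T₀
      · have h3 : cutHigh η T₀ T₁ t = 1 / (((1 / 2 + η : ℝ) : ℂ) + t * I) := by
          unfold cutHigh
          rw [Set.indicator_of_mem ht]
        rw [Set.indicator_of_mem ht, h3]
        simp only [hK]
        rw [mellin_trap_eq_integral m n (by simp; linarith)]
        ring
      · have h3 : cutHigh η T₀ T₁ t = 0 := by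
          unfold cutHigh
          rw [Set.indicator_of_notMem ht]
        rw [Set.indicator_of_notMem ht, h3]
        ring
    rw [he, enorm_mul]
    have e4 : ‖(4 : ℂ)‖ₑ = 4 := by
      rw [← ofReal_norm]; norm_num
    rw [e4]
    gcongr
    exact enorm_sub_le.trans (add_le_add b1 b2)
  have htail : ‖∫ t in (Set.Icc (-T₁) T₁)ᶜ, (zetaMu η t : ℂ) * K t‖ₑ ≤
      ∫⁻ t in (Set.Icc (-T₁) T₁)ᶜ, ENNReal.ofReal |zetaMu η t| * ‖K t‖ₑ := by
    refine (MeasureTheory.enorm_integral_le_lintegral_enorm _).trans (le_of_eq ?_)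
    refine MeasureTheory.lintegral_congr fun t => ?_
    rw [enorm_mul, ← ofReal_norm (zetaMu η t : ℂ), norm_real, Real.norm_eq_abs]
  rw [hsplit]
  exact (enorm_add_le _ _).trans (add_le_add ((enorm_add_le _ _).trans (add_le_add hlow hhigh)) htail)

lemma exists_lintegral_zetaMu_cutLow_le (hRH : RiemannHypothesis) :
    ∃ C : ℝ, 0 < C ∧ ∀ η T₀ T₁ : ℝ, 0 < η → η ≤ 1 → 1 ≤ T₀ → T₀ ≤ T₁ →
      ∫⁻ t, ENNReal.ofReal |zetaMu η t| * (‖cutLow T₀ t‖ₑ ^ 2 * ENNReal.ofReal (ell t)) ≤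
        ENNReal.ofReal (C * T₀ * ell T₁ ^ 2) := by
  obtain ⟨C, hC, h⟩ := exists_lintegral_zetaMu_ell_le hRH
  refine ⟨2 * C, by positivity, fun η T₀ T₁ hη hη1 hT₀ hT => ?_⟩
  calc _ ≤ ∫⁻ t, ENNReal.ofReal (2 * T₀ ^ 2) * (ENNReal.ofReal |zetaMu η t| *
        (Set.Icc (-T₁) T₁).indicator
          (fun t => ENNReal.ofReal (ell t / (T₀ ^ 2 + t ^ 2))) t) := by
        refine MeasureTheory.lintegral_mono fun t => ?_
        unfold cutLow
        by_cases ht : t ∈ Set.Icc (-T₀) T₀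
        · have ht1 : t ∈ Set.Icc (-T₁) T₁ := Set.Icc_subset_Icc (by linarith) hT ht
          have hle : t ^ 2 ≤ T₀ ^ 2 := sq_le_sq' ht.1 ht.2
          have hl := one_le_ell t
          rw [Set.indicator_of_mem ht, Set.indicator_of_mem ht1,
            mul_left_comm (ENNReal.ofReal (2 * T₀ ^ 2)), ← ENNReal.ofReal_mul (by positivity)]
          gcongr
          rw [enorm_one, one_pow, one_mul]
          refine ENNReal.ofReal_le_ofReal ?_
          rw [mul_div_assoc', le_div_iff₀ (by positivity)]
          nlinarith
        · rw [Set.indicator_of_notMem ht]; simp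
    _ = ENNReal.ofReal (2 * T₀ ^ 2) * _ := MeasureTheory.lintegral_const_mul' _ _ ENNReal.ofReal_ne_top
    _ ≤ ENNReal.ofReal (2 * T₀ ^ 2) * ENNReal.ofReal (C * ell T₁ ^ 2 / T₀) := by
        gcongr; exact h η T₀ T₁ hη hη1 hT₀ (hT₀.trans hT)
    _ = _ := by
        rw [← ENNReal.ofReal_mul (by positivity)]
        congr 1; field_simp

lemma exists_lintegral_zetaMu_cutHigh_le (hRH : RiemannHypothesis) :
    ∃ C : ℝ, 0 < C ∧ ∀ η T₀ T₁ : ℝ, 0 < η → η ≤ 1 → 1 ≤ T₀ → T₀ ≤ T₁ →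
      ∫⁻ t, ENNReal.ofReal |zetaMu η t| * (‖cutHigh η T₀ T₁ t‖ₑ ^ 2 * ENNReal.ofReal (ell t)) ≤
        ENNReal.ofReal (C * ell T₁ ^ 2 / T₀) := by
  obtain ⟨C, hC, h⟩ := exists_lintegral_zetaMu_ell_le hRH
  refine ⟨2 * C, by positivity, fun η T₀ T₁ hη hη1 hT₀ hT => ?_⟩
  calc _ ≤ ∫⁻ t, ENNReal.ofReal 2 * (ENNReal.ofReal |zetaMu η t| *
        (Set.Icc (-T₁) T₁).indicator
          (fun t => ENNReal.ofReal (ell t / (T₀ ^ 2 + t ^ 2))) t) := by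
        refine MeasureTheory.lintegral_mono fun t => ?_
        unfold cutHigh
        by_cases ht : t ∈ Set.Icc (-T₁) T₁ \ Set.Icc (-T₀) T₀
        · have hlt : T₀ < |t| := by
            by_contra! h'
            exact ht.2 (abs_le.1 h')
          have hle : T₀ ^ 2 ≤ t ^ 2 := by
            rw [← sq_abs t]; gcongr
          have ht0 : 0 < t ^ 2 := by nlinarith
          have hl := one_le_ell t
          have hs := (norm_half_add_ge hη t).2
          rw [Set.indicator_of_mem ht, Set.indicator_of_mem ht.1,
            mul_left_comm (ENNReal.ofReal 2), ← ENNReal.ofReal_mul (by positivity)]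
          gcongr
          rw [← ofReal_norm, ← ENNReal.ofReal_pow (norm_nonneg _),
            ← ENNReal.ofReal_mul (by positivity)]
          refine ENNReal.ofReal_le_ofReal ?_
          rw [norm_div, norm_one, div_pow, one_pow]
          have h2 : t ^ 2 ≤ ‖((1 / 2 + η : ℝ) : ℂ) + t * Complex.I‖ ^ 2 := by
            rw [← sq_abs t]; gcongr
          calc _ ≤ 1 / t ^ 2 * ell t := by gcongr
            _ ≤ 2 / (T₀ ^ 2 + t ^ 2) * ell t := by
              gcongr ?_ * _
              rw [div_le_div_iff₀ ht0 (by positivity)]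
              linarith
            _ = _ := by ring
        · rw [Set.indicator_of_notMem ht]; simp
    _ = ENNReal.ofReal 2 * _ := MeasureTheory.lintegral_const_mul' _ _ (by simp)
    _ ≤ ENNReal.ofReal 2 * ENNReal.ofReal (C * ell T₁ ^ 2 / T₀) := by
        gcongr; exact h η T₀ T₁ hη hη1 hT₀ (hT₀.trans hT)
    _ = _ := by
        rw [← ENNReal.ofReal_mul (by positivity)]
        congr 1; ring

lemma exists_setLIntegral_zetaMu_mellin_trap_le (hRH : RiemannHypothesis) :
    ∃ C : ℝ, 0 < C ∧ ∀ (η T₁ : ℝ) (m n : ℕ), 0 < η → η ≤ 1 / 2 → 1 ≤ T₁ → m ≤ n →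
      ∫⁻ t in (Set.Icc (-T₁) T₁)ᶜ, ENNReal.ofReal |zetaMu η t| *
        ‖mellin (fun y => (trap m n y : ℂ)) (((1 / 2 + η : ℝ) : ℂ) + t * Complex.I)‖ₑ ≤
        ENNReal.ofReal (C * (n + 1 : ℝ) ^ 2 * T₁ ^ (-(1 / 4 : ℝ))) := by
  obtain ⟨C, hC, h⟩ := exists_lintegral_zetaMu_tail_le hRH
  refine ⟨32 * C, by positivity, fun η T₁ m n hη hη1 hT hmn => ?_⟩
  calc _ ≤ ∫⁻ t in (Set.Icc (-T₁) T₁)ᶜ, ENNReal.ofReal (32 * (n + 1 : ℝ) ^ 2) *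
        (ENNReal.ofReal |zetaMu η t| * ENNReal.ofReal (1 / (T₁ ^ 2 + t ^ 2))) := by
        refine MeasureTheory.setLIntegral_mono' measurableSet_Icc.compl fun t ht => ?_
        have hlt : T₁ < |t| := by
          by_contra! h'
          exact ht (abs_le.1 h')
        have hle : T₁ ^ 2 ≤ t ^ 2 := by
          rw [← sq_abs t]; gcongr
        have ht0 : 0 < t ^ 2 := by nlinarith
        rw [mul_left_comm (ENNReal.ofReal (32 * (n + 1 : ℝ) ^ 2)), ← ENNReal.ofReal_mul (by positivity)]
        gcongr
        rw [← ofReal_norm]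
        refine ENNReal.ofReal_le_ofReal ?_
        set s : ℂ := ((1 / 2 + η : ℝ) : ℂ) + t * Complex.I with hs
        have hre : s.re = 1 / 2 + η := by simp [hs]
        have him : s.im = t := by simp [hs]
        have h1 : |t| ≤ ‖s‖ := (norm_half_add_ge hη t).2
        have h2 : |t| ≤ ‖s + 1‖ := by
          refine le_trans (le_of_eq ?_) (Complex.abs_im_le_norm _)
          simp [him]
        refine (norm_mellin_trap_le hmn (by rw [hre]; linarith)).trans ?_
        have h3 : (n + 1 : ℝ) ^ (s.re + 1) ≤ (n + 1 : ℝ) ^ 2 := by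
          rw [← Real.rpow_natCast, hre]
          refine Real.rpow_le_rpow_of_exponent_le ?_ (by push_cast; linarith)
          have : (0 : ℝ) ≤ n := by positivity
          linarith
        have h4 : t ^ 2 ≤ ‖s‖ * ‖s + 1‖ := by
          rw [← sq_abs, sq]; gcongr
        calc _ ≤ 16 * (n + 1 : ℝ) ^ 2 / t ^ 2 := by gcongr
          _ ≤ _ := by
            rw [mul_one_div, div_le_div_iff₀ ht0 (by positivity)]
            have : 0 < (n + 1 : ℝ) ^ 2 := by positivity
            nlinarith
    _ ≤ ∫⁻ t, ENNReal.ofReal (32 * (n + 1 : ℝ) ^ 2) *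
        (ENNReal.ofReal |zetaMu η t| * ENNReal.ofReal (1 / (T₁ ^ 2 + t ^ 2))) :=
        MeasureTheory.setLIntegral_le_lintegral _ _
    _ = ENNReal.ofReal (32 * (n + 1 : ℝ) ^ 2) * _ :=
        MeasureTheory.lintegral_const_mul' _ _ ENNReal.ofReal_ne_top
    _ ≤ ENNReal.ofReal (32 * (n + 1 : ℝ) ^ 2) * ENNReal.ofReal (C * T₁ ^ (-(1 / 4 : ℝ))) := by
        gcongr; exact h η T₁ hη (by linarith) hT
    _ = _ := by
        rw [← ENNReal.ofReal_mul (by positivity)]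
        congr 1; ring

lemma ENNReal_add_sq_le (x y : ENNReal) : (x + y) ^ 2 ≤ 2 * (x ^ 2 + y ^ 2) := by
  rcases eq_or_ne x ⊤ with rfl | hx
  · simp
  rcases eq_or_ne y ⊤ with rfl | hy
  · simp
  lift x to NNReal using hx
  lift y to NNReal using hy
  norm_cast
  exact add_sq_le

lemma ENNReal_four_term_sq_le (a b c d : ENNReal) :
    (a + 4 * (b + c) + d) ^ 2 ≤ 4 * a ^ 2 + 128 * (b ^ 2 + c ^ 2) + 2 * d ^ 2 := by
  calc _ ≤ 2 * ((a + 4 * (b + c)) ^ 2 + d ^ 2) := ENNReal_add_sq_le _ _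
    _ ≤ 2 * (2 * (a ^ 2 + (4 * (b + c)) ^ 2) + d ^ 2) := by
        gcongr; exact ENNReal_add_sq_le _ _
    _ = 2 * (2 * (a ^ 2 + 16 * (b + c) ^ 2) + d ^ 2) := by ring
    _ ≤ 2 * (2 * (a ^ 2 + 16 * (2 * (b ^ 2 + c ^ 2))) + d ^ 2) := by
        gcongr; exact ENNReal_add_sq_le _ _
    _ = _ := by ring

lemma enorm_psi_integral (hRH : RiemannHypothesis) {m n : ℕ} (hm : 1 ≤ m) (hmn : m ≤ n) {η : ℝ}
    (hη : 0 < η) (hη1 : η ≤ 1 / 2) :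
    ENNReal.ofReal ((Chebyshev.psi n - Chebyshev.psi m - (n - m + 1 / 4 : ℝ)) ^ 2) ≤
    ‖∫ t : ℝ, (zetaMu η t : ℂ) *
        mellin (fun y => (trap m n y : ℂ)) (((1 / 2 + η : ℝ) : ℂ) + t * Complex.I)‖ₑ ^ 2 := by
  rw [psi_sub_psi_eq hRH hm hmn hη hη1, ← ofReal_norm, ← ENNReal.ofReal_pow (norm_nonneg _)]
  refine ENNReal.ofReal_le_ofReal ?_
  rw [norm_mul, Complex.norm_real, Complex.norm_real, mul_pow, Real.norm_eq_abs, Real.norm_eq_abs,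
    sq_abs, sq_abs]
  have h1 : 1 ≤ Real.pi ^ 2 := by nlinarith [Real.pi_gt_three]
  have h2 := sq_nonneg (Chebyshev.psi n - Chebyshev.psi m - (n - m + 1 / 4 : ℝ))
  nlinarith

lemma exists_sum_psi_sq_dyadic (hRH : RiemannHypothesis) :
    ∃ C : ℝ, 0 < C ∧ ∀ M H : ℕ, 1 ≤ H → H ≤ M →
      ∑ m ∈ Ioc M (2 * M), (Chebyshev.psi ((m + H : ℕ) : ℝ) - Chebyshev.psi m - (H + 1 / 4)) ^ 2 ≤
        C * H * M * Real.log (8 * M) ^ 2 := by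
  obtain ⟨C₁, hC₁, hlow⟩ := exists_lintegral_zetaMu_cutLow_le hRH
  obtain ⟨C₂, hC₂, hhigh⟩ := exists_lintegral_zetaMu_cutHigh_le hRH
  obtain ⟨C₃, hC₃, htail⟩ := exists_setLIntegral_zetaMu_mellin_trap_le hRH
  obtain ⟨C₄, hC₄, hms⟩ := exists_lintegral_zetaP_sq_le hRH
  refine ⟨4 * (4 * 9 * C₄ * C₁ * 81) + 128 * (2 * (5 * 9 * C₄ * C₂ * 81)) + 2 * C₃ ^ 2,
    by positivity, fun M H hH hHM => ?_⟩
  have hM : 1 ≤ M := hH.trans hHM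
  have hMr : (1 : ℝ) ≤ M := by exact_mod_cast hM
  have hHr : (1 : ℝ) ≤ H := by exact_mod_cast hH
  have hHMr : (H : ℝ) ≤ M := by exact_mod_cast hHM
  set L := Real.log (8 * M) with hL
  have hL2 : 2 ≤ L := by
    rw [hL, Real.le_log_iff_exp_le (by positivity)]
    have h2 : Real.exp 2 = Real.exp 1 * Real.exp 1 := by rw [← Real.exp_add]; norm_num
    have h3 := Real.exp_one_lt_d9
    have h4 := Real.exp_pos 1
    nlinarith
  set η : ℝ := 1 / L with hη
  have hη0 : 0 < η := by positivity
  have hη1 : η ≤ 1 / 2 := one_div_le_one_div_of_le (by norm_num) hL2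
  have hpow : (8 * M : ℝ) ^ (2 * η) ≤ 9 := by
    rw [Real.rpow_def_of_pos (by positivity), ← hL, hη]
    have : L * (2 * (1 / L)) = 2 := by field_simp
    rw [this]
    have h2 : Real.exp 2 = Real.exp 1 * Real.exp 1 := by rw [← Real.exp_add]; norm_num
    have h3 := Real.exp_one_lt_d9
    have h4 := Real.exp_pos 1
    nlinarith
  set T₀ : ℝ := M / H with hT₀
  set T₁ : ℝ := (8 * M : ℝ) ^ 8 with hT₁
  have hT₀1 : 1 ≤ T₀ := by rw [hT₀, one_le_div (by positivity)]; exact hHMr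
  have hT₁8 : 8 * (M : ℝ) ≤ T₁ := le_self_pow₀ (by linarith) (by norm_num)
  have hT₀₁ : T₀ ≤ T₁ := by
    have : T₀ ≤ M := by rw [hT₀]; exact div_le_self (by positivity) hHr
    linarith
  have hell : ell T₁ ^ 2 ≤ 81 * L ^ 2 := by
    have h1 : ell T₁ ≤ 9 * L := by
      unfold ell
      have h2 : (9 : ℝ) * L = Real.log ((8 * M : ℝ) ^ 9) := by
        rw [Real.log_pow]; push_cast; rfl
      rw [h2]
      refine Real.log_le_log (by positivity) ?_
      rw [abs_of_pos (by positivity), hT₁, pow_succ (8 * M : ℝ) 8]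
      nlinarith
    have h0 := one_le_ell T₁
    nlinarith
  set P0 : ℝ → ENNReal := fun y => ‖zetaP η (cutLow T₀) (Real.log y)‖ₑ with hP0
  set P1 : ℝ → ENNReal := fun y => ‖zetaP η (cutHigh η T₀ T₁) (Real.log y)‖ₑ with hP1
  have hP0m : Measurable P0 :=
    ((measurable_zetaP hRH hη0 (measurable_cutLow T₀)).comp Real.measurable_log).enorm
  have hP1m : Measurable P1 :=
    ((measurable_zetaP hRH hη0 (measurable_cutHigh η T₀ T₁)).comp Real.measurable_log).enorm
  set f : ℝ → ENNReal := fun y => ENNReal.ofReal (y ^ (η - 1 / 2)) * P0 y with hf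
  set g : ℝ → ENNReal := fun y => ENNReal.ofReal (y ^ (1 / 2 + η)) * P1 y with hg
  have hfm : Measurable f := by
    have : Measurable fun y : ℝ => ENNReal.ofReal (y ^ (η - 1 / 2)) := by fun_prop
    exact this.mul hP0m
  have hgm : Measurable g := by
    have : Measurable fun y : ℝ => ENNReal.ofReal (y ^ (1 / 2 + η)) := by fun_prop
    exact this.mul hP1m
  have hfint : ∫⁻ y in Set.Icc (M : ℝ) (5 * M), f y ^ 2 ≤
      ENNReal.ofReal (9 * C₄ * C₁ * T₀ * (81 * L ^ 2)) := by
    calc _ ≤ ∫⁻ y in Set.Icc (M : ℝ) (5 * M), ENNReal.ofReal (9 / M) * P0 y ^ 2 := by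
          refine MeasureTheory.setLIntegral_mono' measurableSet_Icc fun y hy => ?_
          simp only [hf]
          rw [mul_pow, ← ENNReal.ofReal_pow (Real.rpow_nonneg (by linarith [hy.1]) _)]
          gcongr
          calc (y ^ (η - 1 / 2)) ^ 2 ≤ ((M : ℝ) ^ (η - 1 / 2)) ^ 2 := by
                have : y ^ (η - 1 / 2) ≤ (M : ℝ) ^ (η - 1 / 2) :=
                  Real.rpow_le_rpow_of_nonpos (by positivity) hy.1 (by linarith)
                have h0 : 0 ≤ y ^ (η - 1 / 2) := Real.rpow_nonneg (by linarith [hy.1]) _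
                gcongr
            _ = (M : ℝ) ^ (2 * η) / M := by
                rw [← Real.rpow_natCast, ← Real.rpow_mul (by positivity)]
                nth_rewrite 3 [← Real.rpow_one (M : ℝ)]
                rw [← Real.rpow_sub (by positivity)]
                congr 1; push_cast; ring
            _ ≤ 9 / M := by
                gcongr
                refine le_trans ?_ hpow
                gcongr; linarith
      _ = ENNReal.ofReal (9 / M) * _ := MeasureTheory.lintegral_const_mul' _ _ ENNReal.ofReal_ne_top
      _ ≤ ENNReal.ofReal (9 / M) * (ENNReal.ofReal (C₄ * M) *
          ENNReal.ofReal (C₁ * T₀ * ell T₁ ^ 2)) := by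
          gcongr
          refine (hms η (cutLow T₀) M hη0 (by linarith) (by positivity) (measurable_cutLow T₀)
            (integrable_zetaMu_mul_cutLow hRH hη0 T₀)).trans ?_
          gcongr
          exact hlow η T₀ T₁ hη0 (by linarith) hT₀1 hT₀₁
      _ ≤ _ := by
          rw [← ENNReal.ofReal_mul (by positivity), ← ENNReal.ofReal_mul (by positivity)]
          refine ENNReal.ofReal_le_ofReal ?_
          calc _ = 9 * C₄ * C₁ * T₀ * ell T₁ ^ 2 := by field_simp
            _ ≤ _ := by gcongr
  have hgint : ∫⁻ y in Set.Icc (M : ℝ) (5 * M), g y ^ 2 ≤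
      ENNReal.ofReal (5 * 9 * C₄ * C₂ * M ^ 2 * (81 * L ^ 2) / T₀) := by
    calc _ ≤ ∫⁻ y in Set.Icc (M : ℝ) (5 * M), ENNReal.ofReal (5 * M * 9) * P1 y ^ 2 := by
          refine MeasureTheory.setLIntegral_mono' measurableSet_Icc fun y hy => ?_
          simp only [hg]
          rw [mul_pow, ← ENNReal.ofReal_pow (Real.rpow_nonneg (by linarith [hy.1]) _)]
          gcongr
          have hy0 : 0 < y := by linarith [hy.1]
          calc (y ^ (1 / 2 + η)) ^ 2 = y * y ^ (2 * η) := by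
                rw [← Real.rpow_natCast, ← Real.rpow_mul hy0.le]
                nth_rewrite 2 [← Real.rpow_one y]
                rw [← Real.rpow_add hy0]
                congr 1; push_cast; ring
            _ ≤ 5 * M * 9 := by
                gcongr
                · exact hy.2
                · refine le_trans ?_ hpow
                  gcongr; linarith [hy.2]
      _ = ENNReal.ofReal (5 * M * 9) * _ :=
          MeasureTheory.lintegral_const_mul' _ _ ENNReal.ofReal_ne_top
      _ ≤ ENNReal.ofReal (5 * M * 9) * (ENNReal.ofReal (C₄ * M) *
          ENNReal.ofReal (C₂ * ell T₁ ^ 2 / T₀)) := by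
          gcongr
          refine (hms η (cutHigh η T₀ T₁) M hη0 (by linarith) (by positivity)
            (measurable_cutHigh η T₀ T₁)
            (integrable_zetaMu_mul_cutHigh hRH hη0 T₀ T₁)).trans ?_
          gcongr
          exact hhigh η T₀ T₁ hη0 (by linarith) hT₀1 hT₀₁
      _ ≤ _ := by
          rw [← ENNReal.ofReal_mul (by positivity), ← ENNReal.ofReal_mul (by positivity)]
          refine ENNReal.ofReal_le_ofReal ?_
          calc _ = 5 * 9 * C₄ * C₂ * M ^ 2 * ell T₁ ^ 2 / T₀ := by ring
            _ ≤ _ := by gcongr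
  set a : ℕ → ENNReal := fun m => ∫⁻ y in Set.Ioc (m : ℝ) ((m + H : ℕ) + 1), f y with ha
  set b : ℕ → ENNReal := fun m => ∫⁻ y in Set.Ioc ((m + H : ℕ) : ℝ) ((m + H : ℕ) + 1), g y with hb
  set c : ℕ → ENNReal := fun m => ∫⁻ y in Set.Ioc (m : ℝ) (m + 1), g y with hc
  have hterm : ∀ m ∈ Ioc M (2 * M), ENNReal.ofReal
      ((Chebyshev.psi ((m + H : ℕ) : ℝ) - Chebyshev.psi m - (H + 1 / 4)) ^ 2) ≤
      4 * a m ^ 2 + 128 * (b m ^ 2 + c m ^ 2) + 2 * ENNReal.ofReal (C₃ ^ 2) := by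
    intro m hm
    rw [Finset.mem_Ioc] at hm
    have h1 := enorm_psi_integral hRH (m := m) (n := m + H) (by omega) (by omega) hη0 hη1
    have e1 : ((m + H : ℕ) : ℝ) - m + 1 / 4 = H + 1 / 4 := by push_cast; ring
    rw [e1] at h1
    have h2 := enorm_integral_zetaMu_mul_mellin_trap_le hRH hη0 (m := m) (n := m + H) (by omega) hT₀₁
    have h3 := htail η T₁ m (m + H) hη0 hη1 (by linarith) (by omega)
    have h4 : C₃ * (((m + H : ℕ) : ℝ) + 1) ^ 2 * T₁ ^ (-(1 / 4 : ℝ)) ≤ C₃ := by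
      have e2 : T₁ ^ (-(1 / 4 : ℝ)) = 1 / (8 * M : ℝ) ^ 2 := by
        have e3 : T₁ ^ (-(1 / 4 : ℝ)) = (8 * M : ℝ) ^ (-(2 : ℝ)) := by
          rw [hT₁, ← Real.rpow_natCast, ← Real.rpow_mul (by positivity)]
          norm_num
        rw [e3, Real.rpow_neg (by positivity), Real.rpow_two, one_div]
      rw [e2, mul_one_div, div_le_iff₀ (by positivity)]
      have h5 : ((m + H : ℕ) : ℝ) + 1 ≤ 8 * M := by exact_mod_cast (by omega)
      gcongr
    calc _ ≤ _ := h1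
      _ ≤ (a m + 4 * (b m + c m) + ENNReal.ofReal C₃) ^ 2 := by
          gcongr
          refine h2.trans ?_
          gcongr
          exact h3.trans (ENNReal.ofReal_le_ofReal h4)
      _ ≤ _ := by
          rw [ENNReal.ofReal_pow hC₃.le]
          exact ENNReal_four_term_sq_le _ _ _ _
  have hsa : ∑ m ∈ Ioc M (2 * M), a m ^ 2 ≤
      ENNReal.ofReal (4 * 9 * C₄ * C₁ * 81 * (H * M * L ^ 2)) := by
    have hH1 : ENNReal.ofReal (H + 1) = (H : ENNReal) + 1 := by
      rw [ENNReal.ofReal_add (by positivity) (by norm_num)]; simp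
    calc _ ≤ ∑ m ∈ Ioc M (2 * M), (H + 1 : ENNReal) *
          ∫⁻ y in Set.Ioc (m : ℝ) (m + H + 1), f y ^ 2 := by
          refine sum_le_sum fun m _ => ?_
          simp only [ha]
          push_cast
          refine (sq_setLIntegral_le hfm _).trans (le_of_eq ?_)
          rw [Real.volume_Ioc, ← hH1]
          congr 2; ring
      _ ≤ (H + 1 : ENNReal) * ((H + 1 : ENNReal) *
          ENNReal.ofReal (9 * C₄ * C₁ * T₀ * (81 * L ^ 2))) := by
          rw [← mul_sum]
          gcongr
          refine (sum_setLIntegral_Ioc_le (fun y => f y ^ 2) M H hHM).trans ?_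
          gcongr
      _ ≤ _ := by
          rw [← hH1, ← ENNReal.ofReal_mul (by positivity), ← ENNReal.ofReal_mul (by positivity)]
          refine ENNReal.ofReal_le_ofReal ?_
          calc _ ≤ (2 * H) * ((2 * H) * (9 * C₄ * C₁ * T₀ * (81 * L ^ 2))) := by
                gcongr <;> linarith
            _ = _ := by rw [hT₀]; field_simp; ring
  have hsg : ∀ j ≤ H, ∑ m ∈ Ioc M (2 * M),
      (∫⁻ y in Set.Ioc ((m + j : ℕ) : ℝ) ((m + j : ℕ) + 1), g y) ^ 2 ≤
      ENNReal.ofReal (5 * 9 * C₄ * C₂ * 81 * (H * M * L ^ 2)) := by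
    intro j hj
    calc _ ≤ ∑ m ∈ Ioc M (2 * M),
          ∫⁻ y in Set.Ioc ((m + j : ℕ) : ℝ) ((m + j : ℕ) + 1), g y ^ 2 := by
          refine sum_le_sum fun m _ => ?_
          refine (sq_setLIntegral_le hgm _).trans (le_of_eq ?_)
          rw [Real.volume_Ioc, add_sub_cancel_left, ENNReal.ofReal_one, one_mul]
      _ ≤ _ := sum_setLIntegral_shift_le (fun y => g y ^ 2) M H hHM j hj
      _ ≤ _ := hgint
      _ = _ := by
          congr 1
          rw [hT₀]; field_simp
  have hfin : ENNReal.ofReal (∑ m ∈ Ioc M (2 * M),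
      (Chebyshev.psi ((m + H : ℕ) : ℝ) - Chebyshev.psi m - (H + 1 / 4)) ^ 2) ≤
      ENNReal.ofReal ((4 * (4 * 9 * C₄ * C₁ * 81) + 128 * (2 * (5 * 9 * C₄ * C₂ * 81))
        + 2 * C₃ ^ 2) * H * M * L ^ 2) := by
    rw [ENNReal.ofReal_sum_of_nonneg fun _ _ => sq_nonneg _]
    calc _ ≤ ∑ m ∈ Ioc M (2 * M),
          (4 * a m ^ 2 + 128 * (b m ^ 2 + c m ^ 2) + 2 * ENNReal.ofReal (C₃ ^ 2)) :=
          sum_le_sum hterm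
      _ = 4 * ∑ m ∈ Ioc M (2 * M), a m ^ 2 + 128 * (∑ m ∈ Ioc M (2 * M), b m ^ 2 +
          ∑ m ∈ Ioc M (2 * M), c m ^ 2) + M * (2 * ENNReal.ofReal (C₃ ^ 2)) := by
          rw [sum_add_distrib, sum_add_distrib, ← mul_sum, ← mul_sum, sum_add_distrib, sum_const,
            Nat.card_Ioc, nsmul_eq_mul]
          congr 3; omega
      _ ≤ 4 * ENNReal.ofReal (4 * 9 * C₄ * C₁ * 81 * (H * M * L ^ 2)) +
          128 * (ENNReal.ofReal (5 * 9 * C₄ * C₂ * 81 * (H * M * L ^ 2)) +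
          ENNReal.ofReal (5 * 9 * C₄ * C₂ * 81 * (H * M * L ^ 2))) +
          M * (2 * ENNReal.ofReal (C₃ ^ 2)) := by
          gcongr
          · exact hsg H le_rfl
          · have := hsg 0 (by omega)
            simpa using this
      _ = ENNReal.ofReal (4 * (4 * 9 * C₄ * C₁ * 81 * (H * M * L ^ 2)) +
          128 * ((5 * 9 * C₄ * C₂ * 81 * (H * M * L ^ 2)) +
          (5 * 9 * C₄ * C₂ * 81 * (H * M * L ^ 2))) + M * (2 * C₃ ^ 2)) := by
          rw [ENNReal.ofReal_add (by positivity) (by positivity),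
            ENNReal.ofReal_add (by positivity) (by positivity),
            ENNReal.ofReal_mul (p := 4) (by norm_num), ENNReal.ofReal_mul (p := 128) (by norm_num),
            ENNReal.ofReal_add (by positivity) (by positivity),
            ENNReal.ofReal_mul (p := (M : ℝ)) (by positivity), ENNReal.ofReal_mul (p := 2) (by norm_num)]
          simp
      _ ≤ _ := by
          refine ENNReal.ofReal_le_ofReal ?_
          have h1 : (M : ℝ) * (2 * C₃ ^ 2) ≤ 2 * C₃ ^ 2 * (H * M * L ^ 2) := by
            have : 1 * 1 ≤ H * L ^ 2 := by gcongr; nlinarith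
            have h3 : 0 ≤ (M : ℝ) * (2 * C₃ ^ 2) := by positivity
            nlinarith
          linarith
  exact (ENNReal.ofReal_le_ofReal_iff (by positivity)).1 hfin

lemma exists_sum_psi_sq_le (hRH : RiemannHypothesis) :
    ∃ C : ℝ, 0 < C ∧ ∀ N H : ℕ, 1 ≤ H → H ≤ N →
      ∑ m ∈ Ioc H N, (Chebyshev.psi ((m + H : ℕ) : ℝ) - Chebyshev.psi m - H) ^ 2 ≤
        C * H * N * Real.log (8 * N) ^ 2 := by
  obtain ⟨C, hC, h⟩ := exists_sum_psi_sq_dyadic hRH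
  set F : ℕ → ℕ → ℝ := fun H m =>
    (Chebyshev.psi ((m + H : ℕ) : ℝ) - Chebyshev.psi m - (H + 1 / 4)) ^ 2 with hF
  have hF0 : ∀ H m, 0 ≤ F H m := fun H m => sq_nonneg _
  have hlogm : ∀ M N : ℕ, 1 ≤ M → M ≤ N →
      Real.log (8 * M) ^ 2 ≤ Real.log (8 * N) ^ 2 := by
    intro M N hM hMN
    have hMr : (1 : ℝ) ≤ M := by exact_mod_cast hM
    have h1 : 0 ≤ Real.log (8 * M) := Real.log_nonneg (by linarith)
    gcongr
  have key : ∀ N H : ℕ, 1 ≤ H → H ≤ N →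
      ∑ m ∈ Ioc H N, F H m ≤ 2 * C * H * N * Real.log (8 * N) ^ 2 := by
    intro N
    induction N using Nat.strong_induction_on with
    | _ N ih =>
      intro H hH hHN
      rcases Nat.lt_or_ge N 2 with hN | hN
      · have : Ioc H N = ∅ := Finset.Ioc_eq_empty (by omega)
        rw [this, sum_empty]; positivity
      set M := (N + 1) / 2 with hM
      rcases Nat.lt_or_ge M H with hMH | hMH
      · calc _ ≤ ∑ m ∈ Ioc H (2 * H), F H m :=
              sum_le_sum_of_subset_of_nonneg (Ioc_subset_Ioc le_rfl (by omega))
                fun _ _ _ => hF0 _ _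
          _ ≤ C * H * H * Real.log (8 * H) ^ 2 := h H H hH le_rfl
          _ ≤ C * H * N * Real.log (8 * N) ^ 2 := by
              gcongr C * H * ?_ * ?_
              · exact_mod_cast hHN
              · exact hlogm H N hH hHN
          _ ≤ 2 * C * H * N * Real.log (8 * N) ^ 2 := by
              gcongr; linarith
      · have h32 : (3 : ℝ) * M ≤ 2 * N := by
          have : 3 * M ≤ 2 * N := by omega
          exact_mod_cast this
        calc _ ≤ ∑ m ∈ Ioc H M ∪ Ioc M (2 * M), F H m := by
              refine sum_le_sum_of_subset_of_nonneg ?_ fun _ _ _ => hF0 _ _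
              intro m hm
              simp only [mem_union, Finset.mem_Ioc] at hm ⊢
              omega
          _ = ∑ m ∈ Ioc H M, F H m + ∑ m ∈ Ioc M (2 * M), F H m := by
              refine sum_union (Finset.disjoint_left.2 fun m hm hm' => ?_)
              simp only [Finset.mem_Ioc] at hm hm'
              omega
          _ ≤ 2 * C * H * M * Real.log (8 * M) ^ 2 + C * H * M * Real.log (8 * M) ^ 2 :=
              add_le_add (ih M (by omega) H hH hMH) (h M H hH hMH)
          _ = C * H * (3 * M) * Real.log (8 * M) ^ 2 := by ring
          _ ≤ C * H * (2 * N) * Real.log (8 * N) ^ 2 := by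
              gcongr C * H * ?_ * ?_
              exact hlogm M N (by omega) (by omega)
          _ = _ := by ring
  refine ⟨4 * C + 1, by positivity, fun N H hH hHN => ?_⟩
  have hHr : (1 : ℝ) ≤ H := by exact_mod_cast hH
  have hNr : (1 : ℝ) ≤ N := by exact_mod_cast hH.trans hHN
  have hL : 1 ≤ Real.log (8 * N) := by
    rw [Real.le_log_iff_exp_le (by positivity)]
    linarith [Real.exp_one_lt_d9]
  calc _ ≤ ∑ m ∈ Ioc H N, (2 * F H m + 1) := by
        refine sum_le_sum fun m _ => ?_
        simp only [hF]
        set z := Chebyshev.psi ((m + H : ℕ) : ℝ) - Chebyshev.psi m - H with hz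
        have : Chebyshev.psi ((m + H : ℕ) : ℝ) - Chebyshev.psi m - (H + 1 / 4) = z - 1 / 4 := by
          rw [hz]; ring
        rw [this]
        nlinarith [sq_nonneg (z - 1 / 2)]
    _ = 2 * ∑ m ∈ Ioc H N, F H m + ((N - H : ℕ) : ℝ) := by
        rw [sum_add_distrib, ← mul_sum, sum_const, Nat.card_Ioc, nsmul_eq_mul, mul_one]
    _ ≤ 2 * (2 * C * H * N * Real.log (8 * N) ^ 2) + H * N * Real.log (8 * N) ^ 2 := by
        gcongr
        · exact key N H hH hHN
        · have h1 : ((N - H : ℕ) : ℝ) ≤ N := by exact_mod_cast Nat.sub_le _ _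
          calc _ ≤ (N : ℝ) := h1
            _ = 1 * N * 1 ^ 2 := by ring
            _ ≤ _ := by gcongr
    _ = _ := by ring

lemma norm_mellin_trap_one_le {n : ℕ} (hn : 1 ≤ n) {η : ℝ} (hη : 0 < η)
    (hpow : (8 * n : ℝ) ^ (2 * η) ≤ 9) (t : ℝ) :
    ‖mellin (fun y => (trap 1 n y : ℂ)) (((1 / 2 + η : ℝ) : ℂ) + t * Complex.I)‖ ≤
      54 * Real.sqrt n * (1 + |t|)⁻¹ := by
  have hnr : (1 : ℝ) ≤ n := by exact_mod_cast hn
  set s : ℂ := ((1 / 2 + η : ℝ) : ℂ) + t * Complex.I with hs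
  have hre : s.re = 1 / 2 + η := by simp [hs]
  have hs1 := norm_half_add_ge hη t
  rw [← hs] at hs1
  have hpow2 : (2 * n : ℝ) ^ (1 / 2 + η) ≤ 9 * Real.sqrt n := by
    have h1 : ((2 * n : ℝ) ^ (1 / 2 + η)) ^ 2 ≤ (9 * Real.sqrt n) ^ 2 := by
      rw [mul_pow, Real.sq_sqrt (by positivity), ← Real.rpow_natCast,
        ← Real.rpow_mul (by positivity)]
      have e : (1 / 2 + η) * ((2 : ℕ) : ℝ) = 1 + 2 * η := by push_cast; ring
      rw [e, Real.rpow_add (by positivity), Real.rpow_one]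
      have h2 : (2 * n : ℝ) ^ (2 * η) ≤ 9 := by
        refine le_trans ?_ hpow
        gcongr; linarith
      nlinarith
    exact le_of_sq_le_sq h1 (by positivity)
  have hint : ∀ a b : ℝ, 0 < a → a ≤ b → b - a = 1 / 4 → b ≤ 2 * n →
      ‖∫ y in a..b, (y : ℂ) ^ s‖ ≤ 9 * Real.sqrt n * (1 / 4) := by
    intro a b ha hab hba hb
    have := intervalIntegral.norm_integral_le_of_norm_le_const (a := a) (b := b)
      (f := fun y : ℝ => (y : ℂ) ^ s) (C := 9 * Real.sqrt n) (fun y hy => by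
        rw [Set.uIoc_of_le hab] at hy
        have hy0 : 0 < y := ha.trans hy.1
        rw [Complex.norm_cpow_eq_rpow_re_of_pos hy0, hre]
        refine le_trans ?_ hpow2
        gcongr
        linarith [hy.2])
    rwa [hba, abs_of_pos (by norm_num)] at this
  rw [mellin_trap_eq_integral 1 n (by rw [hre]; linarith), norm_mul, norm_div]
  have i1 := hint (n + 1 / 2) (n + 3 / 4) (by positivity) (by linarith) (by ring) (by linarith)
  have i2 := hint ((1 : ℕ) + 1 / 4) ((1 : ℕ) + 1 / 2) (by positivity) (by norm_num) (by ring)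
    (by push_cast; linarith)
  have h4 : ‖(4 : ℂ)‖ = 4 := by norm_num
  have hs0 : 0 < ‖s‖ := by linarith [hs1.1]
  have hinv : 1 / ‖s‖ ≤ 3 * (1 + |t|)⁻¹ := by
    rw [← div_eq_mul_inv, div_le_div_iff₀ hs0 (by positivity)]
    linarith [hs1.1, hs1.2]
  calc _ ≤ ‖(4 : ℂ)‖ / ‖s‖ * (9 * Real.sqrt n * (1 / 4) + 9 * Real.sqrt n * (1 / 4)) := by
        gcongr
        exact (norm_sub_le _ _).trans (add_le_add i1 i2)
    _ = (1 / ‖s‖) * (18 * Real.sqrt n) := by rw [h4]; ring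
    _ ≤ (3 * (1 + |t|)⁻¹) * (18 * Real.sqrt n) := by gcongr
    _ = _ := by ring

lemma exists_abs_psi_sub_le (hRH : RiemannHypothesis) :
    ∃ C : ℝ, 0 < C ∧ ∀ n : ℕ, 1 ≤ n →
      |Chebyshev.psi n - n| ≤ C * Real.sqrt n * Real.log (8 * n) ^ 2 := by
  obtain ⟨C₁, hC₁, hinv⟩ := exists_lintegral_zetaMu_inv_le hRH
  obtain ⟨C₃, hC₃, htail⟩ := exists_setLIntegral_zetaMu_mellin_trap_le hRH
  refine ⟨54 * C₁ * 81 + C₃ + 1, by positivity, fun n hn => ?_⟩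
  have hnr : (1 : ℝ) ≤ n := by exact_mod_cast hn
  set L := Real.log (8 * n) with hL
  have hL2 : 2 ≤ L := by
    rw [hL, Real.le_log_iff_exp_le (by positivity)]
    have h2 : Real.exp 2 = Real.exp 1 * Real.exp 1 := by rw [← Real.exp_add]; norm_num
    have h3 := Real.exp_one_lt_d9
    have h4 := Real.exp_pos 1
    nlinarith
  set η : ℝ := 1 / L with hη
  have hη0 : 0 < η := by positivity
  have hη1 : η ≤ 1 / 2 := one_div_le_one_div_of_le (by norm_num) hL2
  have hpow : (8 * n : ℝ) ^ (2 * η) ≤ 9 := by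
    rw [Real.rpow_def_of_pos (by positivity), ← hL, hη]
    have : L * (2 * (1 / L)) = 2 := by field_simp
    rw [this]
    have h2 : Real.exp 2 = Real.exp 1 * Real.exp 1 := by rw [← Real.exp_add]; norm_num
    have h3 := Real.exp_one_lt_d9
    have h4 := Real.exp_pos 1
    nlinarith
  set T₁ : ℝ := (8 * n : ℝ) ^ 8 with hT₁
  have hT₁8 : 8 * (n : ℝ) ≤ T₁ := le_self_pow₀ (by linarith) (by norm_num)
  have hell : ell T₁ ^ 2 ≤ 81 * L ^ 2 := by
    have h1 : ell T₁ ≤ 9 * L := by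
      unfold ell
      have h2 : (9 : ℝ) * L = Real.log ((8 * n : ℝ) ^ 9) := by
        rw [Real.log_pow]; push_cast; rfl
      rw [h2]
      refine Real.log_le_log (by positivity) ?_
      rw [abs_of_pos (by positivity), hT₁, pow_succ (8 * n : ℝ) 8]
      nlinarith
    have h0 := one_le_ell T₁
    nlinarith
  set K : ℝ → ℂ := fun t =>
    mellin (fun y => (trap 1 n y : ℂ)) (((1 / 2 + η : ℝ) : ℂ) + t * Complex.I) with hK
  have hbound : ‖∫ t : ℝ, (zetaMu η t : ℂ) * K t‖ₑ ≤
      ENNReal.ofReal (54 * Real.sqrt n * (C₁ * ell T₁ ^ 2) + C₃) := by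
    have h1 : ‖∫ t : ℝ, (zetaMu η t : ℂ) * K t‖ₑ ≤
        ∫⁻ t, ENNReal.ofReal |zetaMu η t| * ‖K t‖ₑ := by
      refine (MeasureTheory.enorm_integral_le_lintegral_enorm _).trans (le_of_eq ?_)
      refine MeasureTheory.lintegral_congr fun t => ?_
      rw [enorm_mul, ← ofReal_norm (zetaMu η t : ℂ), Complex.norm_real, Real.norm_eq_abs]
    rw [← MeasureTheory.lintegral_add_compl _ (measurableSet_Icc (a := -T₁) (b := T₁))] at h1
    refine h1.trans ?_
    rw [ENNReal.ofReal_add (by positivity) hC₃.le]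
    refine add_le_add ?_ ?_
    · calc _ ≤ ∫⁻ t in Set.Icc (-T₁) T₁, ENNReal.ofReal (54 * Real.sqrt n) *
            (ENNReal.ofReal |zetaMu η t| * ENNReal.ofReal (1 + |t|)⁻¹) := by
            refine MeasureTheory.lintegral_mono fun t => ?_
            rw [mul_left_comm (ENNReal.ofReal (54 * Real.sqrt n)),
              ← ENNReal.ofReal_mul (by positivity)]
            gcongr
            rw [← ofReal_norm]
            exact ENNReal.ofReal_le_ofReal (norm_mellin_trap_one_le hn hη0 hpow t)
        _ = ENNReal.ofReal (54 * Real.sqrt n) * ∫⁻ t in Set.Icc (-T₁) T₁,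
            (ENNReal.ofReal |zetaMu η t| * ENNReal.ofReal (1 + |t|)⁻¹) :=
            MeasureTheory.lintegral_const_mul' _ _ ENNReal.ofReal_ne_top
        _ = ENNReal.ofReal (54 * Real.sqrt n) * ∫⁻ t, ENNReal.ofReal |zetaMu η t| *
            (Set.Icc (-T₁) T₁).indicator (fun t => ENNReal.ofReal (1 + |t|)⁻¹) t := by
            congr 1
            rw [← MeasureTheory.lintegral_indicator measurableSet_Icc]
            refine MeasureTheory.lintegral_congr fun t => ?_
            by_cases ht : t ∈ Set.Icc (-T₁) T₁
            · rw [Set.indicator_of_mem ht, Set.indicator_of_mem ht]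
            · rw [Set.indicator_of_notMem ht, Set.indicator_of_notMem ht, mul_zero]
        _ ≤ ENNReal.ofReal (54 * Real.sqrt n) * ENNReal.ofReal (C₁ * ell T₁ ^ 2) := by
            gcongr
            exact hinv η T₁ hη0 (by linarith) (by linarith)
        _ = _ := by rw [← ENNReal.ofReal_mul (by positivity)]
    · refine (htail η T₁ 1 n hη0 hη1 (by linarith) hn).trans (ENNReal.ofReal_le_ofReal ?_)
      have e3 : T₁ ^ (-(1 / 4 : ℝ)) = (8 * n : ℝ) ^ (-(2 : ℝ)) := by
        rw [hT₁, ← Real.rpow_natCast, ← Real.rpow_mul (by positivity)]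
        norm_num
      rw [e3, Real.rpow_neg (by positivity), Real.rpow_two, ← div_eq_mul_inv,
        div_le_iff₀ (by positivity)]
      have h5 : (n : ℝ) + 1 ≤ 8 * n := by linarith
      gcongr
  have hpsi := enorm_psi_integral hRH (m := 1) (n := n) le_rfl hn hη0 hη1
  have hpsi1 : Chebyshev.psi ((1 : ℕ) : ℝ) = 0 := Chebyshev.psi_eq_zero_of_lt_two (by norm_num)
  rw [hpsi1] at hpsi
  have h2 := hpsi.trans (pow_le_pow_left' hbound 2)
  rw [← ENNReal.ofReal_pow (by positivity), ENNReal.ofReal_le_ofReal_iff (by positivity)] at h2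
  have h3 := abs_le_of_sq_le_sq' h2 (by positivity)
  have hsq : 1 ≤ Real.sqrt n := Real.one_le_sqrt.2 hnr
  have hfin : 54 * Real.sqrt n * (C₁ * ell T₁ ^ 2) + C₃ + 1 ≤
      (54 * C₁ * 81 + C₃ + 1) * Real.sqrt n * L ^ 2 := by
    have h6 : 54 * Real.sqrt n * (C₁ * ell T₁ ^ 2) ≤ 54 * Real.sqrt n * (C₁ * (81 * L ^ 2)) := by
      gcongr
    have h7 : 1 ≤ Real.sqrt n * L ^ 2 := by
      calc (1 : ℝ) = 1 * 1 ^ 2 := by norm_num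
        _ ≤ _ := by gcongr; linarith
    nlinarith
  push_cast at h3
  rw [abs_le]
  constructor <;> linarith [h3.1, h3.2]

lemma exists_abs_theta_sub_le (hRH : RiemannHypothesis) :
    ∃ C : ℝ, 0 < C ∧ ∀ X x : ℝ, 1 ≤ X → 0 ≤ x → x ≤ X →
      |Chebyshev.theta x - x| ≤ C * Real.sqrt X * Real.log (8 * X) ^ 2 := by
  obtain ⟨C, hC, h⟩ := exists_abs_psi_sub_le hRH
  obtain ⟨B, hB⟩ := Chebyshev.psi_sub_theta_le_mul_sqrt
  refine ⟨C + |B| + 1, by positivity, fun X x hX hx hxX => ?_⟩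
  have hL : 1 ≤ Real.log (8 * X) := by
    rw [Real.le_log_iff_exp_le (by positivity)]
    linarith [Real.exp_one_lt_d9]
  have hsX : 1 ≤ Real.sqrt X := Real.one_le_sqrt.2 hX
  have hSL : 1 ≤ Real.sqrt X * Real.log (8 * X) ^ 2 := by
    calc (1 : ℝ) = 1 * 1 ^ 2 := by norm_num
      _ ≤ _ := by gcongr
  rcases lt_or_ge x 1 with hx1 | hx1
  · rw [Chebyshev.theta_eq_zero_of_lt_two (by linarith), zero_sub, abs_neg, abs_of_nonneg hx]
    have : 0 ≤ (C + |B|) * (Real.sqrt X * Real.log (8 * X) ^ 2) := by positivity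
    nlinarith
  · have hn : 1 ≤ ⌊x⌋₊ := Nat.one_le_floor_iff x |>.2 hx1
    have h1 := h ⌊x⌋₊ hn
    rw [← Chebyshev.psi_eq_psi_coe_floor] at h1
    have h2 := hB x
    have h3 := Chebyshev.theta_le_psi x
    have hfl := Nat.floor_le hx
    have hfl2 := Nat.lt_floor_add_one x
    have hnr : (1 : ℝ) ≤ ⌊x⌋₊ := by exact_mod_cast hn
    have h4 : C * Real.sqrt ⌊x⌋₊ * Real.log (8 * ⌊x⌋₊) ^ 2 ≤
        C * (Real.sqrt X * Real.log (8 * X) ^ 2) := by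
      rw [mul_assoc]
      have h0 : 0 ≤ Real.log (8 * ⌊x⌋₊) := Real.log_nonneg (by linarith)
      gcongr <;> linarith
    have h5 : B * Real.sqrt x ≤ |B| * (Real.sqrt X * Real.log (8 * X) ^ 2) := by
      have h6 : Real.sqrt x ≤ Real.sqrt X * Real.log (8 * X) ^ 2 := by
        calc Real.sqrt x ≤ Real.sqrt X * 1 ^ 2 := by
              rw [one_pow, mul_one]; exact Real.sqrt_le_sqrt hxX
          _ ≤ _ := by gcongr
      calc _ ≤ |B| * Real.sqrt x := by gcongr; exact le_abs_self B
        _ ≤ _ := by gcongr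
    have h7 := abs_le.1 h1
    have e : (C + |B| + 1) * Real.sqrt X * Real.log (8 * X) ^ 2 =
      C * (Real.sqrt X * Real.log (8 * X) ^ 2) + |B| * (Real.sqrt X * Real.log (8 * X) ^ 2) +
        Real.sqrt X * Real.log (8 * X) ^ 2 := by ring
    rw [e, abs_le]
    constructor <;> linarith [h7.1, h7.2]

/-- The logarithm on primes, extended by zero. -/
noncomputable def primeLog (n : ℕ) : ℝ := if n.Prime then Real.log n else 0

lemma primeLog_nonneg (n : ℕ) : 0 ≤ primeLog n := by
  unfold primeLog
  split_ifs
  · exact Real.log_natCast_nonneg _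
  · exact le_rfl

lemma sum_primeLog (n : ℕ) : ∑ k ∈ range (n + 1), primeLog k = Chebyshev.theta n := by
  rw [Chebyshev.theta_eq_sum_Icc, Nat.floor_natCast, sum_filter]
  refine sum_congr ?_ fun _ _ => rfl
  ext; simp

lemma rPrime2Sq_eq (n : ℕ) :
    rPrime2Sq n = ∑ p ∈ range (n + 1), primeLog p * primeSquareConv (n - p) := by
  refine sum_congr rfl fun p hp => ?_
  have hpn : p ≤ n := by simpa [Nat.lt_succ_iff] using hp
  rw [primeSquareConv_eq (R := n) (by have := Nat.sub_le n p; nlinarith), sum_product, sum_filter,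
    mul_sum]
  refine sum_congr rfl fun q _ => ?_
  rw [sum_filter]
  by_cases hq : q.Prime
  · rw [if_pos hq, mul_sum]
    refine sum_congr rfl fun s _ => ?_
    unfold primeLog
    have : p + q ^ 2 + s ^ 2 = n ↔ q ^ 2 + s ^ 2 = n - p := by omega
    by_cases h1 : p.Prime <;> by_cases h2 : s.Prime <;> simp [h1, h2, hq, this, mul_assoc]
  · simp [hq]

lemma sum_rPrime2Sq (N : ℕ) :
    ∑ n ∈ range (N + 1), rPrime2Sq n =
      ∑ m ∈ range (N + 1), primeSquareConv m * Chebyshev.theta ((N - m : ℕ) : ℝ) := by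
  have h := sum_range_diag_flip (N + 1) (fun k m => primeSquareConv k * primeLog m)
  have h2 : ∀ n, rPrime2Sq n = ∑ k ∈ range (n + 1), primeSquareConv k * primeLog (n - k) := by
    intro n
    rw [rPrime2Sq_eq, ← sum_range_reflect]
    refine sum_congr rfl fun k hk => ?_
    have hk' : k ≤ n := by simpa [Nat.lt_succ_iff] using hk
    rw [show n + 1 - 1 - k = n - k by omega, Nat.sub_sub_self hk', mul_comm]
  simp_rw [h2]
  rw [h]
  refine sum_congr rfl fun m hm => ?_
  have hm' : m ≤ N := by simpa [Nat.lt_succ_iff] using hm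
  rw [← mul_sum, ← sum_primeLog, show N + 1 - m = N - m + 1 by omega]

lemma sum_primeSquareConv (N : ℕ) :
    ∑ m ∈ range (N + 1), primeSquareConv m =
      ∑ p ∈ range (Nat.sqrt N + 1),
        primeLog p * Chebyshev.theta (√((N : ℝ) - (p : ℝ) ^ 2)) := by
  have hN : N < (Nat.sqrt N + 1) ^ 2 := by
    rw [sq]; exact Nat.lt_succ_sqrt N
  have h1 : ∀ m ∈ range (N + 1), primeSquareConv m = ∑ p ∈ range (Nat.sqrt N + 1),
      ∑ q ∈ range (Nat.sqrt N + 1), if p ^ 2 + q ^ 2 = m then primeLog p * primeLog q else 0 := by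
    intro m hm
    rw [primeSquareConv_eq (R := Nat.sqrt N) (by simp at hm; omega), sum_product, sum_filter]
    refine sum_congr rfl fun p _ => ?_
    rw [sum_filter]
    unfold primeLog
    by_cases hp : p.Prime
    · simp only [hp, if_true]
      refine sum_congr rfl fun q _ => ?_
      by_cases hq : q.Prime <;> simp [hq]
    · simp [hp]
  rw [sum_congr rfl h1, sum_comm]
  refine sum_congr rfl fun p hp => ?_
  have hpN : p ^ 2 ≤ N := by
    have : p ≤ Nat.sqrt N := by simpa [Nat.lt_succ_iff] using hp
    rw [Nat.le_sqrt] at this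
    nlinarith
  rw [sum_comm, Chebyshev.theta_eq_theta_coe_floor, ← sum_primeLog, mul_sum]
  have hf : ⌊√((N : ℝ) - (p : ℝ) ^ 2)⌋₊ = Nat.sqrt (N - p ^ 2) := by
    rw [← Real.nat_floor_real_sqrt_eq_nat_sqrt]
    push_cast [hpN]
    rfl
  rw [hf]
  have hsub : range (Nat.sqrt (N - p ^ 2) + 1) ⊆ range (Nat.sqrt N + 1) := by
    intro q
    simp only [mem_range, Nat.lt_succ_iff]
    intro h
    exact h.trans (Nat.sqrt_le_sqrt (Nat.sub_le _ _))
  rw [← sum_subset hsub]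
  · refine sum_congr rfl fun q hq => ?_
    rw [sum_ite_eq, if_pos]
    simp only [mem_range, Nat.lt_succ_iff, Nat.le_sqrt] at hq ⊢
    have : q ^ 2 = q * q := sq q
    omega
  · intro q _ hq
    rw [sum_ite_eq, if_neg]
    simp only [mem_range, Nat.lt_succ_iff, Nat.le_sqrt] at hq ⊢
    have : q ^ 2 = q * q := sq q
    omega

lemma abs_sum_mul_le_of_antitone {u g : ℕ → ℝ} {E : ℝ} (n : ℕ) (hg : Antitone g)
    (hg0 : ∀ k, 0 ≤ g k) (hE : ∀ k ≤ n, |∑ i ∈ range (k + 1), u i| ≤ E) :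
    |∑ i ∈ range (n + 1), u i * g i| ≤ E * g 0 := by
  have key : ∀ n, ∑ i ∈ range (n + 1), u i * g i = (∑ i ∈ range (n + 1), u i) * g n +
      ∑ i ∈ range n, (∑ j ∈ range (i + 1), u j) * (g i - g (i + 1)) := by
    intro n
    induction n with
    | zero => simp
    | succ k ih =>
      rw [sum_range_succ, ih, sum_range_succ u (k + 1),
        sum_range_succ (fun i => (∑ j ∈ range (i + 1), u j) * (g i - g (i + 1))) k]
      ring
  have htel : ∑ i ∈ range n, E * (g i - g (i + 1)) = E * (g 0 - g n) := by
    rw [← mul_sum, sum_range_sub']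
  rw [key]
  calc _ ≤ |(∑ i ∈ range (n + 1), u i) * g n| +
      |∑ i ∈ range n, (∑ j ∈ range (i + 1), u j) * (g i - g (i + 1))| := abs_add_le _ _
    _ ≤ E * g n + ∑ i ∈ range n, E * (g i - g (i + 1)) := by
      refine add_le_add ?_ ((abs_sum_le_sum_abs _ _).trans (sum_le_sum fun i hi => ?_))
      · rw [abs_mul, abs_of_nonneg (hg0 n)]
        exact mul_le_mul_of_nonneg_right (hE n le_rfl) (hg0 n)
      · have h0 : 0 ≤ g i - g (i + 1) := sub_nonneg.2 (hg (Nat.le_succ i))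
        rw [abs_mul, abs_of_nonneg h0]
        exact mul_le_mul_of_nonneg_right (hE i (mem_range.1 hi).le) h0
    _ = E * g 0 := by rw [htel]; ring

lemma integral_sqrt_sub_sq {N b : ℝ} (hN : 0 < N) (hb : √N ≤ b) :
    ∫ t in (0 : ℝ)..b, √(N - t ^ 2) = Real.pi / 4 * N := by
  have hc : Continuous fun t : ℝ => √(N - t ^ 2) := by fun_prop
  have hc1 : Continuous fun t : ℝ => √(1 - t ^ 2) := by fun_prop
  have h1 : ∫ t in (0 : ℝ)..1, √(1 - t ^ 2) = Real.pi / 4 := by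
    have h := integral_sqrt_one_sub_sq
    rw [← intervalIntegral.integral_add_adjacent_intervals (b := 0)
      (hc1.intervalIntegrable _ _) (hc1.intervalIntegrable _ _)] at h
    have h2 := intervalIntegral.integral_comp_neg (a := (0 : ℝ)) (b := 1)
      (fun t : ℝ => √(1 - t ^ 2))
    simp only [even_two, Even.neg_pow, neg_zero] at h2
    linarith
  have hs : 0 < √N := Real.sqrt_pos.2 hN
  have h2 : ∫ t in (0 : ℝ)..√N, √(N - t ^ 2) = Real.pi / 4 * N := by
    have h3 := intervalIntegral.integral_comp_mul_left (a := 0) (b := 1)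
      (fun t : ℝ => √(N - t ^ 2)) hs.ne'
    have h4 : ∀ x : ℝ, √(N - (√N * x) ^ 2) = √N * √(1 - x ^ 2) := by
      intro x
      rw [← Real.sqrt_mul hN.le]
      congr 1
      rw [mul_pow, Real.sq_sqrt hN.le]; ring
    simp only [h4, mul_zero, mul_one, intervalIntegral.integral_const_mul, h1, smul_eq_mul] at h3
    have h5 : √N * √N = N := Real.mul_self_sqrt hN.le
    calc _ = √N * ((√N)⁻¹ * ∫ t in (0 : ℝ)..√N, √(N - t ^ 2)) := by field_simp
      _ = (√N * √N) * (Real.pi / 4) := by rw [← h3]; ring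
      _ = _ := by rw [h5]; ring
  rw [← intervalIntegral.integral_add_adjacent_intervals (b := √N)
    (hc.intervalIntegrable _ _) (hc.intervalIntegrable _ _), h2]
  have h6 : ∫ t in √N..b, √(N - t ^ 2) = 0 := by
    rw [intervalIntegral.integral_congr (g := fun _ => (0 : ℝ))]
    · simp
    · intro t ht
      rw [Set.uIcc_of_le hb] at ht
      refine Real.sqrt_eq_zero_of_nonpos ?_
      have := mul_self_le_mul_self hs.le ht.1
      rw [Real.mul_self_sqrt hN.le] at this
      nlinarith
  rw [h6, add_zero]

lemma antitoneOn_sqrt_sub_sq (N : ℝ) : AntitoneOn (fun t : ℝ => √(N - t ^ 2)) (Set.Ici 0) := by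
  intro s hs t _ hst
  have : (0 : ℝ) ≤ s := hs
  apply Real.sqrt_le_sqrt
  gcongr

lemma abs_sum_sqrt_sub_sq_sub_le {N : ℕ} (hN : 0 < N) :
    |∑ k ∈ range (Nat.sqrt N), √((N : ℝ) - ((k + 1 : ℕ) : ℝ) ^ 2) - Real.pi / 4 * N| ≤ √N := by
  set R := Nat.sqrt N with hR
  set g : ℝ → ℝ := fun t => √((N : ℝ) - t ^ 2) with hg
  have hb : √(N : ℝ) ≤ 0 + ((R + 1 : ℕ) : ℝ) := by
    rw [Real.sqrt_le_left (by positivity)]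
    have : N < (R + 1) ^ 2 := by rw [sq]; exact Nat.lt_succ_sqrt N
    rw [zero_add]
    exact_mod_cast this.le
  have hI := integral_sqrt_sub_sq (N := (N : ℝ)) (by exact_mod_cast hN) hb
  have ha : AntitoneOn g (Set.Icc 0 (0 + ((R + 1 : ℕ) : ℝ))) :=
    (antitoneOn_sqrt_sub_sq N).mono Set.Icc_subset_Ici_self
  have h1 := ha.sum_le_integral
  have h2 := ha.integral_le_sum
  simp only [zero_add] at h1 h2 hI
  rw [hI, sum_range_succ] at h1
  rw [hI, sum_range_succ'] at h2
  have h3 : 0 ≤ g ((R + 1 : ℕ) : ℝ) := Real.sqrt_nonneg _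
  have h4 : g ((0 : ℕ) : ℝ) = √N := by simp [hg]
  rw [h4] at h2
  change |∑ k ∈ range R, g ((k + 1 : ℕ) : ℝ) - Real.pi / 4 * N| ≤ √N
  rw [abs_le]
  constructor
  · linarith
  · linarith [Real.sqrt_nonneg (N : ℝ)]

lemma exists_abs_sum_primeSquareConv_sub_le (hRH : RiemannHypothesis) :
    ∃ C : ℝ, 0 < C ∧ ∀ N : ℕ, 1 ≤ N →
      |∑ m ∈ range (N + 1), primeSquareConv m - Real.pi / 4 * N| ≤
        C * (N : ℝ) ^ ((3 : ℝ) / 4) * Real.log (8 * N) ^ 2 := by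
  obtain ⟨C, hC, hθ⟩ := exists_abs_theta_sub_le hRH
  refine ⟨3 * C + 1, by positivity, fun N hN => ?_⟩
  have hN1 : (1 : ℝ) ≤ N := by exact_mod_cast hN
  have hN0 : (0 : ℝ) ≤ N := by linarith
  set X := √(N : ℝ) with hX
  have hXX : X * X = N := Real.mul_self_sqrt hN0
  have hX1 : 1 ≤ X := Real.one_le_sqrt.2 hN1
  set E := C * √X * Real.log (8 * X) ^ 2 with hE
  have hE0 : 0 ≤ E := by positivity
  set R := Nat.sqrt N with hR
  have hRX : (R : ℝ) ≤ X := Real.nat_sqrt_le_real_sqrt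
  have hNR : (N : ℝ) ^ ((3 : ℝ) / 4) = X * √X := by
    rw [hX, Real.sqrt_eq_rpow, Real.sqrt_eq_rpow, ← Real.rpow_mul hN0,
      ← Real.rpow_add (by linarith)]
    norm_num
  have hlog : 1 ≤ Real.log (8 * N) := by
    rw [Real.le_log_iff_exp_le (by positivity)]
    linarith [Real.exp_one_lt_d9]
  have hEX : E * X ≤ C * (N : ℝ) ^ ((3 : ℝ) / 4) * Real.log (8 * N) ^ 2 := by
    have h1 : 0 ≤ Real.log (8 * X) := Real.log_nonneg (by linarith)
    have h2 : Real.log (8 * X) ≤ Real.log (8 * N) := by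
      apply Real.log_le_log (by positivity)
      nlinarith
    rw [hNR, hE]
    calc _ = C * (X * √X) * Real.log (8 * X) ^ 2 := by ring
      _ ≤ _ := by gcongr
  have hXle : X ≤ (N : ℝ) ^ ((3 : ℝ) / 4) * Real.log (8 * N) ^ 2 := by
    have h1 : 1 ≤ √X := Real.one_le_sqrt.2 hX1
    have h2 : 1 ≤ Real.log (8 * N) ^ 2 := one_le_pow₀ hlog
    rw [hNR]
    calc X = X * 1 * 1 := by ring
      _ ≤ _ := by gcongr
  have hg : ∀ p ∈ range (R + 1), (0 : ℝ) ≤ (N : ℝ) - (p : ℝ) ^ 2 := by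
    intro p hp
    have hp' : p ≤ R := by simpa [Nat.lt_succ_iff] using hp
    have : (p : ℝ) ≤ X := le_trans (by exact_mod_cast hp') hRX
    have := mul_self_le_mul_self (Nat.cast_nonneg p) this
    nlinarith
  set g : ℕ → ℝ := fun p => √((N : ℝ) - (p : ℝ) ^ 2) with hgdef
  have hganti : Antitone g := by
    intro p q hpq
    exact antitoneOn_sqrt_sub_sq N (Set.mem_Ici.2 p.cast_nonneg) (Set.mem_Ici.2 q.cast_nonneg)
      (by exact_mod_cast hpq)
  have hg0 : g 0 = X := by simp [hgdef, hX]
  have hθX : Chebyshev.theta X ≤ 2 * X := by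
    have h4 : Real.log 4 ≤ 2 := by
      rw [Real.log_le_iff_le_exp (by norm_num)]
      have : Real.exp 2 = Real.exp 1 * Real.exp 1 := by rw [← Real.exp_add]; norm_num
      nlinarith [Real.exp_one_gt_d9]
    exact (Chebyshev.theta_le_log4_mul_x (by linarith)).trans (by gcongr)
  have e1 : |∑ p ∈ range (R + 1), primeLog p * Chebyshev.theta (g p) -
      ∑ p ∈ range (R + 1), primeLog p * g p| ≤ 2 * (E * X) := by
    rw [← sum_sub_distrib]
    refine (abs_sum_le_sum_abs _ _).trans ?_
    calc _ ≤ ∑ p ∈ range (R + 1), primeLog p * E := by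
          refine sum_le_sum fun p hp => ?_
          rw [← mul_sub, abs_mul, abs_of_nonneg (primeLog_nonneg p)]
          refine mul_le_mul_of_nonneg_left (hθ X (g p) hX1 (Real.sqrt_nonneg _) ?_)
            (primeLog_nonneg p)
          rw [← hg0]
          exact hganti (Nat.zero_le p)
      _ = Chebyshev.theta R * E := by rw [← sum_mul, sum_primeLog]
      _ ≤ (2 * X) * E := by
          gcongr
          exact (Chebyshev.theta_mono hRX).trans hθX
      _ = _ := by ring
  have e2 : |∑ p ∈ range (R + 1), (primeLog p - if p = 0 then 0 else 1) * g p| ≤ E * g 0 := by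
    refine abs_sum_mul_le_of_antitone R hganti (fun _ => Real.sqrt_nonneg _) fun k hk => ?_
    rw [sum_sub_distrib, sum_primeLog]
    have : ∑ i ∈ range (k + 1), (if i = 0 then (0 : ℝ) else 1) = k := by
      rw [sum_range_succ']
      simp
    rw [this]
    exact hθ X k hX1 k.cast_nonneg (le_trans (by exact_mod_cast hk) hRX)
  have e3 : ∑ p ∈ range (R + 1), (primeLog p - if p = 0 then 0 else 1) * g p =
      ∑ p ∈ range (R + 1), primeLog p * g p -
        ∑ k ∈ range R, √((N : ℝ) - ((k + 1 : ℕ) : ℝ) ^ 2) := by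
    simp_rw [sub_mul]
    rw [sum_sub_distrib, sum_range_succ' (fun p => (if p = 0 then (0 : ℝ) else 1) * g p)]
    simp [hgdef]
  have e4 := abs_sum_sqrt_sub_sq_sub_le (N := N) hN
  rw [e3, hg0] at e2
  rw [sum_primeSquareConv]
  change |∑ p ∈ range (R + 1), primeLog p * Chebyshev.theta (g p) - _| ≤ _
  rw [abs_le] at e1 e2 e4 ⊢
  constructor <;> linarith [e1.1, e1.2, e2.1, e2.2, e4.1, e4.2]

lemma psi_sub_theta_mono : Monotone fun x => Chebyshev.psi x - Chebyshev.theta x := by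
  intro x y hxy
  simp only [Chebyshev.psi_sub_theta_eq_sum_not_prime]
  refine sum_le_sum_of_subset_of_nonneg (filter_subset_filter _ ?_) fun _ _ _ =>
    ArithmeticFunction.vonMangoldt_nonneg
  exact Ioc_subset_Ioc_right (Nat.floor_mono hxy)

lemma sum_Ioc_sub_shift_le {h : ℕ → ℝ} (hh : Monotone h) (h0 : ∀ n, 0 ≤ h n) (N H : ℕ) :
    ∑ k ∈ Ioc H N, (h (k + H) - h k) ≤ H * h (N + H) := by
  calc _ ≤ ∑ k ∈ range (N + 1), (h (k + H) - h k) := by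
        refine sum_le_sum_of_subset_of_nonneg ?_ fun k _ _ => sub_nonneg.2 (hh (by omega))
        intro k hk
        simp only [mem_Ioc, mem_range] at *
        omega
    _ = ∑ k ∈ range (N + 1), h (k + H) - ∑ k ∈ range (N + 1), h k := sum_sub_distrib ..
    _ ≤ ∑ k ∈ range H, h (N + 1 + k) := by
        have e1 := sum_range_add (fun k => h k) H (N + 1)
        have e2 := sum_range_add (fun k => h k) (N + 1) H
        have e3 : ∑ k ∈ range (N + 1), h (k + H) = ∑ k ∈ range (N + 1), h (H + k) := by
          simp_rw [add_comm]
        have e4 : 0 ≤ ∑ k ∈ range H, h k := sum_nonneg fun k _ => h0 k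
        rw [add_comm H (N + 1)] at e1
        linarith
    _ ≤ ∑ k ∈ range H, h (N + H) := sum_le_sum fun k hk => hh (by have := mem_range.1 hk; omega)
    _ = _ := by simp

lemma exists_sum_theta_sq_le (hRH : RiemannHypothesis) :
    ∃ C : ℝ, 0 < C ∧ ∀ N H : ℕ, 1 ≤ H → H ≤ N →
      ∑ m ∈ Ioc H N, (Chebyshev.theta ((m + H : ℕ) : ℝ) - Chebyshev.theta m - H) ^ 2 ≤
        C * H * N * Real.log (8 * N) ^ 2 := by
  obtain ⟨C, hC, hψ⟩ := exists_sum_psi_sq_le hRH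
  obtain ⟨K, hK⟩ := Chebyshev.psi_sub_theta_le_mul_sqrt
  refine ⟨2 * C + 4 * K ^ 2, by positivity, fun N H hH hHN => ?_⟩
  have hHr : (1 : ℝ) ≤ H := by exact_mod_cast hH
  have hHNr : (H : ℝ) ≤ N := by exact_mod_cast hHN
  set h : ℕ → ℝ := fun n => Chebyshev.psi n - Chebyshev.theta n with hh
  have hmono : Monotone h := fun a b hab => psi_sub_theta_mono (by exact_mod_cast hab)
  have h0 : ∀ n, 0 ≤ h n := fun n => sub_nonneg.2 (Chebyshev.theta_le_psi _)
  have hB := hK ((N + H : ℕ) : ℝ)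
  have hB0 := h0 (N + H)
  have hB2 : h (N + H) ^ 2 ≤ K ^ 2 * (2 * N) := by
    calc h (N + H) ^ 2 ≤ (K * √((N + H : ℕ) : ℝ)) ^ 2 := by gcongr
      _ = K ^ 2 * ((N + H : ℕ) : ℝ) := by rw [mul_pow, Real.sq_sqrt (by positivity)]
      _ ≤ _ := by push_cast; gcongr; linarith
  have hlog : 1 ≤ Real.log (8 * N) := by
    rw [Real.le_log_iff_exp_le (by linarith)]
    linarith [Real.exp_one_lt_d9]
  have hlog2 : 1 ≤ Real.log (8 * N) ^ 2 := one_le_pow₀ hlog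
  have hd : ∑ m ∈ Ioc H N, (h (m + H) - h m) ^ 2 ≤ 2 * K ^ 2 * H * N := by
    calc _ ≤ ∑ m ∈ Ioc H N, h (N + H) * (h (m + H) - h m) := by
          refine sum_le_sum fun m hm => ?_
          rw [mem_Ioc] at hm
          have a1 : 0 ≤ h (m + H) - h m := sub_nonneg.2 (hmono (by omega))
          have a2 : h (m + H) ≤ h (N + H) := hmono (by omega)
          have a3 := h0 m
          rw [sq]
          gcongr
          linarith
      _ = h (N + H) * ∑ m ∈ Ioc H N, (h (m + H) - h m) := by rw [mul_sum]
      _ ≤ h (N + H) * (H * h (N + H)) := by gcongr; exact sum_Ioc_sub_shift_le hmono h0 N H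
      _ = H * h (N + H) ^ 2 := by ring
      _ ≤ H * (K ^ 2 * (2 * N)) := by gcongr
      _ = _ := by ring
  calc _ ≤ ∑ m ∈ Ioc H N, (2 * (Chebyshev.psi ((m + H : ℕ) : ℝ) - Chebyshev.psi m - H) ^ 2 +
        2 * (h (m + H) - h m) ^ 2) := by
        refine sum_le_sum fun m _ => ?_
        simp only [hh]
        nlinarith [sq_nonneg ((Chebyshev.psi ((m + H : ℕ) : ℝ) - Chebyshev.psi m - H) +
          (Chebyshev.psi ((m + H : ℕ) : ℝ) - Chebyshev.theta ((m + H : ℕ) : ℝ) -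
            (Chebyshev.psi m - Chebyshev.theta m)))]
    _ ≤ 2 * (C * H * N * Real.log (8 * N) ^ 2) + 2 * (2 * K ^ 2 * H * N * 1) := by
        rw [sum_add_distrib, ← mul_sum, ← mul_sum]
        have := hψ N H hH hHN
        gcongr
        linarith
    _ ≤ 2 * (C * H * N * Real.log (8 * N) ^ 2) +
        2 * (2 * K ^ 2 * H * N * Real.log (8 * N) ^ 2) := by gcongr
    _ = _ := by ring

lemma sum_Ioc_rPrime2Sq (N H : ℕ) :
    ∑ n ∈ Ioc N (N + H), rPrime2Sq n - H * ∑ m ∈ range (N + 1), primeSquareConv m =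
      ∑ k ∈ range (N + 1), primeSquareConv (N - k) *
        (Chebyshev.theta ((k + H : ℕ) : ℝ) - Chebyshev.theta k - H) +
      ∑ k ∈ range H, primeSquareConv (N + 1 + k) *
        Chebyshev.theta ((N + H - (N + 1 + k) : ℕ) : ℝ) := by
  have h1 : ∑ n ∈ Ioc N (N + H), rPrime2Sq n =
      ∑ n ∈ range (N + H + 1), rPrime2Sq n - ∑ n ∈ range (N + 1), rPrime2Sq n := by
    rw [show N + H + 1 = N + 1 + H by ring, sum_range_add, add_sub_cancel_left,
      ← Finset.Ico_add_one_add_one_eq_Ioc, sum_Ico_eq_sum_range,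
      show N + H + 1 - (N + 1) = H by omega]
  have h2 : ∀ f : ℕ → ℝ, ∑ k ∈ range (N + 1), f k = ∑ k ∈ range (N + 1), f (N - k) := by
    intro f
    rw [← sum_range_reflect]
    simp
  rw [h1, sum_rPrime2Sq, sum_rPrime2Sq, show N + H + 1 = N + 1 + H by ring, sum_range_add,
    h2 (fun m => primeSquareConv m), h2 (fun m => primeSquareConv m * _), h2 (fun m =>
      primeSquareConv m * Chebyshev.theta ((N - m : ℕ) : ℝ)), mul_sum, add_sub_right_comm,
    add_sub_right_comm, ← sum_sub_distrib, ← sum_sub_distrib]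
  congr 1
  refine sum_congr rfl fun k hk => ?_
  have hk' : k ≤ N := by simpa [Nat.lt_succ_iff] using hk
  rw [show N + H - (N - k) = k + H by omega, Nat.sub_sub_self hk']
  ring

lemma sq_sum_Ioc_mul_le {N H : ℕ} (Δ : ℕ → ℝ) :
    (∑ k ∈ Ioc H N, primeSquareConv (N - k) * Δ k) ^ 2 ≤
      (∑ m ∈ range (N + 1), primeSquareConv m ^ 2) * ∑ k ∈ Ioc H N, Δ k ^ 2 := by
  refine (sum_mul_sq_le_sq_mul_sq _ _ _).trans ?_
  refine mul_le_mul_of_nonneg_right ?_ (sum_nonneg fun _ _ => sq_nonneg _)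
  have h : ∑ m ∈ range (N + 1), primeSquareConv m ^ 2 =
      ∑ k ∈ range (N + 1), primeSquareConv (N - k) ^ 2 := by
    rw [← sum_range_reflect]
    simp
  rw [h]
  refine sum_le_sum_of_subset_of_nonneg ?_ fun _ _ _ => sq_nonneg _
  intro k hk
  simp only [mem_Ioc, mem_range] at *
  omega

lemma exists_abs_sum_rPrime2Sq_sub_le (hRH : RiemannHypothesis) :
    ∃ (C : ℝ) (N0 : ℕ), 0 < C ∧ ∀ N H : ℕ, N0 ≤ N → 1 ≤ H → H ≤ N →
      |∑ n ∈ Ioc N (N + H), rPrime2Sq n - Real.pi / 4 * H * N| ≤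
        C * (√H * N * Real.log N ^ 2 + H * (N : ℝ) ^ ((3 : ℝ) / 4) * Real.log N ^ 2 +
          (H : ℝ) ^ 2) := by
  obtain ⟨A, hA, hV⟩ := exists_abs_sum_primeSquareConv_sub_le hRH
  obtain ⟨B, hB, hθ⟩ := exists_abs_theta_sub_le hRH
  obtain ⟨D, hD, hΔ⟩ := exists_sum_theta_sq_le hRH
  obtain ⟨G, N1, hG, hν⟩ := exists_sum_primeSquareConv_sq_le
  refine ⟨28 * A + 16 * B * (1 + 256 * A) + 2 * √(G * D) + 2, max N1 16, by positivity,
    fun N H hN hH hHN => ?_⟩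
  have hN1 : N1 ≤ N := (le_max_left _ _).trans hN
  have hN16 : 16 ≤ N := (le_max_right _ _).trans hN
  have hNr : (16 : ℝ) ≤ N := by exact_mod_cast hN16
  have hHr : (1 : ℝ) ≤ H := by exact_mod_cast hH
  have hHNr : (H : ℝ) ≤ N := by exact_mod_cast hHN
  set L := Real.log N with hL
  have hL1 : 1 ≤ L := by
    rw [hL, Real.le_log_iff_exp_le (by linarith)]
    linarith [Real.exp_one_lt_d9]
  have hL16 : Real.log (16 * N) ≤ 2 * L := by
    rw [Real.log_mul (by norm_num) (by linarith), two_mul]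
    have := Real.log_le_log (by norm_num) hNr
    linarith
  have hL8 : Real.log (8 * N) ≤ 2 * L :=
    (Real.log_le_log (by linarith) (by linarith)).trans hL16
  have hL80 : 0 ≤ Real.log (8 * N) := Real.log_nonneg (by linarith)
  set P := (N : ℝ) ^ ((3 : ℝ) / 4) with hP
  have hP0 : 0 ≤ P := by positivity
  set ν := primeSquareConv with hνdef
  set W := ∑ m ∈ range (N + 1), ν m with hW
  have hWa : |W - Real.pi / 4 * N| ≤ 4 * A * P * L ^ 2 := by
    refine (hV N (by omega)).trans ?_
    calc _ ≤ A * P * (2 * L) ^ 2 := by gcongr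
      _ = _ := by ring
  set W' := ∑ m ∈ range (N + H + 1), ν m with hW'
  have hWa' : |W' - Real.pi / 4 * (N + H)| ≤ 8 * A * P * L ^ 2 := by
    have h := hV (N + H) (by omega)
    push_cast at h
    refine h.trans ?_
    have h1 : ((N : ℝ) + H) ^ ((3 : ℝ) / 4) ≤ 2 * P := by
      calc ((N : ℝ) + H) ^ ((3 : ℝ) / 4) ≤ (2 * N : ℝ) ^ ((3 : ℝ) / 4) := by gcongr; linarith
        _ = (2 : ℝ) ^ ((3 : ℝ) / 4) * P := by rw [Real.mul_rpow (by norm_num) (by linarith)]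
        _ ≤ 2 * P := by
          gcongr
          calc (2 : ℝ) ^ ((3 : ℝ) / 4) ≤ (2 : ℝ) ^ (1 : ℝ) := by gcongr <;> norm_num
            _ = 2 := Real.rpow_one _
    have h2 : 0 ≤ Real.log (8 * (N + H)) := Real.log_nonneg (by linarith)
    have h3 : Real.log (8 * (N + H)) ≤ 2 * L :=
      (Real.log_le_log (by linarith) (by linarith)).trans hL16
    calc _ ≤ A * (2 * P) * (2 * L) ^ 2 := by gcongr
      _ = _ := by ring
  have hpi : Real.pi / 4 ≤ 1 := by linarith [Real.pi_le_four]
  have hpi0 : 0 ≤ Real.pi / 4 := by positivity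
  have hW0 : 0 ≤ W := sum_nonneg fun m _ => primeSquareConv_nonneg m
  have hWW : W' - W = ∑ k ∈ range H, ν (N + 1 + k) := by
    rw [hW', show N + H + 1 = N + 1 + H by ring, sum_range_add]
    ring
  have hlast0 : 0 ≤ ∑ k ∈ range H, ν (N + 1 + k) *
      Chebyshev.theta ((N + H - (N + 1 + k) : ℕ) : ℝ) :=
    sum_nonneg fun k _ => mul_nonneg (primeSquareConv_nonneg _) (Chebyshev.theta_nonneg _)
  have hlast : ∑ k ∈ range H, ν (N + 1 + k) *
      Chebyshev.theta ((N + H - (N + 1 + k) : ℕ) : ℝ) ≤ 2 * H * (H + 12 * A * P * L ^ 2) := by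
    have h4 : Real.log 4 ≤ 2 := by
      rw [Real.log_le_iff_le_exp (by norm_num)]
      have : Real.exp 2 = Real.exp 1 * Real.exp 1 := by rw [← Real.exp_add]; norm_num
      nlinarith [Real.exp_one_gt_d9]
    calc _ ≤ ∑ k ∈ range H, ν (N + 1 + k) * (2 * H) := by
          refine sum_le_sum fun k _ => mul_le_mul_of_nonneg_left ?_ (primeSquareConv_nonneg _)
          refine (Chebyshev.theta_le_log4_mul_x (Nat.cast_nonneg _)).trans ?_
          have : ((N + H - (N + 1 + k) : ℕ) : ℝ) ≤ H := by
            exact_mod_cast (by omega : N + H - (N + 1 + k) ≤ H)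
          gcongr
      _ = 2 * H * (W' - W) := by rw [← sum_mul, hWW]; ring
      _ ≤ _ := by
          gcongr
          rw [abs_le] at hWa hWa'
          nlinarith [hWa.1, hWa'.2]
  set Δ : ℕ → ℝ := fun k => Chebyshev.theta ((k + H : ℕ) : ℝ) - Chebyshev.theta k - H with hΔdef
  have hsqH : √(2 * H : ℝ) ≤ 2 * √H := by
    rw [Real.sqrt_le_left (by positivity), mul_pow, Real.sq_sqrt (by linarith)]
    linarith
  have hΔsup : ∀ k ≤ H, |Δ k| ≤ 16 * B * √H * L ^ 2 := by
    intro k hk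
    have hkr : (k : ℝ) ≤ H := by exact_mod_cast hk
    have h1 := hθ (2 * H) ((k + H : ℕ) : ℝ) (by linarith) (Nat.cast_nonneg _)
      (by push_cast; linarith)
    have h2 := hθ (2 * H) k (by linarith) (Nat.cast_nonneg _) (by linarith)
    have h3 : B * √(2 * H : ℝ) * Real.log (8 * (2 * H)) ^ 2 ≤ 8 * B * √H * L ^ 2 := by
      have h4 : 0 ≤ Real.log (8 * (2 * H)) := Real.log_nonneg (by linarith)
      have h5 : Real.log (8 * (2 * H)) ≤ 2 * L :=
        (Real.log_le_log (by linarith) (by linarith)).trans hL16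
      calc _ ≤ B * (2 * √H) * (2 * L) ^ 2 := by gcongr
        _ = _ := by ring
    push_cast at h1
    simp only [hΔdef]
    push_cast
    rw [abs_le] at *
    constructor <;> linarith [h1.1, h1.2, h2.1, h2.2]
  have hWN : W ≤ (1 + 256 * A) * N := by
    have h1 : L ^ 2 ≤ 64 * (N : ℝ) ^ ((1 : ℝ) / 4) := by
      have h2 := Real.log_le_rpow_div (x := (N : ℝ)) (ε := 1 / 8) (by linarith) (by norm_num)
      have h3 : ((N : ℝ) ^ ((1 : ℝ) / 8)) ^ 2 = (N : ℝ) ^ ((1 : ℝ) / 4) := by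
        rw [← Real.rpow_natCast, ← Real.rpow_mul (by linarith)]
        norm_num
      calc L ^ 2 ≤ ((N : ℝ) ^ ((1 : ℝ) / 8) / (1 / 8)) ^ 2 := by gcongr
        _ = 64 * ((N : ℝ) ^ ((1 : ℝ) / 8)) ^ 2 := by ring
        _ = _ := by rw [h3]
    have h4 : P * (N : ℝ) ^ ((1 : ℝ) / 4) = N := by
      rw [hP, ← Real.rpow_add (by linarith)]
      norm_num
    have h5 : P * L ^ 2 ≤ 64 * N := by
      calc P * L ^ 2 ≤ P * (64 * (N : ℝ) ^ ((1 : ℝ) / 4)) := by gcongr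
        _ = 64 * (P * (N : ℝ) ^ ((1 : ℝ) / 4)) := by ring
        _ = _ := by rw [h4]
    rw [abs_le] at hWa
    nlinarith [hWa.2]
  have hsplit : ∑ k ∈ range (N + 1), ν (N - k) * Δ k =
      ∑ k ∈ range (H + 1), ν (N - k) * Δ k + ∑ k ∈ Ioc H N, ν (N - k) * Δ k := by
    rw [← Finset.Ico_add_one_add_one_eq_Ioc, sum_range_add_sum_Ico _ (by omega)]
  have hnear : |∑ k ∈ range (H + 1), ν (N - k) * Δ k| ≤
      16 * B * (1 + 256 * A) * (√H * N * L ^ 2) := by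
    calc _ ≤ ∑ k ∈ range (H + 1), ν (N - k) * (16 * B * √H * L ^ 2) := by
          refine (abs_sum_le_sum_abs _ _).trans (sum_le_sum fun k hk => ?_)
          rw [abs_mul, abs_of_nonneg (primeSquareConv_nonneg _)]
          exact mul_le_mul_of_nonneg_left (hΔsup k (by have := mem_range.1 hk; omega))
            (primeSquareConv_nonneg _)
      _ ≤ ∑ k ∈ range (N + 1), ν (N - k) * (16 * B * √H * L ^ 2) := by
          refine sum_le_sum_of_subset_of_nonneg (range_subset_range.2 (by omega)) fun k _ _ =>
            mul_nonneg (primeSquareConv_nonneg _) (by positivity)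
      _ = W * (16 * B * √H * L ^ 2) := by
          rw [← sum_mul, hW, ← sum_range_reflect ν]
          simp
      _ ≤ ((1 + 256 * A) * N) * (16 * B * √H * L ^ 2) := by gcongr
      _ = _ := by ring
  have hfar : |∑ k ∈ Ioc H N, ν (N - k) * Δ k| ≤ 2 * √(G * D) * (√H * N * L ^ 2) := by
    refine abs_le_of_sq_le_sq ((sq_sum_Ioc_mul_le Δ).trans ?_) (by positivity)
    calc _ ≤ (G * N * L ^ 2) * (D * H * N * (2 * L) ^ 2) := by
          have h1 := hν N hN1
          have h2 := hΔ N H hH hHN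
          have h3 : D * H * N * Real.log (8 * N) ^ 2 ≤ D * H * N * (2 * L) ^ 2 := by gcongr
          exact mul_le_mul h1 (h2.trans h3) (sum_nonneg fun _ _ => sq_nonneg _) (by positivity)
      _ = 4 * (G * D) * H * (N * L ^ 2) ^ 2 := by ring
      _ = 4 * √(G * D) ^ 2 * √H ^ 2 * (N * L ^ 2) ^ 2 := by
          rw [Real.sq_sqrt (by positivity), Real.sq_sqrt (by positivity)]
      _ = _ := by ring
  have hmain := sum_Ioc_rPrime2Sq N H
  have hHW : |H * W - Real.pi / 4 * H * N| ≤ 4 * A * (H * P * L ^ 2) := by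
    calc _ = H * |W - Real.pi / 4 * N| := by
          rw [← abs_of_nonneg (by linarith : (0 : ℝ) ≤ H), ← abs_mul,
            abs_of_nonneg (by linarith : (0 : ℝ) ≤ H)]
          ring_nf
      _ ≤ H * (4 * A * P * L ^ 2) := by gcongr
      _ = _ := by ring
  have q1 : 0 ≤ √H * N * L ^ 2 := by positivity
  have q2 : 0 ≤ H * P * L ^ 2 := by positivity
  have q3 : (0 : ℝ) ≤ (H : ℝ) ^ 2 := by positivity
  have q4 : 0 ≤ √(G * D) := Real.sqrt_nonneg _
  calc _ ≤ |∑ k ∈ range (H + 1), ν (N - k) * Δ k| + |∑ k ∈ Ioc H N, ν (N - k) * Δ k| +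
        |∑ k ∈ range H, ν (N + 1 + k) * Chebyshev.theta ((N + H - (N + 1 + k) : ℕ) : ℝ)| +
        |H * W - Real.pi / 4 * H * N| := by
        rw [hsplit] at hmain
        rw [show ∑ n ∈ Ioc N (N + H), rPrime2Sq n - Real.pi / 4 * H * N =
          (∑ n ∈ Ioc N (N + H), rPrime2Sq n - H * W) + (H * W - Real.pi / 4 * H * N) by ring,
          hmain]
        exact (abs_add_le _ _).trans (add_le_add_left
          ((abs_add_le _ _).trans (add_le_add_left (abs_add_le _ _) _)) _)
    _ ≤ 16 * B * (1 + 256 * A) * (√H * N * L ^ 2) + 2 * √(G * D) * (√H * N * L ^ 2) +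
        (2 * H ^ 2 + 24 * A * (H * P * L ^ 2)) + 4 * A * (H * P * L ^ 2) := by
        rw [abs_of_nonneg hlast0]
        gcongr
        exact hlast.trans_eq (by ring)
    _ = (16 * B * (1 + 256 * A) + 2 * √(G * D)) * (√H * N * L ^ 2) +
        28 * A * (H * P * L ^ 2) + 2 * H ^ 2 := by ring
    _ ≤ (28 * A + 16 * B * (1 + 256 * A) + 2 * √(G * D) + 2) * (√H * N * L ^ 2) +
        (28 * A + 16 * B * (1 + 256 * A) + 2 * √(G * D) + 2) * (H * P * L ^ 2) +
        (28 * A + 16 * B * (1 + 256 * A) + 2 * √(G * D) + 2) * H ^ 2 := by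
        have b1 : 0 ≤ 16 * B * (1 + 256 * A) := by positivity
        refine add_le_add (add_le_add ?_ ?_) ?_ <;>
          exact mul_le_mul_of_nonneg_right (by linarith) (by assumption)
    _ = _ := by ring

/-- Assuming RH, `∑_{n=N+1}^{N+H} r(n) = (π/4) H N`
`+ O(H^{1/2} N log²N + H N^{3/4} log³N + H² log^{3/2} N)` as `N → ∞`, uniformly for
`(log N)⁴ = o(H)` and `H = o(N (log N)^{−3/2})`. -/
theorem prime_plus_two_prime_squares_short_intervals
    (hRH : RiemannHypothesis) (H : ℕ → ℕ)
    (hlow : Tendsto (fun N : ℕ => Real.log N ^ 4 / H N) atTop (nhds 0))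
    (hupp : Tendsto (fun N : ℕ => (H N : ℝ) / ((N : ℝ) * Real.log N ^ (-(3 : ℝ) / 2)))
      atTop (nhds 0)) :
    (fun N : ℕ => (∑ n ∈ Finset.Ioc N (N + H N), rPrime2Sq n) - Real.pi / 4 * H N * N)
      =O[atTop]
    (fun N : ℕ => (H N : ℝ) ^ ((1 : ℝ) / 2) * N * Real.log N ^ 2 +
      (H N : ℝ) * (N : ℝ) ^ ((3 : ℝ) / 4) * Real.log N ^ 3 +
      (H N : ℝ) ^ 2 * Real.log N ^ ((3 : ℝ) / 2)) := by
  obtain ⟨C, N0, hC, h⟩ := exists_abs_sum_rPrime2Sq_sub_le hRH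
  refine IsBigO.of_bound C ?_
  filter_upwards [eventually_ge_atTop N0, eventually_ge_atTop 16,
    hupp.eventually_lt_const one_pos] with N hN hN16 hlt
  have hNr : (16 : ℝ) ≤ N := by exact_mod_cast hN16
  have hL1 : 1 ≤ Real.log N := by
    rw [Real.le_log_iff_exp_le (by linarith)]
    linarith [Real.exp_one_lt_d9]
  have hHN : H N ≤ N := by
    have h1 : Real.log N ^ (-(3 : ℝ) / 2) ≤ 1 :=
      Real.rpow_le_one_of_one_le_of_nonpos hL1 (by norm_num)
    have h2 : 0 < Real.log N ^ (-(3 : ℝ) / 2) := Real.rpow_pos_of_pos (by linarith) _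
    rw [div_lt_one (by positivity)] at hlt
    have h3 : (H N : ℝ) ≤ N := by nlinarith
    exact_mod_cast h3
  rcases Nat.eq_zero_or_pos (H N) with h0 | hpos
  · rw [h0]
    simp
  rw [Real.norm_eq_abs, Real.norm_of_nonneg (by positivity), ← Real.sqrt_eq_rpow]
  refine (h N (H N) hN hpos hHN).trans ?_
  have h3 : Real.log N ^ 2 ≤ Real.log N ^ 3 := pow_le_pow_right₀ hL1 (by norm_num)
  have h4 : 1 ≤ Real.log N ^ ((3 : ℝ) / 2) := Real.one_le_rpow hL1 (by norm_num)
  gcongr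
  exact le_mul_of_one_le_right (by positivity) h4
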